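/- arXiv:2601.05863 — 2 statements merged into one kernel-verified Lean document; each statement's English description precedes it below -/
import Mathlib

section
/- Let Z be a compact subset of the unit sphere S² of ℝ³, let 𝔛 be a Z-valued switched Bebutov shift, and let φ ∈ 𝔛. Then there exists a periodic element χ ∈ 𝔛 such that χ(t) belongs to the ω-limit set ω(φ) for every t ≥ 0. -/
open scoped NNReal
open Filter Topology

/-- The shift semiflow `σ^τ` on `C([0,∞), Z)`. -/
noncomputable def bebShift {Z : Type*} [TopologicalSpace Z] (τ : ℝ≥0) (φ : C(ℝ≥0, Z)) :
    C(ℝ≥0, Z) :=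
  φ.comp ⟨fun t => t + τ, continuous_id.add continuous_const⟩

/-- A `Z`-valued switched Bebutov shift: a compact, shift-invariant subset of `C([0,∞), Z)`
(with the compact-open topology) satisfying the switching axiom. -/
def IsSwitchedBebutovShift {Z : Type*} [TopologicalSpace Z] (X : Set C(ℝ≥0, Z)) : Prop :=
  IsCompact X ∧
  (∀ φ ∈ X, ∀ τ : ℝ≥0, bebShift τ φ ∈ X) ∧
  (∀ φ₁ ∈ X, ∀ φ₂ ∈ X, ∀ τ : ℝ≥0, 0 < τ → φ₁ τ = φ₂ τ →
    ∀ ψ : C(ℝ≥0, Z), (∀ t, t ≤ τ → ψ t = φ₁ t) → (∀ t, τ ≤ t → ψ t = φ₂ t) → ψ ∈ X)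

/-- Nonvanishing complex functions on simply connected spaces have continuous logarithms. -/
theorem exists_continuous_log {A : Type*} [TopologicalSpace A] [SimplyConnectedSpace A]
    [LocallyPathConnectedSpace A] (F : A → ℂ) (hF : Continuous F) (h0 : ∀ x, F x ≠ 0) :
    ∃ L : A → ℂ, Continuous L ∧ ∀ x, Complex.exp (L x) = F x := by
  obtain ⟨a₀⟩ : Nonempty A := inferInstance
  obtain ⟨L, ⟨-, hL⟩, -⟩ := Complex.isCoveringMapOn_exp.existsUnique_continuousMap_lifts
    ⟨F, hF⟩ (a₀ := a₀) (e₀ := Complex.log (F a₀)) (by simp [Complex.exp_log (h0 a₀)])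
    (by simpa using h0)
  exact ⟨L, L.continuous, fun x => congrFun hL x⟩

/-- A continuous function whose exponential is constant on a preconnected set is constant there. -/
theorem IsPreconnected.eq_of_exp_eq {A : Type*} [TopologicalSpace A] {S : Set A}
    (hS : IsPreconnected S) {h : A → ℂ} (hc : ContinuousOn h S) {c : ℂ}
    (he : ∀ x ∈ S, Complex.exp (h x) = c) {x y : A} (hx : x ∈ S) (hy : y ∈ S) :
    h x = h y := by
  have hd : DiscreteTopology (AddSubgroup.zmultiples (2 * Real.pi * Complex.I) : Set ℂ) :=
    NormedSpace.discreteTopology_zmultiples (2 * Real.pi * Complex.I)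
  have hm : Set.MapsTo (fun z => h z - h y) S
      (AddSubgroup.zmultiples (2 * Real.pi * Complex.I) : Set ℂ) := by
    intro z hz
    have : Complex.exp (h z) = Complex.exp (h y) := by rw [he z hz, he y hy]
    obtain ⟨n, hn⟩ := Complex.exp_eq_exp_iff_exists_int.1 this
    exact ⟨n, by simp [hn]⟩
  have := hS.constant_of_mapsTo ⟨hd⟩ (hc.sub continuousOn_const) hm hx hy
  simpa [sub_eq_zero] using this

theorem norm_log_le_of_norm_sub_le {A B : ℂ} {ε : ℝ} (hε : ε ≤ 1 / 2) (hB : B ≠ 0)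
    (h : ‖A - B‖ ≤ ε * ‖B‖) : ‖Complex.log (A / B)‖ ≤ 3 / 2 * ε := by
  have hB' : 0 < ‖B‖ := norm_pos_iff.2 hB
  have h1 : ‖(A - B) / B‖ ≤ ε := by rw [norm_div, div_le_iff₀ hB']; exact h
  have h2 : A / B = 1 + (A - B) / B := by field_simp; ring
  rw [h2]
  exact (Complex.norm_log_one_add_half_le_self (h1.trans hε)).trans (by linarith)

theorem div_mem_slitPlane_of_norm_sub_lt {A B : ℂ} (h : ‖A - B‖ < ‖B‖) :
    A / B ∈ Complex.slitPlane := by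
  have hB' : 0 < ‖B‖ := (norm_nonneg _).trans_lt h
  have hB : B ≠ 0 := norm_pos_iff.1 hB'
  have h1 : ‖(A - B) / B‖ < 1 := by rw [norm_div, div_lt_one hB']; exact h
  have h2 : A / B = 1 + (A - B) / B := by field_simp; ring
  rw [h2]
  exact Complex.mem_slitPlane_of_norm_lt_one h1

theorem div_mem_slitPlane_of_notMem_segment {A B z : ℂ} (h : z ∉ segment ℝ A B) :
    (z - A) / (z - B) ∈ Complex.slitPlane := by
  by_contra hn
  apply h
  by_cases hB : z = B
  · subst hB; exact right_mem_segment _ _ _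
  have hB' : z - B ≠ 0 := sub_ne_zero.2 hB
  rw [Complex.mem_slitPlane_iff] at hn
  push Not at hn
  obtain ⟨h1, h2⟩ := hn
  set r := (z - A) / (z - B) with hr
  have hrr : r = ((-(-r.re) : ℝ) : ℂ) := by
    apply Complex.ext <;> simp [h2]
  set l := -r.re
  have hl : 0 ≤ l := by linarith
  have h3 : z - A = -(l : ℂ) * (z - B) := by
    rw [eq_comm, ← eq_div_iff hB', ← hr, hrr]; simp
  refine ⟨1 / (1 + l), l / (1 + l), by positivity, by positivity, by field_simp, ?_⟩
  have h4 : (1 + (l : ℂ)) ≠ 0 := by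
    have : (1 + l : ℝ) ≠ 0 := by positivity
    exact_mod_cast this
  simp only [Complex.real_smul]
  push_cast
  field_simp
  linear_combination -h3

/-- Along an interval, two logarithms of nearly proportional functions have nearly the same
increment. -/
theorem norm_log_increment_sub_le {A B : ℝ → ℂ} {a b : ℝ} (hab : a ≤ b)
    (hA : ContinuousOn A (Set.Icc a b)) (hB : ContinuousOn B (Set.Icc a b)) {c : ℂ} (hc : c ≠ 0)
    (h : ∀ s ∈ Set.Icc a b, ‖Complex.exp (A s) - c * Complex.exp (B s)‖ ≤
      1 / 100 * ‖c * Complex.exp (B s)‖) :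
    ‖(A b - A a) - (B b - B a)‖ ≤ 3 / 100 := by
  set r : ℝ → ℂ := fun s => Complex.exp (A s) / (c * Complex.exp (B s)) with hr
  have hne : ∀ s, c * Complex.exp (B s) ≠ 0 := fun s => mul_ne_zero hc (Complex.exp_ne_zero _)
  have hsl : ∀ s ∈ Set.Icc a b, r s ∈ Complex.slitPlane := fun s hs =>
    div_mem_slitPlane_of_norm_sub_lt ((h s hs).trans_lt (by
      have := norm_pos_iff.2 (hne s)
      linarith))
  have hrc : ContinuousOn r (Set.Icc a b) :=
    (Complex.continuous_exp.comp_continuousOn hA).div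
      (continuousOn_const.mul (Complex.continuous_exp.comp_continuousOn hB)) fun s _ => hne s
  have key := isPreconnected_Icc.eq_of_exp_eq (h := fun s => A s - B s - Complex.log (r s)) (c := c)
    ((hA.sub hB).sub (hrc.clog hsl)) (fun s hs => by
      rw [Complex.exp_sub, Complex.exp_sub, Complex.exp_log (Complex.slitPlane_ne_zero (hsl s hs)),
        hr]
      have := Complex.exp_ne_zero (A s)
      have := Complex.exp_ne_zero (B s)
      field_simp) (Set.left_mem_Icc.2 hab) (Set.right_mem_Icc.2 hab)
  have e : (A b - A a) - (B b - B a) = Complex.log (r b) - Complex.log (r a) := by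
    linear_combination -key
  rw [e]
  have h1 := norm_log_le_of_norm_sub_le (by norm_num) (hne a) (h a (Set.left_mem_Icc.2 hab))
  have h2 := norm_log_le_of_norm_sub_le (by norm_num) (hne b) (h b (Set.right_mem_Icc.2 hab))
  refine (norm_sub_le _ _).trans ?_
  linarith

/-- `G s t` is a continuous logarithm of `f t - f s` on `0 ≤ s < t`. -/
structure IsChordLog (f : ℝ → ℂ) (G : ℝ → ℝ → ℂ) : Prop where
  continuousOn : ContinuousOn (fun p : ℝ × ℝ => G p.1 p.2) {p | 0 ≤ p.1 ∧ p.1 < p.2}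
  exp_eq : ∀ s t, 0 ≤ s → s < t → Complex.exp (G s t) = f t - f s

theorem exists_isChordLog {f : ℝ → ℂ} (hf : Continuous f) (hi : Set.InjOn f (Set.Ici 0)) :
    ∃ G, IsChordLog f G := by
  obtain ⟨L, hL, hL'⟩ := exists_continuous_log
    (fun p : ℝ × ℝ => f (max p.1 0 + Real.exp p.2) - f (max p.1 0)) (by fun_prop) (by
      intro p
      have h1 := Real.exp_pos p.2
      have h2 : 0 ≤ max p.1 0 := le_max_right _ _
      rw [sub_ne_zero]
      intro h
      have := hi (Set.mem_Ici.2 (by linarith)) (Set.mem_Ici.2 h2) h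
      linarith)
  refine ⟨fun s t => L (s, Real.log (t - s)), ?_, ?_⟩
  · refine hL.comp_continuousOn (continuousOn_fst.prodMk ?_)
    refine ContinuousOn.log (continuousOn_snd.sub continuousOn_fst) ?_
    rintro ⟨s, t⟩ ⟨-, h⟩
    exact (sub_pos.2 h).ne'
  · intro s t hs hst
    have := hL' (s, Real.log (t - s))
    simp only [max_eq_left hs, Real.exp_log (sub_pos.2 hst)] at this
    rw [this]
    congr 2
    ring

/-- Winding number (times `2πi`) of the curve `f` on `[s, s']`, closed up by a segment, about the
later point `f t`. -/
noncomputable def chordWinding (f : ℝ → ℂ) (G : ℝ → ℝ → ℂ) (s s' t : ℝ) : ℂ :=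
  G s' t - G s t + Complex.log ((f t - f s) / (f t - f s'))

section
variable {f : ℝ → ℂ} {G : ℝ → ℝ → ℂ}

theorem IsChordLog.chord_ne_zero (hG : IsChordLog f G) {s t : ℝ} (hs : 0 ≤ s) (h : s < t) :
    f t - f s ≠ 0 := by
  rw [← hG.exp_eq s t hs h]; exact Complex.exp_ne_zero _

theorem IsChordLog.comp (hG : IsChordLog f G) {A : Type*} [TopologicalSpace A] {S : Set A}
    {s t : A → ℝ} (hs : ContinuousOn s S) (ht : ContinuousOn t S)
    (h0 : ∀ x ∈ S, 0 ≤ s x) (h1 : ∀ x ∈ S, s x < t x) :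
    ContinuousOn (fun x => G (s x) (t x)) S :=
  hG.continuousOn.comp (hs.prodMk ht) fun x hx => ⟨h0 x hx, h1 x hx⟩

theorem IsChordLog.exp_chordWinding (hG : IsChordLog f G) {s s' t : ℝ} (hs : 0 ≤ s) (h : s < t)
    (hs' : 0 ≤ s') (h' : s' < t) : Complex.exp (chordWinding f G s s' t) = 1 := by
  have h1 := hG.chord_ne_zero hs h
  have h2 := hG.chord_ne_zero hs' h'
  rw [chordWinding, Complex.exp_add, Complex.exp_sub, hG.exp_eq s t hs h, hG.exp_eq s' t hs' h',
    Complex.exp_log (div_ne_zero h1 h2)]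
  field_simp

theorem IsChordLog.exists_int_chordWinding (hG : IsChordLog f G) {s s' t : ℝ} (hs : 0 ≤ s)
    (h : s < t) (hs' : 0 ≤ s') (h' : s' < t) :
    ∃ n : ℤ, chordWinding f G s s' t = n * (2 * Real.pi * Complex.I) :=
  Complex.exp_eq_one_iff.1 (hG.exp_chordWinding hs h hs' h')

theorem IsChordLog.chordWinding_eq (hG : IsChordLog f G) (hf : Continuous f) {A : Type*}
    [TopologicalSpace A] {S : Set A}
    (hS : IsPreconnected S) {s s' t : A → ℝ} (hs : ContinuousOn s S) (hs' : ContinuousOn s' S)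
    (ht : ContinuousOn t S)
    (h0 : ∀ x ∈ S, 0 ≤ s x) (h1 : ∀ x ∈ S, s x < t x)
    (h0' : ∀ x ∈ S, 0 ≤ s' x) (h1' : ∀ x ∈ S, s' x < t x)
    (hseg : ∀ x ∈ S, f (t x) ∉ segment ℝ (f (s x)) (f (s' x))) {x y : A} (hx : x ∈ S)
    (hy : y ∈ S) :
    chordWinding f G (s x) (s' x) (t x) = chordWinding f G (s y) (s' y) (t y) := by
  refine hS.eq_of_exp_eq (h := fun x => chordWinding f G (s x) (s' x) (t x)) (c := 1) ?_
    (fun x hx => hG.exp_chordWinding (h0 x hx) (h1 x hx) (h0' x hx) (h1' x hx)) hx hy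
  unfold chordWinding
  refine ((hG.comp hs' ht h0' h1').sub (hG.comp hs ht h0 h1)).add (ContinuousOn.clog ?_ ?_)
  · refine ContinuousOn.div ?_ ?_ fun x hx => hG.chord_ne_zero (h0' x hx) (h1' x hx)
    · exact (hf.comp_continuousOn ht).sub (hf.comp_continuousOn hs)
    · exact (hf.comp_continuousOn ht).sub (hf.comp_continuousOn hs')
  · exact fun x hx => div_mem_slitPlane_of_notMem_segment (hseg x hx)

end

/-- Bookkeeping for two step functions `Wa`, `Wc` on `[t, t']` which only change at the times `Ha`
and `Hc` respectively, which agree at the times in `O`, and such that every passage from `Hc` to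
`Ha` goes through `O`. -/
structure GatePassage (Wa Wc : ℝ → ℝ) (Ha Hc O : Set ℝ) (t t' : ℝ) : Prop where
  closed_a : IsClosed Ha
  closed_c : IsClosed Hc
  closed_O : IsClosed O
  const_a : ∀ x y, t ≤ x → x ≤ y → y ≤ t' → (∀ z ∈ Set.Icc x y, z ∉ Ha) → Wa x = Wa y
  const_c : ∀ x y, t ≤ x → x ≤ y → y ≤ t' → (∀ z ∈ Set.Icc x y, z ∉ Hc) → Wc x = Wc y
  notMem_a : ∀ x ∈ O, x ∉ Ha
  notMem_c : ∀ x ∈ O, x ∉ Hc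
  agree : ∀ x, t ≤ x → x ≤ t' → x ∈ O → Wa x = Wc x
  progress : ∀ k l, t ≤ k → k ≤ l → l ≤ t' → k ∈ Hc → l ∈ Ha → ∃ u ∈ Set.Icc k l, u ∈ O
  sign : ∀ k, t ≤ k → k < t' → k ∈ Ha → ∀ᶠ x in 𝓝[>] k, Wa x ≤ Wc x

section
variable {Wa Wc : ℝ → ℝ} {Ha Hc O : Set ℝ} {t t' : ℝ}

theorem GatePassage.mono (h : GatePassage Wa Wc Ha Hc O t t') {x y : ℝ} (hx : t ≤ x)
    (hy : y ≤ t') : GatePassage Wa Wc Ha Hc O x y where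
  closed_a := h.closed_a
  closed_c := h.closed_c
  closed_O := h.closed_O
  const_a := fun a b h1 h2 h3 => h.const_a a b (hx.trans h1) h2 (h3.trans hy)
  const_c := fun a b h1 h2 h3 => h.const_c a b (hx.trans h1) h2 (h3.trans hy)
  notMem_a := h.notMem_a
  notMem_c := h.notMem_c
  agree := fun a h1 h2 => h.agree a (hx.trans h1) (h2.trans hy)
  progress := fun a b h1 h2 h3 => h.progress a b (hx.trans h1) h2 (h3.trans hy)
  sign := fun a h1 h2 => h.sign a (hx.trans h1) (h2.trans_le hy)

theorem GatePassage.exists_exit (h : GatePassage Wa Wc Ha Hc O t t') (ht' : t' ∈ O) {l : ℝ}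
    (hl' : l ≤ t') (hlc : ∀ k, l ≤ k → k ≤ t' → k ∈ Ha → ∃ u ∈ Set.Icc l k, u ∈ O) :
    ∃ u ∈ Set.Icc l t', u ∈ O ∧ ∀ z ∈ Set.Icc l u, z ∉ Ha := by
  by_cases hn : (Ha ∩ Set.Icc l t').Nonempty
  · obtain ⟨k, ⟨hk1, hk2, hk3⟩, hk⟩ :=
      (isCompact_Icc.inter_left h.closed_a).exists_isLeast hn
    obtain ⟨u, ⟨hu1, hu2⟩, hu⟩ := hlc k hk2 hk3 hk1
    have huk : u ≠ k := fun e => h.notMem_a u hu (e ▸ hk1)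
    refine ⟨u, ⟨hu1, hu2.trans hk3⟩, hu, fun z hz hza => ?_⟩
    have := hk ⟨hza, hz.1, hz.2.trans (hu2.trans hk3)⟩
    exact huk (le_antisymm hu2 (this.trans hz.2))
  · refine ⟨t', ⟨hl', le_rfl⟩, ht', fun z hz hza => hn ⟨z, hza, hz⟩⟩

theorem GatePassage.exists_step (h : GatePassage Wa Wc Ha Hc O t t') (htt : t < t')
    (ht : t ∈ O) (ht' : t' ∈ O) : ∃ u ∈ Set.Ioc t t', u ∈ O ∧ Wa u ≤ Wa t := by
  by_cases hn : (Hc ∩ Set.Icc t t').Nonempty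
  · obtain ⟨l, ⟨hl1, hl2, hl3⟩, hl⟩ := (isCompact_Icc.inter_left h.closed_c).exists_isLeast hn
    have hlt : t < l := lt_of_le_of_ne hl2 fun e => h.notMem_c t ht (e ▸ hl1)
    obtain ⟨u, ⟨hu1, hu2⟩, hu, hua⟩ := h.exists_exit ht' hl3 fun k hk1 hk2 hk =>
      h.progress l k hl2 hk1 hk2 hl1 hk
    refine ⟨u, ⟨hlt.trans_le hu1, hu2⟩, hu, ?_⟩
    by_cases hm : (Ha ∩ Set.Icc t l).Nonempty
    · obtain ⟨k, ⟨hk1, hk2, hk3⟩, hk⟩ := (isCompact_Icc.inter_left h.closed_a).exists_isGreatest hm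
      have hkl : k < l := by
        refine lt_of_le_of_ne hk3 fun e => ?_
        obtain ⟨w, hw1, hw2⟩ := h.progress l l hl2 le_rfl hl3 hl1 (e ▸ hk1)
        have : w = l := le_antisymm hw1.2 hw1.1
        exact h.notMem_c w hw2 (this ▸ hl1)
      obtain ⟨v, hv, hvk, hvl⟩ := ((h.sign k hk2 (hkl.trans_le hl3) hk1).and
        (Ioo_mem_nhdsGT hkl)).exists
      have e1 : Wc t = Wc v := h.const_c t v le_rfl (hk2.trans hvk.le) (hvl.le.trans hl3)
        fun z hz hzc => absurd (hl ⟨hzc, hz.1, hz.2.trans (hvl.le.trans hl3)⟩)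
          (not_le.2 (hz.2.trans_lt hvl))
      have e2 : Wa v = Wa u := by
        refine h.const_a v u (hk2.trans hvk.le) (hvl.le.trans hu1) hu2 fun z hz hza => ?_
        rcases le_total z l with hzl | hzl
        · exact absurd (hk ⟨hza, (hk2.trans hvk.le).trans hz.1, hzl⟩)
            (not_le.2 (hvk.trans_le hz.1))
        · exact hua z ⟨hzl, hz.2⟩ hza
      rw [← e2, h.agree t le_rfl htt.le ht, e1]
      exact hv
    · refine (h.const_a t u le_rfl (hlt.le.trans hu1) hu2 fun z hz hza => ?_).ge
      rcases le_total z l with hzl | hzl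
      · exact hm ⟨z, hza, hz.1, hzl⟩
      · exact hua z ⟨hzl, hz.2⟩ hza
  · refine ⟨t', ⟨htt, le_rfl⟩, ht', ?_⟩
    rw [h.agree t' htt.le le_rfl ht', h.agree t le_rfl htt.le ht]
    exact (h.const_c t t' le_rfl htt.le le_rfl fun z hz hzc => hn ⟨z, hzc, hz⟩).ge

theorem GatePassage.le (h : GatePassage Wa Wc Ha Hc O t t') (htt : t ≤ t') (ht : t ∈ O)
    (ht' : t' ∈ O) : Wa t' ≤ Wa t := by
  set A : Set ℝ := {u | u ∈ Set.Icc t t' ∧ u ∈ O ∧ Wa u ≤ Wa t} with hA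
  have hAc : IsClosed A := by
    refine isClosed_of_closure_subset fun u hu => ?_
    have hu1 : u ∈ Set.Icc t t' := isClosed_Icc.closure_subset_iff.2 (fun _ hx => hx.1) hu
    have hu2 : u ∈ O := h.closed_O.closure_subset_iff.2 (fun _ hx => hx.2.1) hu
    obtain ⟨ε, hε, hball⟩ := Metric.isOpen_iff.1 h.closed_a.isOpen_compl u (h.notMem_a u hu2)
    obtain ⟨v, hv, hvu⟩ := Metric.mem_closure_iff.1 hu ε hε
    rw [Real.dist_eq, abs_lt] at hvu
    refine ⟨hu1, hu2, ?_⟩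
    have hz : ∀ z, |z - u| < ε → z ∉ Ha := fun z hz => hball (by rwa [Metric.mem_ball, Real.dist_eq])
    rcases le_total u v with huv | huv
    · rw [h.const_a u v hu1.1 huv hv.1.2 fun z hz' => hz z (by
        rw [abs_lt]; constructor <;> linarith [hz'.1, hz'.2])]
      exact hv.2.2
    · rw [← h.const_a v u hv.1.1 huv hu1.2 fun z hz' => hz z (by
        rw [abs_lt]; constructor <;> linarith [hz'.1, hz'.2])]
      exact hv.2.2
  have hAk : IsCompact A := isCompact_Icc.of_isClosed_subset hAc fun _ hx => hx.1
  obtain ⟨u, ⟨⟨hu1, hu2⟩, hu3, hu4⟩, hu⟩ := hAk.exists_isGreatest ⟨t, ⟨le_rfl, htt⟩, ht, le_rfl⟩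
  rcases hu2.lt_or_eq with hlt | rfl
  · obtain ⟨v, ⟨hv1, hv2⟩, hv3, hv4⟩ := (h.mono hu1 le_rfl).exists_step hlt hu3 ht'
    exact absurd (hu ⟨⟨hu1.trans hv1.le, hv2⟩, hv3, hv4.trans hu4⟩) (not_le.2 hv1)
  · exact hu4

theorem GatePassage.lt (h : GatePassage Wa Wc Ha Hc O t t') (ht : t ∈ O) (ht' : t' ∈ O) {m : ℝ}
    (htm : t ≤ m) (hmt : m ≤ t') (hc : ∀ k ∈ Set.Icc t m, k ∈ Hc → ∃ u ∈ Set.Icc k m, u ∈ O)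
    (ha : ∀ k ∈ Set.Icc m t', k ∈ Ha → ∃ u ∈ Set.Icc m k, u ∈ O) (hm : Wa m ≠ Wc m) :
    Wa t' < Wa t := by
  obtain ⟨u, ⟨⟨hu1, hu2⟩, hu3⟩, hu⟩ := (isCompact_Icc.inter_right h.closed_O).exists_isGreatest
    (⟨t, ⟨le_rfl, htm⟩, ht⟩ : (Set.Icc t m ∩ O).Nonempty)
  obtain ⟨v, ⟨hv1, hv2⟩, hv3, hv4⟩ := h.exists_exit ht' hmt
    fun k hk1 hk2 => ha k ⟨hk1, hk2⟩
  have e1 : Wa m = Wa v := h.const_a m v htm hv1 hv2 hv4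
  have e2 : Wc u = Wc m := h.const_c u m hu1 hu2 hmt fun z hz hzc => by
    obtain ⟨w, hw, hwO⟩ := hc z ⟨hu1.trans hz.1, hz.2⟩ hzc
    have h1 := hu ⟨⟨hu1.trans (hz.1.trans hw.1), hw.2⟩, hwO⟩
    have : z = u := le_antisymm (hw.1.trans h1) hz.1
    exact h.notMem_c u hu3 (this ▸ hzc)
  have e3 := h.agree u hu1 (hu2.trans hmt) hu3
  have i1 := (h.mono le_rfl (hu2.trans hmt)).le hu1 ht hu3
  have i2 := (h.mono hu1 hv2).le (hu2.trans hv1) hu3 hv3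
  have i3 := (h.mono (htm.trans hv1) le_rfl).le hv2 hv3 ht'
  have : Wa m < Wc m := lt_of_le_of_ne (by linarith) hm
  linarith

end

theorem exists_div_eq_neg_of_mem_openSegment {A B z : ℂ} (h : z ∈ openSegment ℝ A B)
    (hAB : A ≠ B) : ∃ r : ℝ, 0 < r ∧ (z - A) / (z - B) = -(r : ℂ) := by
  obtain ⟨a, b, ha, hb, hab, rfl⟩ := h
  refine ⟨b / a, by positivity, ?_⟩
  have hab' : (a : ℂ) + b = 1 := by exact_mod_cast hab
  have ha' : (a : ℂ) ≠ 0 := by exact_mod_cast ha.ne'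
  have h1 : (a • A + b • B) - A = b * (B - A) := by
    simp only [Complex.real_smul]; linear_combination A * hab'
  have h2 : (a • A + b • B) - B = a * (A - B) := by
    simp only [Complex.real_smul]; linear_combination B * hab'
  have h3 : A - B ≠ 0 := sub_ne_zero.2 hAB
  rw [h1, h2]
  push_cast
  field_simp
  ring

/-- Between two disjoint compact sets met by a segment there is a free subsegment. -/
theorem exists_free_subsegment {K L : Set ℂ} (hK : IsCompact K) (hL : IsCompact L)
    (hKL : Disjoint K L) {x y : ℂ} (hx : x ∈ K) (hy : y ∈ L) :
    ∃ A ∈ K, ∃ B ∈ L, A ∈ segment ℝ x y ∧ B ∈ segment ℝ x y ∧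
      ∀ z ∈ openSegment ℝ A B, z ∉ K ∧ z ∉ L := by
  set z : ℝ → ℂ := fun t => AffineMap.lineMap x y t with hz
  have hzc : Continuous z := AffineMap.lineMap_continuous
  obtain ⟨t1, ⟨⟨ht1, ht1'⟩, ht1L⟩, h1⟩ := (isCompact_Icc.inter_right
    (hL.isClosed.preimage hzc)).exists_isLeast (⟨1, by simp, by simpa [hz] using hy⟩ :
      (Set.Icc (0 : ℝ) 1 ∩ z ⁻¹' L).Nonempty)
  obtain ⟨t0, ⟨⟨ht0, ht0'⟩, ht0K⟩, h0⟩ := (isCompact_Icc.inter_right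
    (hK.isClosed.preimage hzc)).exists_isGreatest (⟨0, by simp [ht1], by simpa [hz] using hx⟩ :
      (Set.Icc (0 : ℝ) t1 ∩ z ⁻¹' K).Nonempty)
  have hlt : t0 < t1 := lt_of_le_of_ne ht0' fun e => Set.disjoint_left.1 hKL ht0K (e ▸ ht1L)
  have hseg : ∀ t ∈ Set.Icc (0 : ℝ) 1, z t ∈ segment ℝ x y := fun t ht => by
    rw [segment_eq_image_lineMap]; exact ⟨t, ht, rfl⟩
  refine ⟨z t0, ht0K, z t1, ht1L, hseg _ ⟨ht0, ht0'.trans ht1'⟩, hseg _ ⟨ht1, ht1'⟩, ?_⟩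
  intro w hw
  have : w ∈ z '' Set.Ioo t0 t1 := by
    rw [← openSegment_eq_Ioo hlt, hz]
    have := image_openSegment ℝ (AffineMap.lineMap x y : ℝ →ᵃ[ℝ] ℂ) t0 t1
    rw [this]; exact hw
  obtain ⟨t, ⟨hta, htb⟩, rfl⟩ := this
  exact ⟨fun hm => absurd (h0 ⟨⟨ht0.trans hta.le, htb.le⟩, hm⟩) (not_le.2 hta),
    fun hm => absurd (h1 ⟨⟨ht0.trans hta.le, htb.le.trans ht1'⟩, hm⟩) (not_le.2 htb)⟩

section
variable {f : ℝ → ℂ} {G : ℝ → ℝ → ℂ}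

/-- The increment of the chord logarithm along an arc only depends continuously on the endpoint
outside the arc. -/
theorem IsChordLog.exists_increment_path (hG : IsChordLog f G) (hf : Continuous f) {α β : ℝ}
    (hα : 0 ≤ α) {k l : ℝ} (hk : β < k) (hl : β < l) {u₁ u₂ : ℝ} (h₁ : u₁ ∈ Set.Icc α β)
    (h₂ : u₂ ∈ Set.Icc α β) {z : ℝ → ℂ} (hz : Continuous z) (hz0 : z 0 = f k) (hz1 : z 1 = f l)
    (hne : ∀ x ∈ Set.Icc (0 : ℝ) 1, ∀ u ∈ Set.Icc α β, z x ≠ f u) :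
    ∃ H : ℝ → ℂ, Continuous H ∧ H 0 = G u₂ k - G u₁ k ∧ H 1 = G u₂ l - G u₁ l ∧
      ∀ x ∈ Set.Icc (0 : ℝ) 1, Complex.exp (H x) = (z x - f u₂) / (z x - f u₁) := by
  have hαβ : α ≤ β := h₁.1.trans h₁.2
  obtain ⟨L, hL, hL'⟩ := exists_continuous_log
    (fun p : ℝ × ℝ => z (Set.projIcc (0 : ℝ) 1 zero_le_one p.1) - f (Set.projIcc α β hαβ p.2))
    (by fun_prop) (fun p => sub_ne_zero.2 (hne _ (Subtype.prop _) _ (Subtype.prop _)))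
  have hLe : ∀ x ∈ Set.Icc (0 : ℝ) 1, ∀ u ∈ Set.Icc α β, Complex.exp (L (x, u)) = z x - f u := by
    intro x hx u hu
    rw [hL']
    simp [Set.projIcc_of_mem _ hx, Set.projIcc_of_mem _ hu]
  have key : ∀ x ∈ Set.Icc (0 : ℝ) 1, ∀ k, β < k → z x = f k →
      L (x, u₂) - L (x, u₁) = G u₂ k - G u₁ k := by
    intro x hx k hk hzk
    have := (isPreconnected_Icc (a := α) (b := β)).eq_of_exp_eq
      (h := fun u => L (x, u) - G u k) (c := 1)
      ((by fun_prop : Continuous fun u => L (x, u)).continuousOn.sub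
        (hG.comp continuousOn_id continuousOn_const (fun u hu => hα.trans hu.1)
          fun u hu => hu.2.trans_lt hk))
      (fun u hu => by
        have h := hG.exp_eq u k (hα.trans hu.1) (hu.2.trans_lt hk)
        have h' := hG.chord_ne_zero (hα.trans hu.1) (hu.2.trans_lt hk)
        rw [Complex.exp_sub, hLe x hx u hu, h, hzk, div_self h']) h₁ h₂
    linear_combination -this
  refine ⟨fun x => L (x, u₂) - L (x, u₁), by fun_prop, key 0 (by simp) k hk hz0,
    key 1 (by simp) l hl hz1, fun x hx => ?_⟩
  rw [Complex.exp_sub, hLe x hx _ h₁, hLe x hx _ h₂]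

/-- The curve crosses the free segment from `f pa` to `f qa` always in the same direction, relative
to the segment from `f pc` to `f qc`. -/
theorem IsChordLog.sign_crossing (hG : IsChordLog f G) (hf : Continuous f)
    {p₁ p₂ q₁ q₂ pa pc qa qc T : ℝ} (hp₁ : 0 ≤ p₁) (hq₁ : 0 ≤ q₁) (hpT : p₂ < T) (hqT : q₂ < T)
    (hpa : pa ∈ Set.Icc p₁ p₂) (hpc : pc ∈ Set.Icc p₁ p₂) (hqa : qa ∈ Set.Icc q₁ q₂)
    (hqc : qc ∈ Set.Icc q₁ q₂) (hne : f pa ≠ f qa)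
    (hfp : ∀ z ∈ openSegment ℝ (f pa) (f qa), ∀ u ∈ Set.Icc p₁ p₂, z ≠ f u)
    (hfq : ∀ z ∈ openSegment ℝ (f pa) (f qa), ∀ u ∈ Set.Icc q₁ q₂, z ≠ f u)
    (hd : ∀ z ∈ segment ℝ (f pa) (f qa), z ∉ segment ℝ (f pc) (f qc)) :
    (∀ k, T ≤ k → f k ∈ segment ℝ (f pa) (f qa) → ∀ᶠ x in 𝓝[>] k,
      (chordWinding f G pa qa x).im ≤ (chordWinding f G pc qc x).im) ∨
    (∀ k, T ≤ k → f k ∈ segment ℝ (f pa) (f qa) → ∀ᶠ x in 𝓝[>] k,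
      (chordWinding f G pc qc x).im ≤ (chordWinding f G pa qa x).im) := by
  have hpi := Real.pi_gt_three
  set E : ℝ → ℂ := fun t => (G qc t - G qa t) - (G pc t - G pa t) +
    Complex.log ((f t - f pc) / (f t - f qc)) with hE
  have hpa0 := hp₁.trans hpa.1
  have hpc0 := hp₁.trans hpc.1
  have hqa0 := hq₁.trans hqa.1
  have hqc0 := hq₁.trans hqc.1
  have hpaT := hpa.2.trans_lt hpT
  have hpcT := hpc.2.trans_lt hpT
  have hqaT := hqa.2.trans_lt hqT
  have hqcT := hqc.2.trans_lt hqT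
  have hop : ∀ k, T ≤ k → f k ∈ segment ℝ (f pa) (f qa) → f k ∈ openSegment ℝ (f pa) (f qa) :=
    fun k hk h => mem_openSegment_of_ne_left_right
      (sub_ne_zero.1 (hG.chord_ne_zero hpa0 (hpaT.trans_le hk))).symm
      (sub_ne_zero.1 (hG.chord_ne_zero hqa0 (hqaT.trans_le hk))).symm h
  have hEW : ∀ t, E t = chordWinding f G pc qc t - chordWinding f G pa qa t +
      Complex.log ((f t - f pa) / (f t - f qa)) := by
    intro t; simp only [hE, chordWinding]; ring
  -- the imaginary part of `E` is the same at all crossings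
  have hconst : ∀ k l, T ≤ k → T ≤ l → f k ∈ segment ℝ (f pa) (f qa) →
      f l ∈ segment ℝ (f pa) (f qa) → (E k).im = (E l).im := by
    intro k l hk hl hkS hlS
    set z : ℝ → ℂ := fun x => AffineMap.lineMap (f k) (f l) x with hz
    have hzc : Continuous z := AffineMap.lineMap_continuous
    have hzS : ∀ x ∈ Set.Icc (0 : ℝ) 1, z x ∈ openSegment ℝ (f pa) (f qa) := by
      intro x hx
      have : z x ∈ segment ℝ (f k) (f l) := by
        rw [segment_eq_image_lineMap]; exact ⟨x, hx, rfl⟩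
      exact (convex_openSegment (𝕜 := ℝ) (f pa) (f qa)).segment_subset (hop k hk hkS)
        (hop l hl hlS) this
    obtain ⟨Hp, hHp, hHp0, hHp1, hHpe⟩ := hG.exists_increment_path hf hp₁ (hpT.trans_le hk)
      (hpT.trans_le hl) hpa hpc hzc (by simp [hz]) (by simp [hz])
      (fun x hx => hfp _ (hzS x hx))
    obtain ⟨Hq, hHq, hHq0, hHq1, hHqe⟩ := hG.exists_increment_path hf hq₁ (hqT.trans_le hk)
      (hqT.trans_le hl) hqa hqc hzc (by simp [hz]) (by simp [hz])
      (fun x hx => hfq _ (hzS x hx))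
    have hsl : ∀ x ∈ Set.Icc (0 : ℝ) 1, (z x - f pc) / (z x - f qc) ∈ Complex.slitPlane :=
      fun x hx => div_mem_slitPlane_of_notMem_segment (hd _ (openSegment_subset_segment _ _ _
        (hzS x hx)))
    have hnA : ∀ x ∈ Set.Icc (0 : ℝ) 1, z x - f pa ≠ 0 := fun x hx =>
      sub_ne_zero.2 (hfp _ (hzS x hx) _ hpa)
    have hnB : ∀ x ∈ Set.Icc (0 : ℝ) 1, z x - f qa ≠ 0 := fun x hx =>
      sub_ne_zero.2 (hfq _ (hzS x hx) _ hqa)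
    have hnA' : ∀ x ∈ Set.Icc (0 : ℝ) 1, z x - f pc ≠ 0 := fun x hx =>
      sub_ne_zero.2 (hfp _ (hzS x hx) _ hpc)
    have hnB' : ∀ x ∈ Set.Icc (0 : ℝ) 1, z x - f qc ≠ 0 := fun x hx =>
      sub_ne_zero.2 (hfq _ (hzS x hx) _ hqc)
    have hneg : ∀ x ∈ Set.Icc (0 : ℝ) 1, ∃ r : ℝ, 0 < r ∧
        -((z x - f pa) / (z x - f qa)) = (r : ℂ) := fun x hx => by
      obtain ⟨r, hr, h⟩ := exists_div_eq_neg_of_mem_openSegment (hzS x hx) hne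
      exact ⟨r, hr, by rw [h, neg_neg]⟩
    have key := (isPreconnected_Icc (a := (0 : ℝ)) (b := 1)).eq_of_exp_eq
      (h := fun x => Hq x - Hp x + Complex.log ((z x - f pc) / (z x - f qc)) -
        Complex.log (-((z x - f pa) / (z x - f qa)))) (c := -1)
      (by
        refine ((hHq.sub hHp).continuousOn.add (ContinuousOn.clog ?_ hsl)).sub
          (ContinuousOn.clog ?_ ?_)
        · exact (hzc.sub continuous_const).continuousOn.div
            (hzc.sub continuous_const).continuousOn hnB'
        · exact ((hzc.sub continuous_const).continuousOn.div
            (hzc.sub continuous_const).continuousOn hnB).neg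
        · intro x hx
          obtain ⟨r, hr, h⟩ := hneg x hx
          rw [h]
          exact Complex.ofReal_mem_slitPlane.2 hr)
      (fun x hx => by
        have := hnA x hx
        have := hnB x hx
        have := hnA' x hx
        have := hnB' x hx
        rw [Complex.exp_sub, Complex.exp_add, Complex.exp_sub, hHqe x hx, hHpe x hx,
          Complex.exp_log (div_ne_zero (hnA' x hx) (hnB' x hx)),
          Complex.exp_log (neg_ne_zero.2 (div_ne_zero (hnA x hx) (hnB x hx)))]
        field_simp) (Set.left_mem_Icc.2 zero_le_one) (Set.right_mem_Icc.2 zero_le_one)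
    have hlog : ∀ x ∈ Set.Icc (0 : ℝ) 1,
        (Complex.log (-((z x - f pa) / (z x - f qa)))).im = 0 := fun x hx => by
      obtain ⟨r, hr, h⟩ := hneg x hx
      rw [h, Complex.log_im, Complex.arg_ofReal_of_nonneg hr.le]
    have hz0 : z 0 = f k := by simp [hz]
    have hz1 : z 1 = f l := by simp [hz]
    have h0 := hlog 0 (by simp)
    have h1 := hlog 1 (by simp)
    have key' := congrArg Complex.im key
    simp only [hHp0, hHp1, hHq0, hHq1, hz0, hz1, Complex.sub_im (_ + _)] at key' h0 h1
    rw [h0, h1, sub_zero, sub_zero] at key'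
    exact key'
  have hcont : ∀ k, T ≤ k → f k ∈ segment ℝ (f pa) (f qa) → ContinuousAt E k := by
    intro k hk hkS
    have hc : ∀ s, 0 ≤ s → s < T → ContinuousAt (fun t => G s t) k := fun s hs hsT =>
      (hG.comp (S := Set.Ioi s) continuousOn_const continuousOn_id (fun _ _ => hs)
        fun _ hx => hx).continuousAt (Ioi_mem_nhds (hsT.trans_le hk))
    refine (((hc _ hqc0 hqcT).sub (hc _ hqa0 hqaT)).sub
      ((hc _ hpc0 hpcT).sub (hc _ hpa0 hpaT))).add (ContinuousAt.clog ?_ ?_)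
    · exact (hf.continuousAt.sub continuousAt_const).div (hf.continuousAt.sub continuousAt_const)
        (hG.chord_ne_zero hqc0 (hqcT.trans_le hk))
    · exact div_mem_slitPlane_of_notMem_segment (hd _ hkS)
  have hint : ∀ k, T ≤ k → ∃ n : ℤ, (chordWinding f G pc qc k).im -
      (chordWinding f G pa qa k).im = n * (2 * Real.pi) := by
    intro k hk
    obtain ⟨n, hn⟩ := hG.exists_int_chordWinding hpc0 (hpcT.trans_le hk) hqc0 (hqcT.trans_le hk)
    obtain ⟨m, hm⟩ := hG.exists_int_chordWinding hpa0 (hpaT.trans_le hk) hqa0 (hqaT.trans_le hk)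
    refine ⟨n - m, ?_⟩
    rw [hn, hm]
    simp
    ring
  have hodd : ∀ k, T ≤ k → f k ∈ segment ℝ (f pa) (f qa) →
      Real.pi ≤ (E k).im ∨ (E k).im ≤ -Real.pi := by
    intro k hk hkS
    obtain ⟨n, hn⟩ := hint k hk
    obtain ⟨r, hr, h⟩ := exists_div_eq_neg_of_mem_openSegment (hop k hk hkS) hne
    have h2 : (Complex.log ((f k - f pa) / (f k - f qa))).im = Real.pi := by
      rw [h, Complex.log_im, ← Complex.ofReal_neg, Complex.arg_ofReal_of_neg (by linarith)]
    rw [hEW, Complex.add_im, Complex.sub_im, h2, hn]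
    rcases le_or_gt 0 n with hn0 | hn0
    · left
      have : (0 : ℝ) ≤ n := by exact_mod_cast hn0
      nlinarith
    · right
      have : (n : ℝ) ≤ -1 := by exact_mod_cast (by omega : n ≤ -1)
      nlinarith
  have harg : ∀ t, -Real.pi ≤ (Complex.log ((f t - f pa) / (f t - f qa))).im ∧
      (Complex.log ((f t - f pa) / (f t - f qa))).im ≤ Real.pi := fun t =>
    ⟨(Complex.neg_pi_lt_log_im _).le, Complex.log_im_le_pi _⟩
  have him : ∀ k, T ≤ k → f k ∈ segment ℝ (f pa) (f qa) →
      ∀ᶠ x in 𝓝[>] k, (E k).im - 1 < (E x).im ∧ (E x).im < (E k).im + 1 ∧ T ≤ x := by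
    intro k hk hkS
    have h := (Complex.continuous_im.continuousAt.comp (hcont k hk hkS)).tendsto.mono_left
      (nhdsWithin_le_nhds (s := Set.Ioi k))
    filter_upwards [h (Ioo_mem_nhds (sub_one_lt _) (lt_add_one _)), self_mem_nhdsWithin]
      with x hx hx'
    exact ⟨hx.1, hx.2, hk.trans (le_of_lt hx')⟩
  by_cases hex : ∃ k, T ≤ k ∧ f k ∈ segment ℝ (f pa) (f qa) ∧ Real.pi ≤ (E k).im
  · obtain ⟨k₀, hk₀, hk₀S, hk₀E⟩ := hex
    left
    intro k hk hkS
    have hEk := hconst k k₀ hk hk₀ hkS hk₀S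
    filter_upwards [him k hk hkS] with x ⟨hx1, hx2, hx3⟩
    obtain ⟨n, hn⟩ := hint x hx3
    have h3 : (E x).im = (chordWinding f G pc qc x).im - (chordWinding f G pa qa x).im +
        (Complex.log ((f x - f pa) / (f x - f qa))).im := by
      rw [hEW, Complex.add_im, Complex.sub_im]
    have h5 := (harg x).2
    have h6 : (-1 : ℝ) < n * (2 * Real.pi) := by linarith
    have h7 : (-1 : ℤ) < n := by
      by_contra hcon
      have : (n : ℝ) ≤ -1 := by exact_mod_cast not_lt.1 hcon
      nlinarith
    have h8 : (0 : ℝ) ≤ n := by exact_mod_cast (by omega : 0 ≤ n)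
    have : 0 ≤ (n : ℝ) * (2 * Real.pi) := by positivity
    linarith
  · right
    intro k hk hkS
    have hEk : (E k).im ≤ -Real.pi := (hodd k hk hkS).resolve_left fun h => hex ⟨k, hk, hkS, h⟩
    filter_upwards [him k hk hkS] with x ⟨hx1, hx2, hx3⟩
    obtain ⟨n, hn⟩ := hint x hx3
    have h3 : (E x).im = (chordWinding f G pc qc x).im - (chordWinding f G pa qa x).im +
        (Complex.log ((f x - f pa) / (f x - f qa))).im := by
      rw [hEW, Complex.add_im, Complex.sub_im]
    have h5 := (harg x).1
    have h6 : n * (2 * Real.pi) < (1 : ℝ) := by linarith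
    have h7 : n < (1 : ℤ) := by
      by_contra hcon
      have : (1 : ℝ) ≤ n := by exact_mod_cast not_lt.1 hcon
      nlinarith
    have h8 : (n : ℝ) ≤ 0 := by exact_mod_cast (by omega : n ≤ 0)
    have : (n : ℝ) * (2 * Real.pi) ≤ 0 := mul_nonpos_of_nonpos_of_nonneg h8 (by positivity)
    linarith

end

section
variable {f : ℝ → ℂ} {G : ℝ → ℝ → ℂ}

/-- The winding number about `f w` agrees with that about `f v` when the two points are close. -/
theorem IsChordLog.exists_chordWinding_eq (hG : IsChordLog f G) (hf : Continuous f) {s s' v : ℝ}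
    (hs : 0 ≤ s) (hss : s ≤ s') (hsv : s' < v) (hv : f v ∉ segment ℝ (f s) (f s')) :
    ∃ η > 0, ∀ w, s' < w → ‖f w - f v‖ < η →
      chordWinding f G s s' w = chordWinding f G s s' v := by
  obtain ⟨u₀, hu₀, hmin⟩ := (isCompact_Icc (a := s) (b := s')).exists_isMinOn ⟨s, by simp [hss]⟩
    (f := fun u => ‖f v - f u‖) (by fun_prop)
  have hμ : 0 < ‖f v - f u₀‖ :=
    norm_pos_iff.2 (hG.chord_ne_zero (hs.trans hu₀.1) (hu₀.2.trans_lt hsv))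
  have hlog : ContinuousAt (fun z => Complex.log ((z - f s) / (z - f s'))) (f v) := by
    refine ContinuousAt.clog ((continuousAt_id.sub continuousAt_const).div
      (continuousAt_id.sub continuousAt_const) ?_) (div_mem_slitPlane_of_notMem_segment hv)
    exact hG.chord_ne_zero (hs.trans hss) hsv
  obtain ⟨η, hη, hηlog⟩ := Metric.continuousAt_iff.1 hlog 1 one_pos
  refine ⟨min η (‖f v - f u₀‖ / 100), by positivity, fun w hw hwv => ?_⟩
  have h1 := hηlog (x := f w) (by rw [dist_eq_norm]; exact hwv.trans_le (min_le_left _ _))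
  have h2 := norm_log_increment_sub_le (A := fun u => G u w) (B := fun u => G u v) hss
    (hG.comp continuousOn_id continuousOn_const (fun u hu => hs.trans hu.1)
      fun u hu => hu.2.trans_lt hw)
    (hG.comp continuousOn_id continuousOn_const (fun u hu => hs.trans hu.1)
      fun u hu => hu.2.trans_lt hsv) one_ne_zero (fun u hu => by
        rw [hG.exp_eq _ _ (hs.trans hu.1) (hu.2.trans_lt hw),
          hG.exp_eq _ _ (hs.trans hu.1) (hu.2.trans_lt hsv), one_mul,
          show f w - f u - (f v - f u) = f w - f v by ring]
        have := hmin hu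
        simp only [Set.mem_ofPred_eq] at this
        have := hwv.le.trans (min_le_right _ _)
        linarith)
  obtain ⟨n, hn⟩ := hG.exists_int_chordWinding hs (hss.trans_lt hw) (hs.trans hss) hw
  obtain ⟨m, hm⟩ := hG.exists_int_chordWinding hs (hss.trans_lt hsv) (hs.trans hss) hsv
  have h3 : ‖chordWinding f G s s' w - chordWinding f G s s' v‖ ≤ 3 / 100 + 1 := by
    rw [dist_eq_norm] at h1
    refine (le_of_eq ?_).trans ((norm_add_le _ _).trans (add_le_add h2 h1.le))
    congr 1
    simp only [chordWinding]
    ring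
  rw [hn, hm, ← sub_mul, norm_mul] at h3
  have h4 : ‖(2 * Real.pi * Complex.I : ℂ)‖ = 2 * Real.pi := by
    simp [abs_of_pos Real.pi_pos]
  rw [h4] at h3
  have h5 : ‖((n : ℂ) - m)‖ = |((n - m : ℤ) : ℝ)| := by
    rw [← Int.cast_sub, Complex.norm_intCast]
  rw [h5] at h3
  have h6 : |n - m| < 1 := by
    by_contra hcon
    have : (1 : ℝ) ≤ |((n - m : ℤ) : ℝ)| := by exact_mod_cast not_lt.1 hcon
    nlinarith [Real.pi_gt_three]
  have h7 : n = m := by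
    have := Int.abs_lt_one_iff.1 h6
    omega
  rw [hn, hm, h7]

end

/-- A recurrent injective plane curve making progress along its initial arc, together with scales
`δ`, `ω`, `ε` controlling its behaviour near this arc. -/
structure GateScale (f : ℝ → ℂ) (δ ω ε : ℝ) : Prop where
  cont : Continuous f
  inj : Set.InjOn f (Set.Ici 0)
  recurrent : ∀ T η B : ℝ, 0 < η → ∃ t > B, ∀ s ∈ Set.Icc 0 T, ‖f (t + s) - f s‖ < η
  progress : ∀ k l, 0 ≤ k → k ≤ l → ∀ s ∈ Set.Icc (1 : ℝ) 4, ∀ s' ∈ Set.Icc (1 : ℝ) 4,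
    (∀ u ∈ Set.Icc k l, ∃ r ∈ Set.Icc (1 : ℝ) 4, ‖f u - f r‖ ≤ δ) →
    ‖f k - f s‖ ≤ δ → ‖f l - f s'‖ ≤ δ → s ≤ s' + 1 / 8
  δ_pos : 0 < δ
  ω_pos : 0 < ω
  ω_le : ω ≤ 1 / 16
  ε_pos : 0 < ε
  ε_le : ε ≤ δ / 4
  start : ∀ r ∈ Set.Icc (1 : ℝ) 4, 2 * δ ≤ ‖f 0 - f r‖
  finish : ∀ r ∈ Set.Icc (1 : ℝ) 4, 2 * δ ≤ ‖f 5 - f r‖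
  mid : ∀ r ∈ Set.Icc (1 : ℝ) (9 / 4), 2 * δ ≤ ‖f (5 / 2) - f r‖
  modulus : ∀ s ∈ Set.Icc (0 : ℝ) 5, ∀ t ∈ Set.Icc (0 : ℝ) 5, |s - t| ≤ 2 * ω →
    ‖f s - f t‖ ≤ δ / 4
  separation : ∀ s ∈ Set.Icc (0 : ℝ) 5, ∀ t ∈ Set.Icc (0 : ℝ) 5, ‖f s - f t‖ ≤ 2 * ε →
    |s - t| ≤ ω

section
variable {f : ℝ → ℂ} {G : ℝ → ℝ → ℂ} {δ ω ε : ℝ}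

theorem norm_sub_le_of_endpoints {x y z w : ℂ} {r : ℝ} (hx : ‖x - w‖ ≤ r) (hy : ‖y - w‖ ≤ r)
    (hz : z ∈ segment ℝ x y) : ‖z - w‖ ≤ r := by
  have := (convex_closedBall w r).segment_subset (mem_closedBall_iff_norm.2 hx)
    (mem_closedBall_iff_norm.2 hy) hz
  exact mem_closedBall_iff_norm.1 this

theorem GateScale.norm_sub_le_of_mem_chord (h : GateScale f δ ω ε) {p q s s' : ℝ} (hs : s ∈ Set.Icc (0 : ℝ) 5)
    (hs' : s' ∈ Set.Icc (0 : ℝ) 5) (hp : ∀ s ∈ Set.Icc (0 : ℝ) 5, ‖f (p + s) - f s‖ ≤ ε)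
    (hq : ∀ s ∈ Set.Icc (0 : ℝ) 5, ‖f (q + s) - f s‖ ≤ ε) (hss : |s' - s| ≤ 2 * ω) {z : ℂ}
    (hz : z ∈ segment ℝ (f (p + s)) (f (q + s'))) : ‖z - f s‖ ≤ δ / 2 := by
  have h1 := h.modulus s' hs' s hs hss
  have h2 := hp s hs
  have h3 := hq s' hs'
  have h4 := h.ε_le
  have h5 := h.δ_pos
  refine norm_sub_le_of_endpoints (by linarith) ?_ hz
  have := norm_sub_le_norm_sub_add_norm_sub (f (q + s')) (f s') (f s)
  linarith

/-- Moving the two feet of the closing segment from `s₀, s₀'` to `s₁, s₁'` does not change the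
winding number about a point far away. -/
theorem GateScale.chordWinding_eq_of_far (h : GateScale f δ ω ε) (hG : IsChordLog f G)
    {p q t s₀ s₀' s₁ s₁' : ℝ} (hp0 : 0 ≤ p) (hq0 : 0 ≤ q) (hpt : p + 5 < t) (hqt : q + 5 < t)
    (hp : ∀ s ∈ Set.Icc (0 : ℝ) 5, ‖f (p + s) - f s‖ ≤ ε)
    (hq : ∀ s ∈ Set.Icc (0 : ℝ) 5, ‖f (q + s) - f s‖ ≤ ε)
    (h₀ : s₀ ∈ Set.Icc (1 : ℝ) 4) (h₀' : s₀' ∈ Set.Icc (1 : ℝ) 4)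
    (h₁ : s₁ ∈ Set.Icc (1 : ℝ) 4) (h₁' : s₁' ∈ Set.Icc (1 : ℝ) 4)
    (hd₀ : |s₀' - s₀| ≤ 2 * ω) (hd₁ : |s₁' - s₁| ≤ 2 * ω)
    (hfar : ∀ r ∈ segment ℝ s₀ s₁, δ ≤ ‖f t - f r‖) :
    chordWinding f G (p + s₀) (q + s₀') t = chordWinding f G (p + s₁) (q + s₁') t := by
  have hσ : ∀ x ∈ Set.Icc (0 : ℝ) 1, s₀ + x * (s₁ - s₀) ∈ Set.Icc (1 : ℝ) 4 := fun x hx => by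
    have := (convex_Icc (1 : ℝ) 4).add_smul_sub_mem h₀ h₁ hx
    simpa using this
  have hσ' : ∀ x ∈ Set.Icc (0 : ℝ) 1, s₀' + x * (s₁' - s₀') ∈ Set.Icc (1 : ℝ) 4 := fun x hx => by
    have := (convex_Icc (1 : ℝ) 4).add_smul_sub_mem h₀' h₁' hx
    simpa using this
  have hdd : ∀ x ∈ Set.Icc (0 : ℝ) 1,
      |(s₀' + x * (s₁' - s₀')) - (s₀ + x * (s₁ - s₀))| ≤ 2 * ω := fun x hx => by
    rw [abs_le] at hd₀ hd₁ ⊢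
    obtain ⟨hx0, hx1⟩ := hx
    constructor <;> nlinarith
  have key := hG.chordWinding_eq h.cont (isPreconnected_Icc (a := (0 : ℝ)) (b := 1))
    (s := fun x => p + (s₀ + x * (s₁ - s₀))) (s' := fun x => q + (s₀' + x * (s₁' - s₀')))
    (t := fun _ => t) (by fun_prop) (by fun_prop) (by fun_prop)
    (fun x hx => by linarith [(hσ x hx).1]) (fun x hx => by linarith [(hσ x hx).2])
    (fun x hx => by linarith [(hσ' x hx).1]) (fun x hx => by linarith [(hσ' x hx).2])
    (fun x hx hm => by
      have h1 := h.norm_sub_le_of_mem_chord ⟨zero_le_one.trans (hσ x hx).1, by linarith [(hσ x hx).2]⟩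
        ⟨zero_le_one.trans (hσ' x hx).1, by linarith [(hσ' x hx).2]⟩ hp hq (hdd x hx) hm
      have h2 := hfar (s₀ + x * (s₁ - s₀)) (by
        rw [segment_eq_image']; exact ⟨x, hx, by simp⟩)
      linarith [h.δ_pos])
    (Set.left_mem_Icc.2 zero_le_one) (Set.right_mem_Icc.2 zero_le_one)
  simpa using key

theorem GateScale.chordWinding_eq (h : GateScale f δ ω ε) (hG : IsChordLog f G) {p q v : ℝ}
    (hp0 : 0 ≤ p) (hpq : p + 10 ≤ q) (hqv : q + 10 ≤ v)
    (hp : ∀ s ∈ Set.Icc (0 : ℝ) 5, ‖f (p + s) - f s‖ ≤ ε)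
    (hq : ∀ s ∈ Set.Icc (0 : ℝ) 5, ‖f (q + s) - f s‖ ≤ ε)
    (hv : ∀ s ∈ Set.Icc (0 : ℝ) 5, ‖f (v + s) - f s‖ ≤ ε) :
    chordWinding f G (p + 2) (q + 2) (v + 5 / 2) = chordWinding f G (p + 3) (q + 3) (v + 5 / 2) := by
  have hδ := h.δ_pos
  have hε := h.ε_pos
  have hεδ := h.ε_le
  have hω := h.ω_le
  have hω0 := h.ω_pos
  have hf := h.cont
  have hq0 : 0 ≤ q := by linarith
  -- the free segment
  have hdisj : Disjoint (f '' Set.Icc (p + 1) (p + 4)) (f '' Set.Icc (q + 1) (q + 4)) := by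
    rw [Set.disjoint_left]
    rintro _ ⟨x, hx, rfl⟩ ⟨y, hy, hxy⟩
    have := h.inj (Set.mem_Ici.2 (by linarith [hy.1])) (Set.mem_Ici.2 (by linarith [hx.1])) hxy
    linarith [hx.2, hy.1]
  obtain ⟨_, ⟨pa, hpa, rfl⟩, _, ⟨qa, hqa, rfl⟩, hA, hB, hfree⟩ := exists_free_subsegment
    (isCompact_Icc.image hf) (isCompact_Icc.image hf) hdisj
    (x := f (p + 2)) (y := f (q + 2)) ⟨_, by constructor <;> linarith, rfl⟩
    ⟨_, by constructor <;> linarith, rfl⟩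
  obtain ⟨a, rfl⟩ : ∃ a, pa = p + a := ⟨pa - p, by ring⟩
  obtain ⟨a', rfl⟩ : ∃ a', qa = q + a' := ⟨qa - q, by ring⟩
  have ha : a ∈ Set.Icc (1 : ℝ) 4 := ⟨by linarith [hpa.1], by linarith [hpa.2]⟩
  have ha' : a' ∈ Set.Icc (1 : ℝ) 4 := ⟨by linarith [hqa.1], by linarith [hqa.2]⟩
  have ha5 : a ∈ Set.Icc (0 : ℝ) 5 := ⟨by linarith [ha.1], by linarith [ha.2]⟩
  have ha5' : a' ∈ Set.Icc (0 : ℝ) 5 := ⟨by linarith [ha'.1], by linarith [ha'.2]⟩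
  have h2 : (2 : ℝ) ∈ Set.Icc (0 : ℝ) 5 := by constructor <;> norm_num
  have h3 : (3 : ℝ) ∈ Set.Icc (0 : ℝ) 5 := by constructor <;> norm_num
  have h52 : (5 / 2 : ℝ) ∈ Set.Icc (0 : ℝ) 5 := by constructor <;> norm_num
  have hnear2 : ∀ z ∈ segment ℝ (f (p + 2)) (f (q + 2)), ‖z - f 2‖ ≤ ε := fun z hz =>
    norm_sub_le_of_endpoints (hp 2 h2) (hq 2 h2) hz
  have hnear3 : ∀ z ∈ segment ℝ (f (p + 3)) (f (q + 3)), ‖z - f 3‖ ≤ ε := fun z hz =>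
    norm_sub_le_of_endpoints (hp 3 h3) (hq 3 h3) hz
  have hSa : ∀ z ∈ segment ℝ (f (p + a)) (f (q + a')), ‖z - f 2‖ ≤ ε := fun z hz =>
    hnear2 z ((convex_segment _ _).segment_subset hA hB hz)
  have haω : |a - 2| ≤ ω := by
    refine h.separation a ha5 2 h2 ?_
    have e1 := hp a ha5
    have e2 := hnear2 _ hA
    have := norm_sub_le_norm_sub_add_norm_sub (f a) (f (p + a)) (f 2)
    rw [norm_sub_rev (f a) (f (p + a))] at this
    linarith
  have haω' : |a' - 2| ≤ ω := by
    refine h.separation a' ha5' 2 h2 ?_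
    have e1 := hq a' ha5'
    have e2 := hnear2 _ hB
    have := norm_sub_le_norm_sub_add_norm_sub (f a') (f (q + a')) (f 2)
    rw [norm_sub_rev (f a') (f (q + a'))] at this
    linarith
  have haa : |a' - a| ≤ 2 * ω := by
    rw [abs_le] at *
    constructor <;> linarith [haω.1, haω.2, haω'.1, haω'.2]
  have hne : f (p + a) ≠ f (q + a') := fun e => by
    have := h.inj (Set.mem_Ici.2 (by linarith [ha.1])) (Set.mem_Ici.2 (by linarith [ha'.1])) e
    linarith [ha.2, ha'.1]
  have hdis : ∀ z ∈ segment ℝ (f (p + a)) (f (q + a')), z ∉ segment ℝ (f (p + 3)) (f (q + 3)) := by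
    intro z hz hz'
    have e1 := hSa z hz
    have e2 := hnear3 z hz'
    have e3 := norm_sub_le_norm_sub_add_norm_sub (f 2) z (f 3)
    rw [norm_sub_rev (f 2) z] at e3
    have := h.separation 2 h2 3 h3 (by linarith)
    norm_num at this
    linarith
  set Wa : ℝ → ℝ := fun t => (chordWinding f G (p + a) (q + a') t).im with hWa
  set Wc : ℝ → ℝ := fun t => (chordWinding f G (p + 3) (q + 3) t).im with hWc
  set Ha : Set ℝ := {t | f t ∈ segment ℝ (f (p + a)) (f (q + a'))} with hHa
  set Hc : Set ℝ := {t | f t ∈ segment ℝ (f (p + 3)) (f (q + 3))} with hHc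
  set O : Set ℝ := {t | ∀ r ∈ Set.Icc (1 : ℝ) 4, δ ≤ ‖f t - f r‖} with hO
  have hsegc : ∀ x y : ℂ, IsClosed (segment ℝ x y) := fun x y => by
    rw [segment_eq_image_lineMap]
    exact (isCompact_Icc.image AffineMap.lineMap_continuous).isClosed
  have hHac : IsClosed Ha := (hsegc _ _).preimage hf
  have hHcc : IsClosed Hc := (hsegc _ _).preimage hf
  have hOc : IsClosed O := by
    simp only [hO, Set.ofPred_forall]
    exact isClosed_biInter fun r _ => isClosed_le continuous_const (by fun_prop)
  have hOout : ∀ k l, 0 ≤ k → k ≤ l → ∀ s ∈ Set.Icc (1 : ℝ) 4, ∀ s' ∈ Set.Icc (1 : ℝ) 4,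
      ‖f k - f s‖ ≤ δ → ‖f l - f s'‖ ≤ δ → s' + 1 / 8 < s → ∃ u ∈ Set.Icc k l, u ∈ O := by
    intro k l hk hkl s hs s' hs' hks hls hss
    by_contra! hcon
    have := h.progress k l hk hkl s hs s' hs' (fun u hu => by
      have := hcon u hu
      simp only [hO, Set.mem_ofPred_eq] at this
      push Not at this
      obtain ⟨r, hr, hr'⟩ := this
      exact ⟨r, hr, hr'.le⟩) hks hls
    linarith
  have hconst : ∀ b b', b ∈ Set.Icc (1 : ℝ) 4 → b' ∈ Set.Icc (1 : ℝ) 4 → ∀ x y, v ≤ x → x ≤ y →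
      (∀ z ∈ Set.Icc x y, z ∉ {t | f t ∈ segment ℝ (f (p + b)) (f (q + b'))}) →
      chordWinding f G (p + b) (q + b') x = chordWinding f G (p + b) (q + b') y := by
    intro b b' hb hb' x y hvx hxy hz
    exact hG.chordWinding_eq hf (isPreconnected_Icc (a := x) (b := y)) (s := fun _ => p + b)
      (s' := fun _ => q + b') (t := fun t => t) (by fun_prop) (by fun_prop) (by fun_prop)
      (fun t ht => by linarith [hb.1]) (fun t ht => by linarith [hb.2, ht.1])
      (fun t ht => by linarith [hb'.1]) (fun t ht => by linarith [hb'.2, ht.1])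
      hz (Set.left_mem_Icc.2 hxy) (Set.right_mem_Icc.2 hxy)
  have hI2 : (2 : ℝ) ∈ Set.Icc (1 : ℝ) 4 := by constructor <;> norm_num
  have hI3 : (3 : ℝ) ∈ Set.Icc (1 : ℝ) 4 := by constructor <;> norm_num
  have hI52 : (5 / 2 : ℝ) ∈ Set.Icc (1 : ℝ) 4 := by constructor <;> norm_num
  have hHaO : ∀ x ∈ O, x ∉ Ha := fun x hx hxa => by
    have e1 := hx 2 hI2
    have e2 := hSa _ hxa
    linarith
  have hHcO : ∀ x ∈ O, x ∉ Hc := fun x hx hxa => by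
    have e1 := hx 3 hI3
    have e2 := hnear3 _ hxa
    linarith
  have hagree : ∀ x, v ≤ x → x ∈ O →
      chordWinding f G (p + a) (q + a') x = chordWinding f G (p + 3) (q + 3) x := by
    intro x hx hxO
    refine h.chordWinding_eq_of_far hG hp0 hq0 (by linarith) (by linarith) hp hq ha ha' hI3 hI3 haa
      (by simpa using hω0.le) fun r hr => hxO r ((convex_Icc _ _).segment_subset ha hI3 hr)
  have hprog : ∀ k l, v ≤ k → k ≤ l → k ∈ Hc → l ∈ Ha → ∃ u ∈ Set.Icc k l, u ∈ O := by
    intro k l hk hkl hkc hla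
    refine hOout k l (by linarith) hkl 3 hI3 2 hI2 ?_ ?_ (by norm_num)
    · linarith [hnear3 _ hkc]
    · linarith [hSa _ hla]
  have hm := hv (5 / 2) h52
  set m := v + 5 / 2 with hmdef
  have hv0 : v ∈ O := fun r hr => by
    have e1 := h.start r hr
    have e2 := hv 0 (by simp)
    rw [add_zero] at e2
    have := norm_sub_le_norm_sub_add_norm_sub (f 0) (f v) (f r)
    rw [norm_sub_rev (f 0) (f v)] at this
    linarith
  have hv5 : v + 5 ∈ O := fun r hr => by
    have e1 := h.finish r hr
    have e2 := hv 5 (by simp)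
    have := norm_sub_le_norm_sub_add_norm_sub (f 5) (f (v + 5)) (f r)
    rw [norm_sub_rev (f 5) (f (v + 5))] at this
    linarith
  obtain ⟨η, hη, hηW⟩ := hG.exists_chordWinding_eq hf (s := p + a) (s' := q + a') (v := v)
    (by linarith [ha.1]) (by linarith [ha.2, ha'.1]) (by linarith [ha'.2]) (hHaO v hv0)
  obtain ⟨t, ht, htv⟩ := h.recurrent v (min η (δ / 4)) 5 (by positivity)
  have htv := htv v ⟨by linarith, le_rfl⟩
  rw [add_comm t v] at htv
  have hret : Wa (v + t) = Wa v := by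
    simp only [hWa]
    rw [hηW (v + t) (by linarith [ha'.2]) (htv.trans_le (min_le_left _ _))]
  have hvt : v + t ∈ O := fun r hr => by
    have e1 := h.start r hr
    have e2 := hv 0 (by simp)
    rw [add_zero] at e2
    have e3 := htv.trans_le (min_le_right _ _)
    have e4 := norm_sub_le_norm_sub_add_norm_sub (f 0) (f v) (f r)
    rw [norm_sub_rev (f 0) (f v)] at e4
    have e5 := norm_sub_le_norm_sub_add_norm_sub (f v) (f (v + t)) (f r)
    rw [norm_sub_rev (f v) (f (v + t))] at e5
    linarith
  have hpass : ∀ Va Vc : ℝ → ℝ, (∀ x y, v ≤ x → x ≤ y → (∀ z ∈ Set.Icc x y, z ∉ Ha) → Va x = Va y) →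
      (∀ x y, v ≤ x → x ≤ y → (∀ z ∈ Set.Icc x y, z ∉ Hc) → Vc x = Vc y) →
      (∀ x, v ≤ x → x ∈ O → Va x = Vc x) →
      (∀ k, v ≤ k → k ∈ Ha → ∀ᶠ x in 𝓝[>] k, Va x ≤ Vc x) → Va (v + t) = Va v → Va m = Vc m := by
    intro Va Vc hVa hVc hag hsg hre
    have hgp : GatePassage Va Vc Ha Hc O v (v + t) :=
      { closed_a := hHac
        closed_c := hHcc
        closed_O := hOc
        const_a := fun x y hx hxy _ => hVa x y hx hxy
        const_c := fun x y hx hxy _ => hVc x y hx hxy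
        notMem_a := hHaO
        notMem_c := hHcO
        agree := fun x hx _ => hag x hx
        progress := fun k l hk hkl _ => hprog k l hk hkl
        sign := fun k hk _ => hsg k hk }
    by_contra hne
    have l1 := (hgp.mono le_rfl (by linarith : v + 5 ≤ v + t)).lt hv0 hv5 (m := m) (by linarith)
      (by linarith)
      (fun k hk hkc => hOout k m (by linarith [hk.1]) hk.2 3 hI3 (5 / 2) hI52
        (by linarith [hnear3 _ hkc]) (by linarith) (by norm_num))
      (fun k hk hka => hOout m k (by linarith) hk.1 (5 / 2) hI52 2 hI2
        (by linarith) (by linarith [hSa _ hka]) (by norm_num)) hne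
    have l2 := (hgp.mono (by linarith : v ≤ v + 5) le_rfl).le (by linarith) hv5 hvt
    linarith
  have hWm : Wa m = Wc m := by
    have hsign := hG.sign_crossing hf (p₁ := p + 1) (p₂ := p + 4) (q₁ := q + 1) (q₂ := q + 4)
      (pa := p + a) (pc := p + 3) (qa := q + a') (qc := q + 3) (T := v) (by linarith)
      (by linarith) (by linarith) (by linarith) hpa (by constructor <;> linarith) hqa
      (by constructor <;> linarith) hne
      (fun z hz u hu e => (hfree z hz).1 ⟨u, hu, e.symm⟩)
      (fun z hz u hu e => (hfree z hz).2 ⟨u, hu, e.symm⟩) hdis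
    rcases hsign with hsg | hsg
    · exact hpass Wa Wc (fun x y hx hxy hz => congrArg Complex.im (hconst a a' ha ha' x y hx hxy hz))
        (fun x y hx hxy hz => congrArg Complex.im (hconst 3 3 hI3 hI3 x y hx hxy hz))
        (fun x hx hxO => congrArg Complex.im (hagree x hx hxO)) hsg hret
    · have := hpass (fun x => -Wa x) (fun x => -Wc x)
        (fun x y hx hxy hz => congrArg (fun w => -Complex.im w) (hconst a a' ha ha' x y hx hxy hz))
        (fun x y hx hxy hz => congrArg (fun w => -Complex.im w) (hconst 3 3 hI3 hI3 x y hx hxy hz))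
        (fun x hx hxO => congrArg (fun w => -Complex.im w) (hagree x hx hxO))
        (fun k hk hka => (hsg k hk hka).mono fun x hx => neg_le_neg hx) (by rw [hret])
      exact neg_injective this
  have hmove : chordWinding f G (p + a) (q + a') m = chordWinding f G (p + 2) (q + 2) m := by
    refine h.chordWinding_eq_of_far hG hp0 hq0 (by linarith) (by linarith) hp hq ha ha' hI2 hI2 haa
      (by simpa using hω0.le) fun r hr => ?_
    have hr' : r ∈ Set.Icc (1 : ℝ) (9 / 4) := by
      refine (convex_Icc _ _).segment_subset ⟨ha.1, ?_⟩ (by constructor <;> norm_num) hr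
      linarith [(abs_le.1 haω).2]
    have e1 := h.mid r hr'
    have e2 := norm_sub_le_norm_sub_add_norm_sub (f (5 / 2)) (f m) (f r)
    rw [norm_sub_rev (f (5 / 2)) (f m)] at e2
    linarith
  rw [← hmove]
  obtain ⟨n, hn⟩ := hG.exists_int_chordWinding (s := p + a) (s' := q + a') (t := m)
    (by linarith [ha.1]) (by linarith [ha.2]) (by linarith [ha'.1]) (by linarith [ha'.2])
  obtain ⟨n', hn'⟩ := hG.exists_int_chordWinding (s := p + 3) (s' := q + 3) (t := m)
    (by linarith) (by linarith) (by linarith) (by linarith)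
  simp only [hWa, hWc] at hWm
  rw [hn, hn'] at hWm ⊢
  simp at hWm
  rw [hWm]

end

section
variable {f : ℝ → ℂ} {G : ℝ → ℝ → ℂ} {δ ω ε : ℝ}

/-- Two nearby copies of the initial arc wind around each other an odd number of half turns more
in one direction than in the other. -/
theorem GateScale.exists_odd_increment (h : GateScale f δ ω ε) (hG : IsChordLog f G)
    (hsmall : ε ≤ δ / 1000) (hgap : ∀ s ∈ Set.Icc (2 : ℝ) (5 / 2), 2 * δ ≤ ‖f (s + 1 / 2) - f s‖)
    {p q : ℝ} (hp0 : 0 ≤ p) (hpq : p + 10 ≤ q)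
    (hp : ∀ s ∈ Set.Icc (0 : ℝ) 5, ‖f (p + s) - f s‖ ≤ ε)
    (hq : ∀ s ∈ Set.Icc (0 : ℝ) 5, ‖f (q + s) - f s‖ ≤ ε) :
    ∃ n : ℤ, |((G (p + 3) (q + 5 / 2) - G (p + 2) (q + 5 / 2)) -
      (G (p + 5 / 2) (q + 3) - G (p + 5 / 2) (q + 2))).im - 2 * (2 * n + 1) * Real.pi| ≤ 1 / 10 := by
  have hε := h.ε_pos
  have hclose : ∀ x ∈ Set.Icc (2 : ℝ) (5 / 2),
      ‖Complex.exp (G (p + (x + 1 / 2)) (q + x)) - (-1) * Complex.exp (G (p + x) (q + (x + 1 / 2)))‖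
        ≤ 1 / 100 * ‖(-1) * Complex.exp (G (p + x) (q + (x + 1 / 2)))‖ := by
    intro x hx
    obtain ⟨hx1, hx2⟩ := hx
    rw [hG.exp_eq _ _ (by linarith) (by linarith), hG.exp_eq _ _ (by linarith) (by linarith),
      neg_one_mul, norm_neg, sub_neg_eq_add]
    have e1 := hp x ⟨by linarith, by linarith⟩
    have e2 := hq x ⟨by linarith, by linarith⟩
    have e3 := hp (x + 1 / 2) ⟨by linarith, by linarith⟩
    have e4 := hq (x + 1 / 2) ⟨by linarith, by linarith⟩
    have e5 := hgap x ⟨hx1, hx2⟩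
    have e6 : ‖f (q + x) - f (p + (x + 1 / 2)) + (f (q + (x + 1 / 2)) - f (p + x))‖ ≤ 4 * ε := by
      rw [show f (q + x) - f (p + (x + 1 / 2)) + (f (q + (x + 1 / 2)) - f (p + x)) =
        ((f (q + x) - f x) + (f (q + (x + 1 / 2)) - f (x + 1 / 2))) -
        ((f (p + x) - f x) + (f (p + (x + 1 / 2)) - f (x + 1 / 2))) by ring]
      refine (norm_sub_le _ _).trans ?_
      have := norm_add_le (f (q + x) - f x) (f (q + (x + 1 / 2)) - f (x + 1 / 2))
      have := norm_add_le (f (p + x) - f x) (f (p + (x + 1 / 2)) - f (x + 1 / 2))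
      linarith
    have e7 : ‖f (x + 1 / 2) - f x‖ ≤ ‖f (q + (x + 1 / 2)) - f (p + x)‖ + 2 * ε := by
      rw [show f (x + 1 / 2) - f x = (f (q + (x + 1 / 2)) - f (p + x)) -
        (f (q + (x + 1 / 2)) - f (x + 1 / 2)) + (f (p + x) - f x) by ring]
      refine (norm_add_le _ _).trans ?_
      have := norm_sub_le (f (q + (x + 1 / 2)) - f (p + x)) (f (q + (x + 1 / 2)) - f (x + 1 / 2))
      linarith
    linarith
  have hinc := norm_log_increment_sub_le (A := fun x => G (p + (x + 1 / 2)) (q + x))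
    (B := fun x => G (p + x) (q + (x + 1 / 2))) (by norm_num : (2 : ℝ) ≤ 5 / 2)
    (hG.comp (by fun_prop) (by fun_prop) (fun x hx => by linarith [hx.1])
      (fun x hx => by linarith [hx.2]))
    (hG.comp (by fun_prop) (by fun_prop) (fun x hx => by linarith [hx.1])
      (fun x hx => by linarith [hx.2])) (neg_ne_zero.2 one_ne_zero) hclose
  have h52 := norm_log_le_of_norm_sub_le (by norm_num)
    (mul_ne_zero (neg_ne_zero.2 one_ne_zero) (Complex.exp_ne_zero _))
    (hclose (5 / 2) (by norm_num))
  norm_num only [] at hinc h52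
  set D := G (p + 3) (q + 5 / 2) - G (p + 5 / 2) (q + 3) with hD
  set D' := G (p + 2) (q + 5 / 2) - G (p + 5 / 2) (q + 2) with hD'
  have hDD : ‖D + D'‖ ≤ 3 / 100 := by
    refine (le_of_eq ?_).trans hinc
    congr 1
    rw [hD, hD']
    ring
  set w := Complex.exp (G (p + 3) (q + 5 / 2)) / (-1 * Complex.exp (G (p + 5 / 2) (q + 3))) with hw
  have hexp : Complex.exp D = Complex.exp (Complex.log w + Real.pi * Complex.I) := by
    have h1 := Complex.exp_ne_zero (G (p + 3) (q + 5 / 2))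
    have h2 := Complex.exp_ne_zero (G (p + 5 / 2) (q + 3))
    rw [Complex.exp_add, Complex.exp_log, Complex.exp_pi_mul_I, hw, hD, Complex.exp_sub]
    · field_simp
    · rw [hw]
      exact div_ne_zero h1 (mul_ne_zero (neg_ne_zero.2 one_ne_zero) h2)
  obtain ⟨n, hn⟩ := Complex.exp_eq_exp_iff_exists_int.1 hexp
  refine ⟨n, ?_⟩
  have e1 : (G (p + 3) (q + 5 / 2) - G (p + 2) (q + 5 / 2)) -
      (G (p + 5 / 2) (q + 3) - G (p + 5 / 2) (q + 2)) = 2 * D - (D + D') := by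
    rw [hD, hD']; ring
  have e2 : D.im = (Complex.log w).im + (2 * n + 1) * Real.pi := by
    rw [hn]; simp; ring
  have e3 := (Complex.abs_im_le_norm _).trans hDD
  have e4 := (Complex.abs_im_le_norm _).trans h52
  rw [e1]
  simp only [Complex.sub_im, Complex.mul_im, Complex.re_ofNat, Complex.im_ofNat, zero_mul,
    add_zero, e2]
  rw [abs_le] at *
  constructor <;> linarith

/-- The two arcs of a pair of nearby strands wind equally around the midpoint of a third one. -/
theorem GateScale.norm_increment_sub_le (h : GateScale f δ ω ε) (hG : IsChordLog f G)
    (hsmall : ε ≤ δ / 1000) (hgap : ∀ s ∈ Set.Icc (2 : ℝ) (5 / 2), 2 * δ ≤ ‖f (s + 1 / 2) - f s‖)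
    {p q v : ℝ} (hp0 : 0 ≤ p) (hpq : p + 10 ≤ q) (hqv : q + 10 ≤ v)
    (hp : ∀ s ∈ Set.Icc (0 : ℝ) 5, ‖f (p + s) - f s‖ ≤ ε)
    (hq : ∀ s ∈ Set.Icc (0 : ℝ) 5, ‖f (q + s) - f s‖ ≤ ε)
    (hv : ∀ s ∈ Set.Icc (0 : ℝ) 5, ‖f (v + s) - f s‖ ≤ ε) :
    ‖(G (q + 3) (v + 5 / 2) - G (q + 2) (v + 5 / 2)) -
      (G (p + 3) (v + 5 / 2) - G (p + 2) (v + 5 / 2))‖ ≤ 3 / 100 := by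
  have key := h.chordWinding_eq hG hp0 hpq hqv hp hq hv
  have hε := h.ε_pos
  have hfoot : ∀ s ∈ Set.Icc (2 : ℝ) 3, 2 * δ ≤ ‖f (5 / 2) - f s‖ →
      ‖Complex.log ((f (v + 5 / 2) - f (p + s)) / (f (v + 5 / 2) - f (q + s)))‖ ≤
        3 / 2 * (1 / 100) := by
    intro s hs hg
    have e1 := hp s ⟨by linarith [hs.1], by linarith [hs.2]⟩
    have e2 := hq s ⟨by linarith [hs.1], by linarith [hs.2]⟩
    have e3 := hv (5 / 2) (by norm_num)
    refine norm_log_le_of_norm_sub_le (by norm_num)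
      (hG.chord_ne_zero (by linarith [hs.1]) (by linarith [hs.2])) ?_
    have e4 : ‖f (v + 5 / 2) - f (p + s) - (f (v + 5 / 2) - f (q + s))‖ ≤ 2 * ε := by
      rw [show f (v + 5 / 2) - f (p + s) - (f (v + 5 / 2) - f (q + s)) =
        (f (q + s) - f s) - (f (p + s) - f s) by ring]
      exact (norm_sub_le _ _).trans (by linarith)
    have e5 : ‖f (5 / 2) - f s‖ ≤ ‖f (v + 5 / 2) - f (q + s)‖ + 2 * ε := by
      rw [show f (5 / 2) - f s = (f (v + 5 / 2) - f (q + s)) - (f (v + 5 / 2) - f (5 / 2)) +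
        (f (q + s) - f s) by ring]
      refine (norm_add_le _ _).trans ?_
      have := norm_sub_le (f (v + 5 / 2) - f (q + s)) (f (v + 5 / 2) - f (5 / 2))
      linarith
    linarith
  have g2 := hgap 2 (by norm_num)
  have g3 := hgap (5 / 2) (by norm_num)
  norm_num only [] at g2 g3
  rw [norm_sub_rev] at g3
  have l2 := hfoot 2 (by norm_num) g2
  have l3 := hfoot 3 (by norm_num) g3
  simp only [chordWinding] at key
  have e : (G (q + 3) (v + 5 / 2) - G (q + 2) (v + 5 / 2)) -
      (G (p + 3) (v + 5 / 2) - G (p + 2) (v + 5 / 2)) =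
      Complex.log ((f (v + 5 / 2) - f (p + 2)) / (f (v + 5 / 2) - f (q + 2))) -
      Complex.log ((f (v + 5 / 2) - f (p + 3)) / (f (v + 5 / 2) - f (q + 3))) := by
    linear_combination -key
  rw [e]
  exact (norm_sub_le _ _).trans (by linarith)

theorem exists_pos_le_norm_sub (hf : Continuous f) (hi : Set.InjOn f (Set.Ici 0)) {a b x : ℝ}
    (ha : 0 ≤ a) (hx0 : 0 ≤ x) (hx : x ∉ Set.Icc a b) :
    ∃ μ > 0, ∀ u ∈ Set.Icc a b, μ ≤ ‖f x - f u‖ := by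
  obtain hn | hn := (Set.Icc a b).eq_empty_or_nonempty
  · exact ⟨1, one_pos, by simp [hn]⟩
  obtain ⟨u, hu, hmin⟩ := (isCompact_Icc (a := a) (b := b)).exists_isMinOn hn
    (f := fun u => ‖f x - f u‖) (by fun_prop)
  refine ⟨‖f x - f u‖, norm_pos_iff.2 (sub_ne_zero.2 fun e => hx ?_), fun v hv => hmin hv⟩
  rw [hi (Set.mem_Ici.2 hx0) (Set.mem_Ici.2 (ha.trans hu.1)) e]
  exact hu

theorem GateScale.false (h : GateScale f δ ω ε) (hsmall : ε ≤ δ / 1000)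
    (hgap : ∀ s ∈ Set.Icc (2 : ℝ) (5 / 2), 2 * δ ≤ ‖f (s + 1 / 2) - f s‖) : False := by
  obtain ⟨G, hG⟩ := exists_isChordLog h.cont h.inj
  have hf := h.cont
  have h00 : ∀ s ∈ Set.Icc (0 : ℝ) 5, ‖f (0 + s) - f s‖ ≤ ε := by simp [h.ε_pos.le]
  obtain ⟨t₁, ht₁, hc₁⟩ := h.recurrent 5 ε 10 h.ε_pos
  replace hc₁ := fun s hs => (hc₁ s hs).le
  obtain ⟨μ₂, hμ₂, hμ₂'⟩ := exists_pos_le_norm_sub hf h.inj (a := 2) (b := 3) (x := t₁ + 5 / 2)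
    (by norm_num) (by linarith) (fun hm => by linarith [hm.2])
  obtain ⟨t₂, ht₂, hc₂⟩ := h.recurrent 5 (min ε (μ₂ / 100)) (t₁ + 10) (lt_min h.ε_pos (by positivity))
  have hc₂' := fun s hs => (hc₂ s hs).le.trans (min_le_right _ _)
  replace hc₂ := fun s hs => (hc₂ s hs).le.trans (min_le_left _ _)
  obtain ⟨μ₃, hμ₃, hμ₃'⟩ := exists_pos_le_norm_sub hf h.inj (a := t₁ + 2) (b := t₂ + 3) (x := 5 / 2)
    (by linarith) (by norm_num) (fun hm => by linarith [hm.1])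
  obtain ⟨t₃, ht₃, hc₃⟩ := h.recurrent 5 (min ε (μ₃ / 100)) (t₂ + 10) (lt_min h.ε_pos (by positivity))
  have hc₃' := fun s hs => (hc₃ s hs).le.trans (min_le_right _ _)
  replace hc₃ := fun s hs => (hc₃ s hs).le.trans (min_le_left _ _)
  have m1 := h.norm_increment_sub_le hG hsmall hgap le_rfl (by linarith) ht₂.le h00 hc₁ hc₂
  have m2 := h.norm_increment_sub_le hG hsmall hgap (by linarith) ht₂.le ht₃.le hc₁ hc₂ hc₃
  have c1 : ∀ t, t₁ ≤ t → t ≤ t₂ → ‖(G (t + 3) (t₃ + 5 / 2) - G (t + 2) (t₃ + 5 / 2)) -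
      (G (5 / 2) (t + 3) - G (5 / 2) (t + 2))‖ ≤ 3 / 100 := by
    intro t h1 h2
    refine norm_log_increment_sub_le (A := fun s => G (t + s) (t₃ + 5 / 2))
      (B := fun s => G (5 / 2) (t + s)) (by norm_num : (2 : ℝ) ≤ 3)
      (hG.comp (by fun_prop) (by fun_prop) (fun x hx => by linarith [hx.1])
        (fun x hx => by linarith [hx.2]))
      (hG.comp (by fun_prop) (by fun_prop) (fun x hx => by norm_num)
        (fun x hx => by linarith [hx.1])) (neg_ne_zero.2 one_ne_zero) fun s hs => ?_
    rw [hG.exp_eq _ _ (by linarith [hs.1]) (by linarith [hs.2]),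
      hG.exp_eq _ _ (by norm_num) (by linarith [hs.1]), neg_one_mul, norm_neg, sub_neg_eq_add,
      sub_add_sub_cancel, norm_sub_rev (f (t + s))]
    have e1 := hμ₃' (t + s) ⟨by linarith [hs.1], by linarith [hs.2]⟩
    have e2 := hc₃' (5 / 2) (by norm_num)
    linarith
  have c2 : ‖(G (t₁ + 5 / 2) (t₂ + 3) - G (t₁ + 5 / 2) (t₂ + 2)) -
      (G 3 (t₁ + 5 / 2) - G 2 (t₁ + 5 / 2))‖ ≤ 3 / 100 := by
    refine norm_log_increment_sub_le (A := fun s => G (t₁ + 5 / 2) (t₂ + s))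
      (B := fun s => G s (t₁ + 5 / 2)) (by norm_num : (2 : ℝ) ≤ 3)
      (hG.comp (by fun_prop) (by fun_prop) (fun x hx => by linarith)
        (fun x hx => by linarith [hx.1]))
      (hG.comp (by fun_prop) (by fun_prop) (fun x hx => by linarith [hx.1])
        (fun x hx => by linarith [hx.2])) (neg_ne_zero.2 one_ne_zero) fun s hs => ?_
    rw [hG.exp_eq _ _ (by linarith) (by linarith [hs.1]),
      hG.exp_eq _ _ (by linarith [hs.1]) (by linarith [hs.2]), neg_one_mul, norm_neg,
      sub_neg_eq_add, sub_add_sub_cancel]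
    have e1 := hμ₂' s hs
    have e2 := hc₂' s ⟨by linarith [hs.1], by linarith [hs.2]⟩
    linarith
  have c11 := c1 t₁ le_rfl (by linarith)
  have c12 := c1 t₂ (by linarith) le_rfl
  obtain ⟨n₁, hn₁⟩ := h.exists_odd_increment hG hsmall hgap le_rfl (by linarith : 0 + 10 ≤ t₁) h00 hc₁
  obtain ⟨n₂, hn₂⟩ := h.exists_odd_increment hG hsmall hgap le_rfl (by linarith : 0 + 10 ≤ t₂) h00 hc₂
  obtain ⟨n₃, hn₃⟩ := h.exists_odd_increment hG hsmall hgap (by linarith) ht₂.le hc₁ hc₂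
  replace m1 := (Complex.abs_im_le_norm _).trans m1
  replace m2 := (Complex.abs_im_le_norm _).trans m2
  replace c2 := (Complex.abs_im_le_norm _).trans c2
  replace c11 := (Complex.abs_im_le_norm _).trans c11
  replace c12 := (Complex.abs_im_le_norm _).trans c12
  simp only [zero_add, Complex.sub_im] at hn₁ hn₂ hn₃ m1 m2 c2 c11 c12
  have hodd : |(((2 * (n₁ - n₂ + n₃) + 1 : ℤ)) : ℝ)| * (2 * Real.pi) ≤ 1 := by
    rw [← abs_of_pos Real.two_pi_pos, ← abs_mul]
    push_cast
    rw [abs_le] at *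
    constructor <;> linarith [hn₁.1, hn₁.2, hn₂.1, hn₂.2, hn₃.1, hn₃.2]
  have h1 : (1 : ℝ) ≤ |(((2 * (n₁ - n₂ + n₃) + 1 : ℤ)) : ℝ)| := by
    have : 1 ≤ |2 * (n₁ - n₂ + n₃) + 1| := Int.one_le_abs (by omega)
    exact_mod_cast this
  nlinarith [Real.pi_gt_three]

/-- There is no recurrent injective curve in the plane which makes progress along its initial
arc. -/
theorem false_of_recurrent_of_progress (hf : Continuous f) (hi : Set.InjOn f (Set.Ici 0))
    (hrec : ∀ T η B : ℝ, 0 < η → ∃ t > B, ∀ s ∈ Set.Icc 0 T, ‖f (t + s) - f s‖ < η)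
    (hprog : ∃ δ > 0, ∀ k l, 0 ≤ k → k ≤ l → ∀ s ∈ Set.Icc (1 : ℝ) 4, ∀ s' ∈ Set.Icc (1 : ℝ) 4,
      (∀ u ∈ Set.Icc k l, ∃ r ∈ Set.Icc (1 : ℝ) 4, ‖f u - f r‖ ≤ δ) →
      ‖f k - f s‖ ≤ δ → ‖f l - f s'‖ ≤ δ → s ≤ s' + 1 / 8) : False := by
  obtain ⟨δ₀, hδ₀, hprog⟩ := hprog
  obtain ⟨μ₁, hμ₁, h₁⟩ := exists_pos_le_norm_sub hf hi (a := 1) (b := 4) (x := 0)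
    (by norm_num) (by norm_num) (by norm_num)
  obtain ⟨μ₂, hμ₂, h₂⟩ := exists_pos_le_norm_sub hf hi (a := 1) (b := 4) (x := 5)
    (by norm_num) (by norm_num) (by norm_num)
  obtain ⟨μ₃, hμ₃, h₃⟩ := exists_pos_le_norm_sub hf hi (a := 1) (b := 9 / 4) (x := 5 / 2)
    (by norm_num) (by norm_num) (by norm_num)
  have hsep : ∀ ω > 0, ∃ μ > 0, ∀ s ∈ Set.Icc (0 : ℝ) 5, ∀ t ∈ Set.Icc (0 : ℝ) 5, ω ≤ |s - t| →
      μ ≤ ‖f s - f t‖ := by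
    intro ω hω
    set K : Set (ℝ × ℝ) := (Set.Icc (0 : ℝ) 5 ×ˢ Set.Icc (0 : ℝ) 5) ∩ {p | ω ≤ |p.1 - p.2|} with hK
    have hKc : IsCompact K := (isCompact_Icc.prod isCompact_Icc).inter_right
      (isClosed_le continuous_const (by fun_prop))
    obtain hn | hn := K.eq_empty_or_nonempty
    · refine ⟨1, one_pos, fun s hs t ht hst => absurd ?_ (hn ▸ Set.notMem_empty (s, t))⟩
      exact ⟨⟨hs, ht⟩, hst⟩
    · obtain ⟨p, hp, hmin⟩ := hKc.exists_isMinOn hn (f := fun p => ‖f p.1 - f p.2‖)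
        (by fun_prop)
      refine ⟨‖f p.1 - f p.2‖, norm_pos_iff.2 (sub_ne_zero.2 fun e => ?_), fun s hs t ht hst =>
        hmin (show (s, t) ∈ K from ⟨⟨hs, ht⟩, hst⟩)⟩
      have := hi (Set.mem_Ici.2 hp.1.1.1) (Set.mem_Ici.2 hp.1.2.1) e
      have h2 : ω ≤ |p.1 - p.2| := hp.2
      simp only [this, sub_self, abs_zero] at h2
      linarith
  obtain ⟨μ₄, hμ₄, h₄⟩ := hsep (1 / 2) (by norm_num)
  set δ := min δ₀ (min (min μ₁ μ₂) (min μ₃ μ₄) / 2) with hδ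
  have hδpos : 0 < δ := by positivity
  have d0 : δ ≤ δ₀ := min_le_left _ _
  have dm : 2 * δ ≤ min (min μ₁ μ₂) (min μ₃ μ₄) := by
    have := min_le_right δ₀ (min (min μ₁ μ₂) (min μ₃ μ₄) / 2)
    linarith
  simp only [le_min_iff] at dm
  obtain ⟨⟨d1, d2⟩, d3, d4⟩ := dm
  obtain ⟨ω₀, hω₀, hω⟩ := Metric.uniformContinuousOn_iff.1
    (isCompact_Icc.uniformContinuousOn_of_continuous (s := Set.Icc (0 : ℝ) 5) hf.continuousOn)
    (δ / 4) (by positivity)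
  set ω := min (1 / 16) (ω₀ / 4)
  have hωpos : 0 < ω := by positivity
  have w1 : ω ≤ ω₀ / 4 := min_le_right _ _
  obtain ⟨κ, hκ, hκ'⟩ := hsep ω hωpos
  have e1 : min (κ / 4) (δ / 1000) ≤ δ / 1000 := min_le_right _ _
  have e2 : min (κ / 4) (δ / 1000) ≤ κ / 4 := min_le_left _ _
  refine GateScale.false (f := f) (δ := δ) (ω := ω) (ε := min (κ / 4) (δ / 1000)) ?_ e1 ?_
  · exact
      { cont := hf
        inj := hi
        recurrent := hrec
        progress := fun k l hk hkl s hs s' hs' hu h h' => hprog k l hk hkl s hs s' hs'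
          (fun u huk => (hu u huk).imp fun r hr => ⟨hr.1, hr.2.trans d0⟩) (h.trans d0) (h'.trans d0)
        δ_pos := hδpos
        ω_pos := hωpos
        ω_le := min_le_left _ _
        ε_pos := by positivity
        ε_le := by linarith
        start := fun r hr => d1.trans (h₁ r hr)
        finish := fun r hr => d2.trans (h₂ r hr)
        mid := fun r hr => d3.trans (h₃ r hr)
        modulus := fun s hs t ht hst => by
          have := hω s hs t ht (by rw [Real.dist_eq]; linarith)
          rw [dist_eq_norm] at this
          exact this.le
        separation := fun s hs t ht hst => by
          by_contra! hcon
          have := hκ' s hs t ht hcon.le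
          linarith }
  · intro s hs
    refine d4.trans (h₄ _ ⟨by linarith [hs.1], by linarith [hs.2]⟩ _
      ⟨by linarith [hs.1], by linarith [hs.2]⟩ ?_)
    rw [add_sub_cancel_left, abs_of_pos (by norm_num)]

end

theorem IsCompact.exists_tendsto_hyperfilter {A : Type*} [TopologicalSpace A] {K : Set A}
    (hK : IsCompact K) {x : ℕ → A} (hx : ∀ n, x n ∈ K) :
    ∃ a ∈ K, Tendsto x (hyperfilter ℕ) (𝓝 a) :=
  isCompact_iff_ultrafilter_le_nhds.1 hK ((hyperfilter ℕ).map x)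
    (tendsto_principal.2 (Eventually.of_forall hx))

section
variable {Z : Type*} [TopologicalSpace Z]

@[simp]
theorem bebShift_apply (τ t : ℝ≥0) (x : C(ℝ≥0, Z)) : bebShift τ x t = x (t + τ) := rfl

theorem bebShift_bebShift (σ τ : ℝ≥0) (x : C(ℝ≥0, Z)) :
    bebShift σ (bebShift τ x) = bebShift (σ + τ) x := by
  ext t; simp [add_assoc]

theorem bebShift_comm (σ τ : ℝ≥0) (x : C(ℝ≥0, Z)) :
    bebShift σ (bebShift τ x) = bebShift τ (bebShift σ x) := by
  rw [bebShift_bebShift, bebShift_bebShift, add_comm]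

theorem continuous_bebShift (τ : ℝ≥0) : Continuous (bebShift (Z := Z) τ) :=
  ContinuousMap.continuous_precomp _

/-- The function following `x` up to time `τ` and `y` afterwards. -/
noncomputable def switchAt (τ : ℝ≥0) (x y : C(ℝ≥0, Z)) (h : x τ = y 0) : C(ℝ≥0, Z) where
  toFun t := if t ≤ τ then x t else y (t - τ)
  continuous_toFun := Continuous.if_le (by fun_prop) (by fun_prop) (by fun_prop) (by fun_prop)
    (by rintro t rfl; simpa using h)

theorem switchAt_of_le {τ : ℝ≥0} {x y : C(ℝ≥0, Z)} (h : x τ = y 0) {t : ℝ≥0} (ht : t ≤ τ) :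
    switchAt τ x y h t = x t := if_pos ht

theorem switchAt_add {τ : ℝ≥0} {x y : C(ℝ≥0, Z)} (h : x τ = y 0) (t : ℝ≥0) :
    switchAt τ x y h (t + τ) = y t := by
  by_cases ht : t = 0
  · subst ht; rw [zero_add, switchAt_of_le h le_rfl, h]
  · have : ¬ t + τ ≤ τ := by simpa using ht
    simp [switchAt, this]

/-- The elements of `X` which can be extended arbitrarily far into the past. -/
def extendableElements (X : Set C(ℝ≥0, Z)) : Set C(ℝ≥0, Z) :=
  {y | y ∈ X ∧ ∀ τ : ℝ≥0, ∃ y' ∈ X, bebShift τ y' = y}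

variable {X : Set C(ℝ≥0, Z)}

namespace IsSwitchedBebutovShift

theorem bebShift_mem_extendable (hX : IsSwitchedBebutovShift X) {y : C(ℝ≥0, Z)}
    (hy : y ∈ extendableElements X) (τ : ℝ≥0) : bebShift τ y ∈ extendableElements X := by
  refine ⟨hX.2.1 y hy.1 τ, fun σ => ?_⟩
  obtain ⟨y', hy', e⟩ := hy.2 σ
  exact ⟨bebShift τ y', hX.2.1 y' hy' τ, by rw [bebShift_comm, e]⟩

theorem switchAt_mem (hX : IsSwitchedBebutovShift X) {x y : C(ℝ≥0, Z)} {τ : ℝ≥0} (hτ : 0 < τ)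
    (hx : x ∈ X) (hy : y ∈ extendableElements X) (h : x τ = y 0) : switchAt τ x y h ∈ X := by
  obtain ⟨y', hy', rfl⟩ := hy.2 τ
  refine hX.2.2 x hx y' hy' τ hτ (by simpa using h) _ (fun t ht => switchAt_of_le h ht)
    fun t ht => ?_
  obtain ⟨s, rfl⟩ := exists_add_of_le ht
  rw [add_comm τ s, switchAt_add, bebShift_apply]

theorem switchAt_mem_extendable (hX : IsSwitchedBebutovShift X) {x y : C(ℝ≥0, Z)} {τ : ℝ≥0}
    (hτ : 0 < τ) (hx : x ∈ extendableElements X) (hy : y ∈ extendableElements X) (h : x τ = y 0) :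
    switchAt τ x y h ∈ extendableElements X := by
  refine ⟨hX.switchAt_mem hτ hx.1 hy h, fun σ => ?_⟩
  obtain ⟨x', hx', rfl⟩ := hx.2 σ
  have h' : x' (τ + σ) = y 0 := h
  refine ⟨switchAt (τ + σ) x' y h', hX.switchAt_mem (by positivity) hx' hy h', ?_⟩
  ext t
  rw [bebShift_apply]
  rcases le_total t τ with ht | ht
  · rw [switchAt_of_le h ht, switchAt_of_le h' (by gcongr), bebShift_apply]
  · obtain ⟨s, rfl⟩ := exists_add_of_le ht
    rw [add_comm τ s, switchAt_add, add_assoc, switchAt_add]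

/-- A loop gives rise to a periodic element. -/
theorem exists_periodic_of_loop [T2Space Z] (hX : IsSwitchedBebutovShift X) {x : C(ℝ≥0, Z)}
    (hx : x ∈ extendableElements X) {p : ℝ≥0} (hp : 0 < p) (hxp : x p = x 0) :
    ∃ χ ∈ X, ∀ t, χ (t + p) = χ t := by
  let A := {y : C(ℝ≥0, Z) // y ∈ extendableElements X ∧ y 0 = x 0}
  let step : A → A := fun y => ⟨switchAt p x y.1 (hxp.trans y.2.2.symm),
    hX.switchAt_mem_extendable hp hx y.2.1 _, switchAt_of_le _ hp.le⟩
  let u : ℕ → A := fun n => step^[n] ⟨x, hx, rfl⟩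
  have hu : ∀ n, u (n + 1) = step (u n) := fun n => Function.iterate_succ_apply' _ _ _
  have hle : ∀ n t, t ≤ p → (u (n + 1)).1 t = x t := fun n t ht => by
    rw [hu]; exact switchAt_of_le (hxp.trans (u n).2.2.symm) ht
  have hadd : ∀ n t, (u (n + 1)).1 (t + p) = (u n).1 t := fun n t => by
    rw [hu]; exact switchAt_add (hxp.trans (u n).2.2.symm) t
  have hstab : ∀ n : ℕ, ∀ t : ℝ≥0, t ≤ n * p → (u (n + 1)).1 t = (u n).1 t := by
    intro n
    induction n with
    | zero =>
      intro t ht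
      have : t = 0 := by simpa using ht
      rw [this, (u 1).2.2, (u 0).2.2]
    | succ n ih =>
      intro t ht
      rcases le_total t p with h | h
      · rw [hle _ _ h, hle _ _ h]
      · obtain ⟨s, rfl⟩ := exists_add_of_le h
        rw [add_comm p s, hadd, hadd]
        refine ih s ?_
        push_cast at ht
        rw [add_mul, one_mul, add_comm] at ht
        exact le_of_add_le_add_right ht
  have hconst : ∀ t : ℝ≥0, ∃ N : ℕ, ∀ n ≥ N, (u n).1 t = (u N).1 t := by
    intro t
    obtain ⟨N, hN⟩ := exists_nat_ge (t / p)
    rw [div_le_iff₀ hp] at hN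
    refine ⟨N, fun n hn => ?_⟩
    induction n, hn using Nat.le_induction with
    | base => rfl
    | succ n hn ih =>
      rw [hstab n t (hN.trans (by gcongr)), ih]
  obtain ⟨χ, hχ, hlim⟩ := hX.1.exists_tendsto_hyperfilter (x := fun n => (u n).1)
    fun n => (u n).2.1.1
  have hval : ∀ t, ∀ᶠ n in atTop, (u n).1 t = χ t := by
    intro t
    obtain ⟨N, hN⟩ := hconst t
    have h1 : Tendsto (fun n => (u n).1 t) (hyperfilter ℕ) (𝓝 (χ t)) :=
      ((continuous_eval_const t).tendsto χ).comp hlim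
    have h2 : Tendsto (fun n => (u n).1 t) atTop (𝓝 ((u N).1 t)) :=
      tendsto_const_nhds.congr' (eventually_atTop.2 ⟨N, fun n hn => (hN n hn).symm⟩)
    rw [tendsto_nhds_unique h1 (h2.mono_left Nat.hyperfilter_le_atTop)]
    exact eventually_atTop.2 ⟨N, hN⟩
  refine ⟨χ, hχ, fun t => ?_⟩
  obtain ⟨n, h1, h2⟩ := (((tendsto_add_atTop_nat 1).eventually (hval (t + p))).and (hval t)).exists
  rw [← h1, ← h2, hadd]

/-- Two arcs, one from `x a` to `x b` and one from there back to `x a`, give a periodic element. -/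
theorem exists_periodic_of_loop₂ [T2Space Z] (hX : IsSwitchedBebutovShift X) {x y : C(ℝ≥0, Z)}
    (hx : x ∈ extendableElements X) (hy : y ∈ extendableElements X) {a b c d : ℝ≥0}
    (hab : a ≤ b) (hcd : c ≤ d) (hlt : a < b ∨ c < d) (h₁ : x a = y d) (h₂ : x b = y c) :
    ∃ χ ∈ X, ∃ p, 0 < p ∧ ∀ t, χ (t + p) = χ t := by
  obtain ⟨e, rfl⟩ := exists_add_of_le hab
  obtain ⟨e', rfl⟩ := exists_add_of_le hcd
  rcases eq_zero_or_pos e with rfl | he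
  · have he' : 0 < e' := by simpa using hlt
    rw [add_zero] at h₂
    obtain ⟨χ, hχ, h⟩ := hX.exists_periodic_of_loop (hX.bebShift_mem_extendable hy c) he'
      (by simpa [add_comm] using h₁.symm.trans h₂)
    exact ⟨χ, hχ, e', he', h⟩
  · have hs : bebShift a x e = bebShift c y 0 := by simpa [add_comm] using h₂
    have hm := hX.switchAt_mem_extendable he (hX.bebShift_mem_extendable hx a)
      (hX.bebShift_mem_extendable hy c) hs
    obtain ⟨χ, hχ, h⟩ := hX.exists_periodic_of_loop hm (p := e' + e) (by positivity) (by
      rw [switchAt_add, switchAt_of_le hs (zero_le), bebShift_apply, bebShift_apply, zero_add, h₁,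
        add_comm])
    exact ⟨χ, hχ, _, by positivity, h⟩

/-- A minimal subset, consisting of recurrent extendable elements. -/
theorem exists_minimal [T2Space Z] (hX : IsSwitchedBebutovShift X) (hne : X.Nonempty) :
    ∃ M ⊆ X, M.Nonempty ∧ IsCompact M ∧ (∀ y ∈ M, ∀ τ, bebShift τ y ∈ M) ∧
      M ⊆ extendableElements X ∧
      ∀ y ∈ M, ∀ B : ℝ≥0, y ∈ closure ((fun t => bebShift t y) '' Set.Ici B) := by
  obtain ⟨M, hMX, ⟨⟨hMne, hMc, hMinv⟩, hmin⟩⟩ := zorn_superset_nonempty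
    {M : Set C(ℝ≥0, Z) | M.Nonempty ∧ IsCompact M ∧ ∀ y ∈ M, ∀ τ, bebShift τ y ∈ M} (by
      intro c hc hchain hcne
      refine ⟨⋂₀ c, ⟨?_, ?_, ?_⟩, fun s hs => Set.sInter_subset_of_mem hs⟩
      · rw [Set.sInter_eq_iInter]
        have : Nonempty c := hcne.to_subtype
        refine IsCompact.nonempty_iInter_of_directed_nonempty_isCompact_isClosed _ ?_
          (fun i => (hc i.2).1) (fun i => (hc i.2).2.1) (fun i => (hc i.2).2.1.isClosed)
        exact fun i j => (hchain.total i.2 j.2).elim (fun h => ⟨i, subset_rfl, h⟩)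
          fun h => ⟨j, h, subset_rfl⟩
      · obtain ⟨s, hs⟩ := hcne
        exact (hc hs).2.1.of_isClosed_subset (isClosed_sInter fun t ht => (hc ht).2.1.isClosed)
          (Set.sInter_subset_of_mem hs)
      · exact fun y hy τ s hs => (hc hs).2.2 y (hy s hs) τ) X ⟨hne, hX.1, hX.2.1⟩
  refine ⟨M, hMX, hMne, hMc, hMinv, fun y hy => ⟨hMX hy, fun τ => ?_⟩, fun y hy B => ?_⟩
  · have hsub : bebShift τ '' M ⊆ M := by rintro _ ⟨z, hz, rfl⟩; exact hMinv z hz τ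
    have := hmin (y := bebShift τ '' M) ⟨hMne.image _, hMc.image (continuous_bebShift τ), by
      rintro _ ⟨z, hz, rfl⟩ σ
      exact ⟨bebShift σ z, hMinv z hz σ, bebShift_comm _ _ _⟩⟩ hsub hy
    obtain ⟨y', hy', e⟩ := this
    exact ⟨y', hMX hy', e⟩
  · set S := (fun t => bebShift t y) '' Set.Ici B with hS
    have hsub : closure S ⊆ M := hMc.isClosed.closure_subset_iff.2 (by
      rintro _ ⟨t, -, rfl⟩; exact hMinv y hy t)
    refine hmin (y := closure S) ⟨⟨_, subset_closure ⟨B, Set.mem_Ici.2 le_rfl, rfl⟩⟩,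
      hMc.of_isClosed_subset isClosed_closure hsub, fun z hz τ => ?_⟩ hsub hy
    refine map_mem_closure (continuous_bebShift τ) hz ?_
    rintro _ ⟨t, ht, rfl⟩
    exact ⟨τ + t, Set.mem_Ici.2 (le_add_of_le_right ht), (bebShift_bebShift _ _ _).symm⟩

end IsSwitchedBebutovShift

end

theorem injective_of_forall_loop_trivial {Z : Type*} {ψ : ℝ≥0 → Z}
    (h : ∀ a b c d : ℝ≥0, a ≤ b → c ≤ d → ψ a = ψ d → ψ b = ψ c → a = b ∧ c = d) :
    Function.Injective ψ := by
  intro a b hab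
  rcases le_total a b with hle | hle
  · exact (h a b a a hle le_rfl rfl hab.symm).1
  · exact (h b a b b hle le_rfl rfl hab).1.symm

section
variable {Z : Type*} [TopologicalSpace Z] [T2Space Z]

/-- If `ψ` follows the arc `ψ '' [1, 4]` closely along `[k, l]`, it cannot move backwards on it. -/
theorem exists_progress {M : Set C(ℝ≥0, Z)} (hMc : IsCompact M)
    (hMinv : ∀ y ∈ M, ∀ τ, bebShift τ y ∈ M)
    (hloop : ∀ x ∈ M, ∀ y ∈ M, ∀ a b c d : ℝ≥0, a ≤ b → c ≤ d → x a = y d → x b = y c →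
      a = b ∧ c = d)
    {ψ : C(ℝ≥0, Z)} (hψ : ψ ∈ M) {g : ℝ≥0 → ℂ} (hg : Continuous g)
    (hinv : ∀ r, Tendsto ψ (comap g (𝓝 (g r))) (𝓝 (ψ r))) :
    ∃ δ > (0 : ℝ), ∀ k l, k ≤ l → ∀ s ∈ Set.Icc (1 : ℝ≥0) 4, ∀ s' ∈ Set.Icc (1 : ℝ≥0) 4,
      (∀ u ∈ Set.Icc k l, ∃ r ∈ Set.Icc (1 : ℝ≥0) 4, ‖g u - g r‖ ≤ δ) →
      ‖g k - g s‖ ≤ δ → ‖g l - g s'‖ ≤ δ → s ≤ s' + 1 / 8 := by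
  by_contra hcon
  push Not at hcon
  choose k l hkl s hs s' hs' har hk hl hlt using fun n : ℕ => hcon (1 / ((n : ℝ) + 1)) (by positivity)
  choose m hm using fun n => exists_add_of_le (hkl n)
  have hδ : Tendsto (fun n : ℕ => 1 / ((n : ℝ) + 1)) (hyperfilter ℕ) (𝓝 0) :=
    tendsto_one_div_add_atTop_nhds_zero_nat.mono_left Nat.hyperfilter_le_atTop
  have key : ∀ (u r : ℕ → ℝ≥0) (r₀ : ℝ≥0), Tendsto r (hyperfilter ℕ) (𝓝 r₀) →
      (∀ᶠ n in hyperfilter ℕ, ‖g (u n) - g (r n)‖ ≤ 1 / ((n : ℝ) + 1)) →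
      Tendsto (fun n => ψ (u n)) (hyperfilter ℕ) (𝓝 (ψ r₀)) := by
    intro u r r₀ hr hu
    refine (hinv r₀).comp (tendsto_comap_iff.2 ?_)
    have h1 : Tendsto (fun n => g (u n) - g (r n)) (hyperfilter ℕ) (𝓝 0) :=
      squeeze_zero_norm' hu hδ
    have h2 := h1.add ((hg.tendsto r₀).comp hr)
    exact (by simpa using h2 : Tendsto (fun n => g (u n)) _ _)
  obtain ⟨ξ, hξ, hlim⟩ := hMc.exists_tendsto_hyperfilter (x := fun n => bebShift (k n) ψ)
    fun n => hMinv ψ hψ _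
  obtain ⟨a, -, ha⟩ := (isCompact_Icc (a := (1 : ℝ≥0)) (b := 4)).exists_tendsto_hyperfilter hs
  obtain ⟨a', -, ha'⟩ := (isCompact_Icc (a := (1 : ℝ≥0)) (b := 4)).exists_tendsto_hyperfilter hs'
  have haa : a' + 1 / 8 ≤ a :=
    le_of_tendsto_of_tendsto (ha'.add_const _) ha (Eventually.of_forall fun n => (hlt n).le)
  have hlt' : a' < a := lt_of_lt_of_le (lt_add_of_pos_right _ (by norm_num)) haa
  have heval : ∀ (v : ℕ → ℝ≥0) (v₀ : ℝ≥0) (z : Z), Tendsto v (hyperfilter ℕ) (𝓝 v₀) →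
      Tendsto (fun n => ψ (v n + k n)) (hyperfilter ℕ) (𝓝 z) → ξ v₀ = z := by
    intro v v₀ z hv hz
    have : Tendsto (fun n => bebShift (k n) ψ (v n)) (hyperfilter ℕ) (𝓝 (ξ v₀)) := hlim.eval hv
    exact tendsto_nhds_unique this hz
  have h0 : ξ 0 = ψ a := heval (fun _ => 0) 0 _ tendsto_const_nhds
    (by simpa using key k s a ha (Eventually.of_forall hk))
  by_cases hb : ∃ L₀, ∀ᶠ n in hyperfilter ℕ, m n ≤ L₀
  · obtain ⟨L₀, hL₀⟩ := hb
    obtain ⟨L, -, hL⟩ := (isCompact_Icc (a := (0 : ℝ≥0)) (b := L₀)).exists_tendsto_hyperfilter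
      (x := fun n => min (m n) L₀) fun n => ⟨zero_le, min_le_right _ _⟩
    have hL' : Tendsto m (hyperfilter ℕ) (𝓝 L) :=
      hL.congr' (hL₀.mono fun n hn => min_eq_left hn)
    have h1 : ξ L = ψ a' := heval m L _ hL' (by
      have := key l s' a' ha' (Eventually.of_forall hl)
      simpa [hm, add_comm] using this)
    exact hlt'.ne (hloop ξ hξ ψ hψ 0 L a' a zero_le hlt'.le h0 h1).2
  · push Not at hb
    have hr : ∀ v, ∃ r ∈ Set.Icc (1 : ℝ≥0) 4, ξ v = ψ r := by
      intro v
      have hv : ∀ᶠ n in hyperfilter ℕ, v < m n := hb v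
      have : ∀ n, ∃ r ∈ Set.Icc (1 : ℝ≥0) 4, v < m n →
          ‖g (v + k n) - g r‖ ≤ 1 / ((n : ℝ) + 1) := by
        intro n
        by_cases h : v < m n
        · obtain ⟨r, hr, h'⟩ := har n (v + k n)
            ⟨le_add_self, by rw [hm, add_comm]; gcongr⟩
          exact ⟨r, hr, fun _ => h'⟩
        · exact ⟨s n, hs n, fun h' => absurd h' h⟩
      choose r hr hr' using this
      obtain ⟨R, hR, hRl⟩ :=
        (isCompact_Icc (a := (1 : ℝ≥0)) (b := 4)).exists_tendsto_hyperfilter hr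
      exact ⟨R, hR, heval (fun _ => v) v _ tendsto_const_nhds
        (key _ r R hRl (hv.mono fun n hn => hr' n hn))⟩
    choose r hr hξr using hr
    have hmono : Monotone r := by
      intro v w hvw
      by_contra! h
      have := (hloop ξ hξ ψ hψ v w (r w) (r v) hvw h.le (hξr v) (hξr w)).2
      exact h.ne this
    have hR := tendsto_atTop_ciSup hmono ⟨4, by rintro _ ⟨v, rfl⟩; exact (hr v).2⟩
    have hξR : Tendsto ξ atTop (𝓝 (ψ (⨆ v, r v))) :=
      ((ψ.continuous.tendsto _).comp hR).congr fun v => (hξr v).symm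
    obtain ⟨ζ, hζ, hζl⟩ := hMc.exists_tendsto_hyperfilter (x := fun n : ℕ => bebShift (n : ℝ≥0) ξ)
      fun n => hMinv ξ hξ _
    have hcst : ∀ t, ζ t = ψ (⨆ v, r v) := by
      intro t
      have h1 : Tendsto (fun n : ℕ => bebShift (n : ℝ≥0) ξ t) (hyperfilter ℕ) (𝓝 (ζ t)) :=
        hζl.eval tendsto_const_nhds
      have h2 : Tendsto (fun n : ℕ => t + (n : ℝ≥0)) (hyperfilter ℕ) atTop :=
        (tendsto_atTop_mono (fun _ => le_add_self) tendsto_natCast_atTop_atTop).mono_left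
          Nat.hyperfilter_le_atTop
      exact tendsto_nhds_unique h1 (hξR.comp h2)
    have := (hloop ζ hζ ζ hζ 0 1 0 0 zero_le le_rfl rfl (by rw [hcst, hcst])).1
    exact zero_ne_one this

/-- A recurrent curve in a shift-invariant compact set without loops does not embed in the plane. -/
theorem false_of_planar {M : Set C(ℝ≥0, Z)} (hMc : IsCompact M)
    (hMinv : ∀ y ∈ M, ∀ τ, bebShift τ y ∈ M)
    (hloop : ∀ x ∈ M, ∀ y ∈ M, ∀ a b c d : ℝ≥0, a ≤ b → c ≤ d → x a = y d → x b = y c →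
      a = b ∧ c = d)
    {ψ : C(ℝ≥0, Z)} (hψ : ψ ∈ M)
    (hrec : ∀ B : ℝ≥0, ψ ∈ closure ((fun t => bebShift t ψ) '' Set.Ici B))
    {γ : Z → ℂ} (hγ : ∀ s, ContinuousAt γ (ψ s))
    (hinv : ∀ r, Tendsto ψ (comap (γ ∘ ψ) (𝓝 (γ (ψ r)))) (𝓝 (ψ r))) : False := by
  have hg : Continuous (γ ∘ ψ) :=
    continuous_iff_continuousAt.2 fun s => (hγ s).comp ψ.continuous.continuousAt
  have hψi : Function.Injective ψ := injective_of_forall_loop_trivial (hloop ψ hψ ψ hψ)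
  have hgi : Function.Injective (γ ∘ ψ) := by
    intro a b h
    have h1 : pure a ≤ comap (γ ∘ ψ) (𝓝 (γ (ψ b))) := by
      rw [← map_le_iff_le_comap, map_pure, h]
      exact pure_le_nhds _
    have h2 := (hinv b).mono_left h1
    exact hψi (tendsto_nhds_unique (tendsto_pure_nhds _ _) h2)
  obtain ⟨δ, hδ, hprog⟩ := exists_progress hMc hMinv hloop hψ hg hinv
  refine false_of_recurrent_of_progress (f := fun t => (γ ∘ ψ) t.toNNReal)
    (hg.comp continuous_real_toNNReal) ?_ ?_ ⟨δ, hδ, ?_⟩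
  · intro a ha b hb h
    exact (Real.toNNReal_eq_toNNReal_iff ha hb).1 (hgi h)
  · intro T η B hη
    have hev : ∀ᶠ x in 𝓝 ψ, ∀ s ∈ Set.Icc 0 T.toNNReal, ‖γ (x s) - (γ ∘ ψ) s‖ < η := by
      refine isCompact_Icc.eventually_forall_of_forall_eventually fun s _ => ?_
      have h1 : ContinuousAt (fun z : C(ℝ≥0, Z) × ℝ≥0 => z.1 z.2) (ψ, s) :=
        continuous_eval.continuousAt
      have h2 : ContinuousAt (fun z : C(ℝ≥0, Z) × ℝ≥0 => γ (z.1 z.2) - (γ ∘ ψ) z.2) (ψ, s) :=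
        ((hγ s).comp (f := fun z : C(ℝ≥0, Z) × ℝ≥0 => z.1 z.2) (x := (ψ, s)) h1).sub
          (hg.comp continuous_snd).continuousAt
      refine h2.norm.eventually_lt continuousAt_const ?_
      simpa using hη
    obtain ⟨_, hx, t, ht, rfl⟩ := mem_closure_iff_nhds.1 (hrec (B.toNNReal + 1)) _ hev
    refine ⟨t, ?_, fun s hs => ?_⟩
    · have : B.toNNReal + 1 ≤ t := ht
      have h' : (B.toNNReal : ℝ) + 1 ≤ t := by exact_mod_cast this
      linarith [Real.le_coe_toNNReal B]
    · lift s to ℝ≥0 using hs.1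
      have := hx s ⟨zero_le, NNReal.le_toNNReal_of_coe_le hs.2⟩
      rw [bebShift_apply] at this
      rw [← NNReal.coe_add, Real.toNNReal_coe, Real.toNNReal_coe, add_comm]
      exact this
  · intro k l hk hkl s hs s' hs' har h1 h2
    have hc : ∀ {s : ℝ≥0}, (s : ℝ) ∈ Set.Icc (1 : ℝ) 4 ↔ s ∈ Set.Icc (1 : ℝ≥0) 4 := by
      intro s
      simp only [Set.mem_Icc]
      norm_cast
    lift k to ℝ≥0 using hk
    lift l to ℝ≥0 using k.2.trans hkl
    lift s to ℝ≥0 using zero_le_one.trans hs.1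
    lift s' to ℝ≥0 using zero_le_one.trans hs'.1
    simp only [Real.toNNReal_coe] at h1 h2
    have := hprog k l (by exact_mod_cast hkl) s (hc.1 hs) s' (hc.1 hs') (fun u hu => ?_) h1 h2
    · exact_mod_cast this
    · obtain ⟨r, hr, h⟩ := har u ⟨by exact_mod_cast hu.1, by exact_mod_cast hu.2⟩
      lift r to ℝ≥0 using zero_le_one.trans hr.1
      simp only [Real.toNNReal_coe] at h
      exact ⟨r, hc.1 hr, h⟩

end

/-- Stereographic projection to the complex plane. -/
theorem exists_sphere_chart (N : Metric.sphere (0 : EuclideanSpace ℝ (Fin 3)) 1) :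
    ∃ e : OpenPartialHomeomorph (Metric.sphere (0 : EuclideanSpace ℝ (Fin 3)) 1) ℂ,
      e.source = {N}ᶜ ∧ e.target = Set.univ := by
  have : Fact (Module.finrank ℝ (EuclideanSpace ℝ (Fin 3)) = 2 + 1) := ⟨by simp⟩
  exact ⟨(stereographic' 2 N).transHomeomorph Complex.orthonormalBasisOneI.repr.symm.toHomeomorph,
    by simp, by simp⟩

/-- A disc in the plane does not embed in the line. -/
theorem not_injective_ball_real {z : ℂ} {r : ℝ} (hr : 0 < r) {h : Metric.ball z r → ℝ}
    (hh : Continuous h) : ¬ Function.Injective h := by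
  intro hinj
  let c : ℝ → Metric.ball z r := fun θ => ⟨circleMap z (r / 2) θ,
    Metric.sphere_subset_closedBall.trans (Metric.closedBall_subset_ball (half_lt_self hr))
      (circleMap_mem_sphere z (by positivity) θ)⟩
  have hc : Continuous c := (continuous_circleMap _ _).subtype_mk _
  let d : ℝ → ℝ := fun θ => h (c θ) - h (c (θ + Real.pi))
  have hd : Continuous d := (hh.comp hc).sub (hh.comp (hc.comp (by fun_prop)))
  have hdπ : d Real.pi = -d 0 := by
    have : c (Real.pi + Real.pi) = c 0 := by
      rw [← two_mul, ← zero_add (2 * Real.pi)]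
      exact Subtype.ext (periodic_circleMap _ _ _)
    simp only [d, this, zero_add]; ring
  obtain ⟨θ, hθ⟩ : ∃ θ, d θ = 0 := by
    rcases le_total (d 0) 0 with h0 | h0
    · exact mem_range_of_exists_le_of_exists_ge hd ⟨0, h0⟩ ⟨Real.pi, by rw [hdπ]; linarith⟩
    · exact mem_range_of_exists_le_of_exists_ge hd ⟨Real.pi, by rw [hdπ]; linarith⟩ ⟨0, h0⟩
  have h1 : circleMap z (r / 2) θ = circleMap z (r / 2) (θ + Real.pi) :=
    congrArg Subtype.val (hinj (sub_eq_zero.1 hθ))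
  refine circleMap_ne_center (c := z) (θ := θ) (half_pos hr).ne' ?_
  simp only [circleMap, Complex.ofReal_add, add_mul, Complex.exp_add, Complex.exp_pi_mul_I]
    at h1 ⊢
  linear_combination h1 / 2

/-- An injective curve does not fill the sphere. -/
theorem not_surjective_of_injective_curve
    {ψ : ℝ≥0 → Metric.sphere (0 : EuclideanSpace ℝ (Fin 3)) 1} (hψ : Continuous ψ)
    (hi : Function.Injective ψ) : ¬ Function.Surjective ψ := by
  intro hs
  have : Nonempty (Metric.sphere (0 : EuclideanSpace ℝ (Fin 3)) 1) := ⟨ψ 0⟩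
  obtain ⟨n, x, hx⟩ := nonempty_interior_of_iUnion_of_closed
    (f := fun n : ℕ => ψ '' Set.Icc 0 (n : ℝ≥0))
    (fun n => (isCompact_Icc.image hψ).isClosed) (by
      refine Set.eq_univ_of_forall fun x => ?_
      obtain ⟨t, rfl⟩ := hs x
      obtain ⟨n, hn⟩ := exists_nat_ge t
      exact Set.mem_iUnion.2 ⟨n, t, ⟨zero_le, hn⟩, rfl⟩)
  obtain ⟨N, hN⟩ : ∃ N, x ≠ N := by
    by_contra! h
    exact zero_ne_one (hi ((h (ψ 0)).symm.trans (h (ψ 1))))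
  obtain ⟨e, he, het⟩ := exists_sphere_chart N
  have hec : Continuous e.symm := by
    have := e.continuousOn_symm
    rwa [het, ← continuousOn_univ] at *
  have hei : Function.Injective e.symm := by
    intro a b h
    exact e.symm.injOn (by simp [het]) (by simp [het]) h
  have hopen : IsOpen (e.symm ⁻¹' interior (ψ '' Set.Icc 0 (n : ℝ≥0))) :=
    isOpen_interior.preimage hec
  obtain ⟨r, hr, hball⟩ := Metric.isOpen_iff.1 hopen (e x) (by
    rw [Set.mem_preimage, e.left_inv (by simpa [he] using hN)]; exact hx)
  have hemb : IsClosedEmbedding ((Set.Icc 0 (n : ℝ≥0)).domRestrict ψ) :=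
    (hψ.comp continuous_subtype_val).isClosedEmbedding (hi.comp Subtype.val_injective)
  let q := hemb.isEmbedding.toHomeomorph
  have hmem : ∀ z : Metric.ball (e x) r, e.symm z ∈
      Set.range ((Set.Icc 0 (n : ℝ≥0)).domRestrict ψ) := by
    intro z
    rw [Set.range_domRestrict]
    exact interior_subset (hball z.2)
  let k : Metric.ball (e x) r → ℝ := fun z => ((q.symm ⟨e.symm z, hmem z⟩ : ℝ≥0) : ℝ)
  have hk : Continuous k := by
    refine NNReal.continuous_coe.comp (continuous_subtype_val.comp (q.symm.continuous.comp ?_))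
    exact (hec.comp continuous_subtype_val).subtype_mk _
  have hki : Function.Injective k := by
    intro a b h
    have h1 := q.symm.injective (Subtype.ext (NNReal.coe_injective h))
    exact Subtype.ext (hei (congrArg Subtype.val h1))
  exact not_injective_ball_real hr hk hki

theorem IsSwitchedBebutovShift.exists_periodic {Z : Set (EuclideanSpace ℝ (Fin 3))}
    (hZs : Z ⊆ Metric.sphere (0 : EuclideanSpace ℝ (Fin 3)) 1)
    {X : Set C(ℝ≥0, Z)} (hX : IsSwitchedBebutovShift X) (hne : X.Nonempty) :
    ∃ χ ∈ X, ∃ p : ℝ≥0, 0 < p ∧ ∀ t : ℝ≥0, χ (t + p) = χ t := by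
  by_contra hno
  obtain ⟨M, -, ⟨ψ, hψ⟩, hMc, hMinv, hMe, hrec⟩ := hX.exists_minimal hne
  have hloop : ∀ x ∈ M, ∀ y ∈ M, ∀ a b c d : ℝ≥0, a ≤ b → c ≤ d → x a = y d → x b = y c →
      a = b ∧ c = d := by
    intro x hx y hy a b c d hab hcd h₁ h₂
    by_contra h
    have : a < b ∨ c < d := by
      rcases hab.lt_or_eq with h' | h'
      · exact .inl h'
      · exact .inr (hcd.lt_of_ne fun h'' => h ⟨h', h''⟩)
    exact hno (hX.exists_periodic_of_loop₂ (hMe hx) (hMe hy) hab hcd this h₁ h₂)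
  have hψi : Function.Injective ψ := injective_of_forall_loop_trivial (hloop ψ hψ ψ hψ)
  let ι := Set.inclusion hZs
  have hι : Continuous ι := continuous_inclusion hZs
  have hns := not_surjective_of_injective_curve (hι.comp ψ.continuous)
    ((Set.inclusion_injective hZs).comp hψi)
  simp only [Function.Surjective, not_forall, not_exists] at hns
  obtain ⟨N, hN⟩ := hns
  obtain ⟨e, he, het⟩ := exists_sphere_chart N
  have hsrc : ∀ t, ι (ψ t) ∈ e.source := fun t => by rw [he]; exact hN t
  refine false_of_planar hMc hMinv hloop hψ (hrec ψ hψ) (γ := fun z => e (ι z))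
    (fun s => (e.continuousAt (hsrc s)).comp hι.continuousAt) fun r => ?_
  have h1 : Tendsto (fun t => (e.symm (e (ι (ψ t))) : EuclideanSpace ℝ (Fin 3)))
      (comap ((fun z => e (ι z)) ∘ ψ) (𝓝 (e (ι (ψ r)))))
      (𝓝 (e.symm (e (ι (ψ r))) : EuclideanSpace ℝ (Fin 3))) :=
    (continuous_subtype_val.continuousAt.comp
      (e.continuousAt_symm (by simp [het]))).tendsto.comp tendsto_comap
  rw [tendsto_subtype_rng]
  simpa only [e.left_inv (hsrc _)] using h1

/-- The elements of a switched Bebutov shift with values in a closed set form a switched Bebutov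
shift. -/
theorem IsSwitchedBebutovShift.inter_values {Z : Type*} [TopologicalSpace Z] {X : Set C(ℝ≥0, Z)}
    (hX : IsSwitchedBebutovShift X) {F : Set Z} (hF : IsClosed F) :
    IsSwitchedBebutovShift {y | y ∈ X ∧ ∀ t, y t ∈ F} := by
  have hcl : IsClosed {y : C(ℝ≥0, Z) | ∀ t, y t ∈ F} := by
    rw [Set.ofPred_forall]
    exact isClosed_iInter fun t => hF.preimage (continuous_eval_const t)
  refine ⟨hX.1.inter_right hcl, fun y hy τ => ⟨hX.2.1 y hy.1 τ, fun t => hy.2 _⟩,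
    fun x hx y hy τ hτ h ψ h₁ h₂ => ⟨hX.2.2 x hx.1 y hy.1 τ hτ h ψ h₁ h₂, fun t => ?_⟩⟩
  rcases le_total t τ with ht | ht
  · rw [h₁ t ht]; exact hx.2 t
  · rw [h₂ t ht]; exact hy.2 t

/-- Every switched Bebutov shift with values in a compact subset of the sphere `S²`
contains a periodic element taking values in the ω-limit set of any given element. -/
theorem switched_bebutov_sphere_periodic_in_omega_limit
    (Z : Set (EuclideanSpace ℝ (Fin 3))) (hZc : IsCompact Z)
    (hZs : Z ⊆ Metric.sphere (0 : EuclideanSpace ℝ (Fin 3)) 1)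
    (X : Set C(ℝ≥0, Z)) (hX : IsSwitchedBebutovShift X)
    (φ : C(ℝ≥0, Z)) (hφ : φ ∈ X) :
    ∃ χ ∈ X, (∃ p : ℝ≥0, 0 < p ∧ ∀ t : ℝ≥0, χ (t + p) = χ t) ∧
      ∀ t : ℝ≥0, χ t ∈ ⋂ T : ℝ≥0, closure (φ '' Set.Ici T) := by
  have hY := hX.inter_values (F := ⋂ T : ℝ≥0, closure (φ '' Set.Ici T))
    (isClosed_iInter fun _ => isClosed_closure)
  obtain ⟨y, hy, hlim⟩ := hX.1.exists_tendsto_hyperfilter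
    (x := fun n : ℕ => bebShift (n : ℝ≥0) φ) fun n => hX.2.1 φ hφ _
  obtain ⟨χ, hχ, p, hp, hper⟩ := hY.exists_periodic hZs ⟨y, hy, fun t => by
    refine Set.mem_iInter.2 fun T => ?_
    have h1 : Tendsto (fun n : ℕ => bebShift (n : ℝ≥0) φ t) (hyperfilter ℕ) (𝓝 (y t)) :=
      ((continuous_eval_const t).tendsto y).comp hlim
    refine mem_closure_of_tendsto h1 ?_
    obtain ⟨m, hm⟩ := exists_nat_ge T
    have : ∀ᶠ n : ℕ in hyperfilter ℕ, m ≤ n :=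
      (eventually_ge_atTop m).filter_mono Nat.hyperfilter_le_atTop
    refine this.mono fun n hn => ⟨t + n, ?_, rfl⟩
    exact (hm.trans (Nat.cast_le.2 hn)).trans le_add_self⟩
  exact ⟨χ, hχ.1, ⟨p, hp, hper⟩, hχ.2⟩
end

section
/- Let φ : [0,∞) → S² be continuous and injective, and suppose that the translates σ^tφ accumulate on φ in the compact-open topology on C([0,∞), S²) as t → ∞, i.e. there is a sequence tₙ → ∞ with σ^{tₙ}φ → φ uniformly on compact sets. Then for every δ > 0 and every T ≥ 0 the following holds with x₁ := φ(T): there exists a point x₂ ∈ S² distinct from x₁ such that for every ε > 0 there are intervals [t₁,t₂] and [t₃,t₄] in [0,∞) with d(φ(t₁),x₁) < ε, d(φ(t₂),x₂) < ε, d(φ(t₃),x₂) < ε, d(φ(t₄),x₁) < ε, and d(φ(t),x₁) < δ for every t ∈ [t₁,t₂] ∪ [t₃,t₄]. -/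
open scoped NNReal
open Filter Topology

section RecurrentRays

open Set ComplexConjugate

/-! ### Continuous angles -/

/-- A continuous real function on an interval whose values differ by multiples of `2π` is
constant. -/
theorem eq_of_continuousOn_of_coe_angle_eq {u v : ℝ} (huv : u ≤ v) {g : ℝ → ℝ}
    (hg : ContinuousOn g (Icc u v))
    (h : ∀ t ∈ Icc u v, (g t : Real.Angle) = (g u : Real.Angle)) : g v = g u := by
  have key : ∀ t ∈ Icc u v, |g t - g u| ≠ Real.pi := by
    intro t ht hπ
    obtain ⟨k, hk⟩ := Real.Angle.angle_eq_iff_two_pi_dvd_sub.1 (h t ht)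
    rw [hk, abs_mul, abs_of_pos Real.two_pi_pos] at hπ
    have h2 : (2 : ℝ) * |(k : ℝ)| = 1 := by
      have := Real.pi_pos
      nlinarith
    have h3 : (2 : ℤ) * |k| = 1 := by exact_mod_cast h2
    omega
  have hcont : ContinuousOn (fun t => |g t - g u|) (Icc u v) :=
    (hg.sub continuousOn_const).abs
  obtain ⟨k, hk⟩ := Real.Angle.angle_eq_iff_two_pi_dvd_sub.1 (h v ⟨huv, le_rfl⟩)
  by_contra hne
  have hk0 : k ≠ 0 := by
    rintro rfl
    apply hne
    simpa [sub_eq_zero] using hk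
  have hk1 : (1 : ℝ) ≤ |(k : ℝ)| := by exact_mod_cast Int.one_le_abs hk0
  have hmem : Real.pi ∈ Icc |g u - g u| |g v - g u| := by
    rw [hk, abs_mul, abs_of_pos Real.two_pi_pos]
    have := Real.pi_pos
    constructor
    · simpa using this.le
    · nlinarith
  obtain ⟨t, ht, hgt⟩ := intermediate_value_Icc huv hcont hmem
  exact key t ht hgt

/-- If a continuous angle `a` of the nonvanishing function `f` is given on an interval on which
`f` stays in an open half-plane, then the increment of `a` is given by the principal argument. -/
theorem angle_increment {u v : ℝ} (huv : u ≤ v) {a : ℝ → ℝ} {f : ℝ → ℂ} (c : ℂ)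
    (ha : ContinuousOn a (Icc u v)) (hf : ContinuousOn f (Icc u v))
    (h : ∀ t ∈ Icc u v, (a t : Real.Angle) = ((f t).arg : Real.Angle))
    (hc : ∀ t ∈ Icc u v, 0 < (f t * c).re) :
    a v - a u = (f v * c).arg - (f u * c).arg := by
  have h0 : ∀ t ∈ Icc u v, f t ≠ 0 ∧ c ≠ 0 := by
    intro t ht
    have := hc t ht
    constructor <;> rintro h0 <;> simp [h0] at this
  have hg : ContinuousOn (fun t => a t - (f t * c).arg) (Icc u v) := by
    refine ha.sub fun t ht => ?_
    exact ContinuousAt.comp_continuousWithinAt (f := fun t => f t * c)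
      (Complex.continuousAt_arg (Or.inl (hc t ht))) ((hf t ht).mul continuousWithinAt_const)
  have hval : ∀ t ∈ Icc u v,
      ((a t - (f t * c).arg : ℝ) : Real.Angle) = -(c.arg : Real.Angle) := by
    intro t ht
    rw [Real.Angle.coe_sub, h t ht, Complex.arg_mul_coe_angle (h0 t ht).1 (h0 t ht).2]
    abel
  have := eq_of_continuousOn_of_coe_angle_eq huv hg fun t ht => by
    rw [hval t ht, hval u ⟨le_rfl, huv⟩]
  linarith

theorem exists_norm_sub_one_lt_abs_arg_lt {κ : ℝ} (hκ : 0 < κ) :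
    ∃ ρ : ℝ, 0 < ρ ∧ ρ ≤ 1 / 2 ∧ ∀ z : ℂ, ‖z - 1‖ < ρ → |z.arg| < κ := by
  have h : ContinuousAt Complex.arg 1 := Complex.continuousAt_arg (Or.inl (by simp))
  obtain ⟨ρ, hρ, h'⟩ := Metric.continuousAt_iff.1 h κ hκ
  refine ⟨min ρ (1 / 2), by positivity, min_le_right _ _, fun z hz => ?_⟩
  have := h' (show dist z 1 < ρ by rw [dist_eq_norm]; exact hz.trans_le (min_le_left _ _))
  simpa [Real.dist_eq] using this

theorem re_pos_of_norm_sub_one_lt {z : ℂ} (h : ‖z - 1‖ < 1) : 0 < z.re := by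
  have h1 := Complex.abs_re_le_norm (z - 1)
  rw [Complex.sub_re, Complex.one_re] at h1
  have h2 := (abs_le.1 h1).1
  linarith

/-- A point `q` of the unit circle sees the closed unit disc in a half-plane. -/
theorem re_one_sub_mul_conj_pos {p q : ℂ} (hp : ‖p‖ ≤ 1) (hq : ‖q‖ = 1) (hne : p ≠ q) :
    0 < (1 - p * conj q).re := by
  have h1 : 0 < Complex.normSq (p - q) := Complex.normSq_pos.2 (sub_ne_zero.2 hne)
  rw [Complex.normSq_sub, Complex.normSq_eq_norm_sq, Complex.normSq_eq_norm_sq, hq] at h1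
  have h2 : ‖p‖ ^ 2 ≤ 1 := by nlinarith [norm_nonneg p]
  rw [Complex.sub_re, Complex.one_re]
  linarith

theorem mul_conj_of_norm_eq_one {q : ℂ} (hq : ‖q‖ = 1) : q * conj q = 1 := by
  rw [Complex.mul_conj, Complex.normSq_eq_norm_sq, hq]; simp

/-- The inscribed angle theorem. -/
theorem arg_one_sub_add_arg_one_sub {w : ℂ} (hw : ‖w‖ = 1) (hne : w ≠ 1) :
    (1 - w).arg - (1 - conj w).arg = (-w).arg := by
  have hre : 0 < (1 - w).re := by
    simpa using re_one_sub_mul_conj_pos hw.le (norm_one (α := ℂ)) hne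
  have habs : |(1 - w).arg| < Real.pi / 2 := Complex.abs_arg_lt_pi_div_two_iff.2 (Or.inl hre)
  have hconj : (1 - conj w).arg = -(1 - w).arg := by
    have : 1 - conj w = conj (1 - w) := by simp
    rw [this, Complex.arg_conj, if_neg]
    intro h
    rw [h, abs_of_pos Real.pi_pos] at habs
    linarith [Real.pi_pos]
  have h0 : (1 - w) ≠ 0 := sub_ne_zero.2 hne.symm
  have hmul : (1 - w) * (1 - w) = ((2 * (1 - w).re : ℝ) : ℂ) * (-w) := by
    have hre2 : ((2 * (1 - w).re : ℝ) : ℂ) = (1 - w) + (1 - conj w) := by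
      have := Complex.add_conj (1 - w)
      rw [← this]; simp
    rw [hre2]
    linear_combination (-1 : ℂ) * mul_conj_of_norm_eq_one hw
  have h2 : ((1 - w) * (1 - w)).arg = (1 - w).arg + (1 - w).arg := by
    rw [Complex.arg_mul_eq_add_arg_iff h0 h0]
    rw [abs_lt] at habs
    constructor <;> linarith
  rw [hmul, Complex.arg_real_mul _ (by positivity)] at h2
  rw [hconj, h2]; ring

theorem norm_sub_one_le_of_arg_neg {z : ℂ} (hz : ‖z‖ = 1) {τ : ℝ}
    (h : Real.pi - τ ≤ |(-z).arg|) : ‖z - 1‖ ≤ τ := by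
  have h1 : -z = Complex.exp ((-z).arg * Complex.I) := by
    have := Complex.norm_mul_exp_arg_mul_I (-z)
    rw [norm_neg, hz] at this
    simpa using this.symm
  have hb := Complex.neg_pi_lt_arg (-z)
  have hb' := Complex.arg_le_pi (-z)
  rcases le_total 0 (-z).arg with h0 | h0
  · rw [abs_of_nonneg h0] at h
    have h2 : z = Complex.exp (Complex.I * (((-z).arg - Real.pi : ℝ) : ℂ)) := by
      push_cast
      rw [mul_sub, Complex.exp_sub, mul_comm, ← h1, mul_comm, Complex.exp_pi_mul_I]
      simp
    rw [h2]
    refine (Real.norm_exp_I_mul_ofReal_sub_one_le).trans ?_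
    rw [Real.norm_eq_abs, abs_le]
    constructor <;> linarith
  · rw [abs_of_nonpos h0] at h
    have h2 : z = Complex.exp (Complex.I * (((-z).arg + Real.pi : ℝ) : ℂ)) := by
      push_cast
      rw [mul_add, Complex.exp_add, mul_comm Complex.I, ← h1, mul_comm Complex.I,
        Complex.exp_pi_mul_I]
      simp
    rw [h2]
    refine (Real.norm_exp_I_mul_ofReal_sub_one_le).trans ?_
    rw [Real.norm_eq_abs, abs_le]
    constructor <;> linarith

theorem arg_neg_of_arg_pos {z : ℂ} (h : 0 < z.arg) (h1 : z.arg < 1) :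
    (-z).arg = z.arg - Real.pi := by
  refine Complex.arg_neg_eq_arg_sub_pi_of_im_pos ?_
  have h2 : 0 ≤ z.im := Complex.arg_nonneg_iff.1 h.le
  refine lt_of_le_of_ne h2 fun h3 => ?_
  rcases le_or_gt 0 z.re with h4 | h4
  · exact h.ne' (Complex.arg_eq_zero_iff.2 ⟨h4, h3.symm⟩)
  · have := Complex.arg_eq_pi_iff.2 ⟨h4, h3.symm⟩
    linarith [Real.pi_gt_three]

theorem arg_neg_of_arg_neg {z : ℂ} (h : z.arg < 0) : (-z).arg = z.arg + Real.pi :=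
  Complex.arg_neg_eq_arg_add_pi_of_im_neg (Complex.arg_neg_iff.1 h)

/-- The difference between the arguments of a point `z` of the unit circle, in the discs cut at
`b` and cut at `1`. -/
noncomputable def cutJump (b z : ℂ) : ℝ := (-z * conj b).arg - (-z).arg + b.arg

theorem cutJump_eq {b z : ℂ} (hb : ‖b‖ = 1) (hz : ‖z‖ = 1) {σ : ℝ} (hσ : σ = 1 ∨ σ = -1)
    (hpos : 0 < σ * b.arg) (h1 : |b.arg| < 1) :
    (cutJump b z = 0 ∧ (-z).arg - b.arg ∈ Ioc (-Real.pi) Real.pi) ∨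
      (cutJump b z = 2 * Real.pi * σ ∧ ‖z - 1‖ ≤ |b.arg|) := by
  have hpi := Real.pi_gt_three
  have hb0 : b ≠ 0 := by rintro rfl; simp at hb
  have hz0 : -z ≠ 0 := by rw [neg_ne_zero]; rintro rfl; simp at hz
  have hcb0 : conj b ≠ 0 := by simpa using hb0
  have hcb : (conj b).arg = -b.arg := by
    rw [Complex.arg_conj, if_neg]
    intro h
    rw [h, abs_of_pos Real.pi_pos] at h1
    linarith
  by_cases hmem : (-z).arg + (conj b).arg ∈ Ioc (-Real.pi) Real.pi
  · left
    refine ⟨?_, by rwa [hcb, ← sub_eq_add_neg] at hmem⟩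
    rw [cutJump, (Complex.arg_mul_eq_add_arg_iff hz0 hcb0).2 hmem, hcb]
    ring
  right
  have hlo := Complex.neg_pi_lt_arg (-z)
  have hhi := Complex.arg_le_pi (-z)
  have hang : (((-z * conj b).arg : ℝ) : Real.Angle) = (((-z).arg - b.arg : ℝ) : Real.Angle) := by
    rw [Complex.arg_mul_coe_angle hz0 hcb0, hcb, ← Real.Angle.coe_add, sub_eq_add_neg]
  obtain ⟨k, hk⟩ := Real.Angle.angle_eq_iff_two_pi_dvd_sub.1 hang
  have hlo' := Complex.neg_pi_lt_arg (-z * conj b)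
  have hhi' := Complex.arg_le_pi (-z * conj b)
  rw [hcb, mem_Ioc, not_and_or, not_lt, not_le] at hmem
  rw [cutJump]
  rw [abs_lt] at h1
  have hk' : ∀ m : ℤ, (-z * conj b).arg - ((-z).arg - b.arg) < 2 * Real.pi * (m + 1) →
      2 * Real.pi * (m - 1) < (-z * conj b).arg - ((-z).arg - b.arg) → k = m := by
    intro m ha hb
    rw [hk] at ha hb
    have ha' : (k : ℝ) < m + 1 := lt_of_mul_lt_mul_left ha Real.two_pi_pos.le
    have hb' : (m : ℝ) - 1 < k := lt_of_mul_lt_mul_left hb Real.two_pi_pos.le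
    have ha'' : k < m + 1 := by exact_mod_cast ha'
    have hb'' : m - 1 < k := by exact_mod_cast hb'
    omega
  rcases hσ with rfl | rfl
  · rw [one_mul] at hpos
    rcases hmem with h | h
    · have : k = 1 := hk' 1 (by push_cast; linarith) (by push_cast; linarith)
      rw [this] at hk
      push_cast at hk
      refine ⟨by linarith, norm_sub_one_le_of_arg_neg hz ?_⟩
      rw [abs_of_pos hpos, abs_of_neg (by linarith)]
      linarith
    · linarith
  · rcases hmem with h | h
    · linarith
    · have : k = -1 := hk' (-1) (by push_cast; linarith) (by push_cast; linarith)
      rw [this] at hk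
      push_cast at hk
      refine ⟨by linarith, norm_sub_one_le_of_arg_neg hz ?_⟩
      rw [abs_of_neg (by linarith : b.arg < 0), abs_of_pos (by linarith)]
      linarith

theorem cutJump_of_between {b z : ℂ} (hb : ‖b‖ = 1) (hz : ‖z‖ = 1) {σ : ℝ}
    (hσ : σ = 1 ∨ σ = -1) (h1 : |b.arg| < 1) (hpos : 0 < σ * z.arg)
    (hlt : σ * z.arg < σ * b.arg) : cutJump b z = 2 * Real.pi * σ := by
  rcases cutJump_eq hb hz hσ (hpos.trans hlt) h1 with ⟨-, h⟩ | ⟨h, -⟩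
  · exfalso
    rw [abs_lt] at h1
    rcases hσ with rfl | rfl
    · rw [arg_neg_of_arg_pos (by linarith) (by linarith)] at h
      linarith [h.1]
    · rw [arg_neg_of_arg_neg (by linarith)] at h
      linarith [h.2]
  · exact h

/-! ### The secant angle of an injective ray in the plane -/

/-- `A s t` is a continuous choice of the angle of the secant `ψ t - ψ s`, for `0 ≤ s < t`. -/
structure IsSecantAngle (ψ : ℝ → ℂ) (A : ℝ → ℝ → ℝ) : Prop where
  continuousOn : ContinuousOn (fun p : ℝ × ℝ => A p.1 p.2) {p | 0 ≤ p.1 ∧ p.1 < p.2}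
  coe_eq : ∀ s t, 0 ≤ s → s < t → (A s t : Real.Angle) = ((ψ t - ψ s).arg : Real.Angle)

theorem exists_isSecantAngle {ψ : ℝ → ℂ} (hψ : Continuous ψ) (hinj : InjOn ψ (Ici 0)) :
    ∃ A, IsSecantAngle ψ A := by
  have hne : ∀ p : ℝ × ℝ, ψ (|p.1| + Real.exp p.2) - ψ |p.1| ≠ 0 := by
    intro p h
    have hp := Real.exp_pos p.2
    have := hinj (mem_Ici.2 (by positivity)) (mem_Ici.2 (abs_nonneg p.1)) (sub_eq_zero.1 h)
    linarith
  let f : C(ℝ × ℝ, {z : ℂ // z ≠ 0}) :=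
    ⟨fun p => ⟨ψ (|p.1| + Real.exp p.2) - ψ |p.1|, hne p⟩, by fun_prop⟩
  obtain ⟨L, ⟨-, hL⟩, -⟩ := Complex.isCoveringMap_exp.existsUnique_continuousMap_lifts f (0, 0)
    (Complex.log (f (0, 0))) (Subtype.ext (Complex.exp_log (f (0, 0)).2))
  have hL' : ∀ p : ℝ × ℝ, Complex.exp (L p) = ψ (|p.1| + Real.exp p.2) - ψ |p.1| := fun p =>
    congrArg Subtype.val (congrFun hL p)
  refine ⟨fun s t => (L (s, Real.log (t - s))).im, ?_, ?_⟩
  · refine Complex.continuous_im.comp_continuousOn (L.continuous.comp_continuousOn ?_)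
    refine continuousOn_fst.prodMk (ContinuousOn.log (by fun_prop) ?_)
    rintro ⟨s, t⟩ ⟨-, h⟩
    exact (sub_pos.2 h).ne'
  · intro s t hs hst
    have h := hL' (s, Real.log (t - s))
    simp only [abs_of_nonneg hs, Real.exp_log (sub_pos.2 hst), add_sub_cancel] at h
    rw [← h, Complex.arg_exp, Real.Angle.coe_toIocMod]

namespace IsSecantAngle

variable {ψ : ℝ → ℂ} {A : ℝ → ℝ → ℝ}

theorem increment_right (hA : IsSecantAngle ψ A) (hψ : Continuous ψ) {s u v : ℝ} (hs : 0 ≤ s)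
    (hsu : s < u) (huv : u ≤ v) (c : ℂ) (h : ∀ t ∈ Icc u v, 0 < ((ψ t - ψ s) * c).re) :
    A s v - A s u = ((ψ v - ψ s) * c).arg - ((ψ u - ψ s) * c).arg := by
  refine angle_increment huv (a := fun t => A s t) (f := fun t => ψ t - ψ s) c ?_ (by fun_prop)
    (fun t ht => hA.coe_eq s t hs (hsu.trans_le ht.1)) h
  exact hA.continuousOn.comp (f := fun t => (s, t)) (by fun_prop)
    fun t ht => ⟨hs, hsu.trans_le ht.1⟩

theorem increment_left (hA : IsSecantAngle ψ A) (hψ : Continuous ψ) {t u v : ℝ} (hu : 0 ≤ u)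
    (huv : u ≤ v) (hvt : v < t) (c : ℂ) (h : ∀ s ∈ Icc u v, 0 < ((ψ t - ψ s) * c).re) :
    A v t - A u t = ((ψ t - ψ v) * c).arg - ((ψ t - ψ u) * c).arg := by
  refine angle_increment huv (a := fun s => A s t) (f := fun s => ψ t - ψ s) c ?_ (by fun_prop)
    (fun s hs => hA.coe_eq s t (hu.trans hs.1) (hs.2.trans_lt hvt)) h
  exact hA.continuousOn.comp (f := fun s => (s, t)) (by fun_prop)
    fun s hs => ⟨hu.trans hs.1, hs.2.trans_lt hvt⟩

/-- The increment of the difference of two secant angles along which the quotient of the two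
secants stays in the right half-plane. -/
theorem increment_sub (hA : IsSecantAngle ψ A) (hψ : Continuous ψ) {u v : ℝ} (huv : u ≤ v)
    {p q p' q' : ℝ → ℝ} (hp : Continuous p) (hq : Continuous q) (hp' : Continuous p')
    (hq' : Continuous q') (h : ∀ t ∈ Icc u v, 0 ≤ p t ∧ p t < q t)
    (h' : ∀ t ∈ Icc u v, 0 ≤ p' t ∧ p' t < q' t)
    (hre : ∀ t ∈ Icc u v, 0 < ((ψ (q t) - ψ (p t)) / (ψ (q' t) - ψ (p' t))).re) :
    (A (p v) (q v) - A (p' v) (q' v)) - (A (p u) (q u) - A (p' u) (q' u)) =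
      ((ψ (q v) - ψ (p v)) / (ψ (q' v) - ψ (p' v))).arg -
        ((ψ (q u) - ψ (p u)) / (ψ (q' u) - ψ (p' u))).arg := by
  have hne : ∀ t ∈ Icc u v, ψ (q t) - ψ (p t) ≠ 0 ∧ ψ (q' t) - ψ (p' t) ≠ 0 := by
    intro t ht
    have := hre t ht
    constructor <;> intro h0 <;> simp [h0] at this
  have := angle_increment huv (a := fun t => A (p t) (q t) - A (p' t) (q' t))
    (f := fun t => (ψ (q t) - ψ (p t)) / (ψ (q' t) - ψ (p' t))) 1 ?_ ?_ ?_ (by simpa using hre)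
  · simpa using this
  · exact (hA.continuousOn.comp (f := fun t => (p t, q t)) (by fun_prop) h).sub
      (hA.continuousOn.comp (f := fun t => (p' t, q' t)) (by fun_prop) h')
  · exact ContinuousOn.div (by fun_prop) (by fun_prop) fun t ht => (hne t ht).2
  · intro t ht
    rw [Real.Angle.coe_sub, hA.coe_eq _ _ (h t ht).1 (h t ht).2,
      hA.coe_eq _ _ (h' t ht).1 (h' t ht).2, div_eq_mul_inv,
      Complex.arg_mul_coe_angle (hne t ht).1 (inv_ne_zero (hne t ht).2),
      Complex.arg_inv_coe_angle, sub_eq_add_neg]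

/-- The arc `ψ [a, e]` ends on the unit circle and the arc `ψ [u, v]` has both endpoints on the
unit circle; both stay in the closed unit disc. Then the rotation of `ψ [u, v]` around `ψ a` only
depends on the endpoints. -/
theorem increment_of_crossing (hA : IsSecantAngle ψ A) (hψ : Continuous ψ)
    (hinj : InjOn ψ (Ici 0)) {a e u v : ℝ} (ha : 0 ≤ a) (hae : a ≤ e) (heu : e < u) (huv : u ≤ v)
    (hdisc : ∀ x ∈ Icc a e, ‖ψ x‖ ≤ 1) (he : ‖ψ e‖ = 1) (hdisc' : ∀ x ∈ Icc u v, ‖ψ x‖ ≤ 1)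
    (hu : ‖ψ u‖ = 1) (hv : ‖ψ v‖ = 1) :
    A a v - A a u = (-ψ v * conj (ψ e)).arg - (-ψ u * conj (ψ e)).arg
      + (1 - ψ a * conj (ψ v)).arg - (1 - ψ a * conj (ψ u)).arg := by
  have hne : ∀ x y, a ≤ x → x < y → ψ y ≠ ψ x := fun x y hx hxy h =>
    hxy.ne' (hinj (mem_Ici.2 (by linarith)) (mem_Ici.2 (by linarith)) h)
  have end_vary : ∀ t, e < t → ‖ψ t‖ = 1 →
      A e t - A a t = (1 - ψ e * conj (ψ t)).arg - (1 - ψ a * conj (ψ t)).arg := by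
    intro t het ht
    have hmul : ∀ s, (ψ t - ψ s) * conj (ψ t) = 1 - ψ s * conj (ψ t) := fun s => by
      rw [sub_mul, mul_conj_of_norm_eq_one ht]
    rw [hA.increment_left hψ ha hae het (conj (ψ t)), hmul, hmul]
    intro s hs
    rw [hmul]
    exact re_one_sub_mul_conj_pos (hdisc s hs) ht (hne s t hs.1 (hs.2.trans_lt het)).symm
  have hmul : ∀ t, (ψ t - ψ e) * -conj (ψ e) = 1 - ψ t * conj (ψ e) := fun t => by
    linear_combination mul_conj_of_norm_eq_one he
  have h1 : A e v - A e u = (1 - ψ v * conj (ψ e)).arg - (1 - ψ u * conj (ψ e)).arg := by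
    rw [hA.increment_right hψ (ha.trans hae) heu huv (-conj (ψ e)), hmul, hmul]
    intro t ht
    rw [hmul]
    exact re_one_sub_mul_conj_pos (hdisc' t ht) he (hne e t hae (heu.trans_le ht.1))
  have inscribed : ∀ t, e < t → ‖ψ t‖ = 1 →
      (1 - ψ t * conj (ψ e)).arg - (1 - ψ e * conj (ψ t)).arg = (-ψ t * conj (ψ e)).arg := by
    intro t het ht
    have hw : ‖ψ t * conj (ψ e)‖ = 1 := by rw [norm_mul, ht, RCLike.norm_conj, he, one_mul]
    have hw1 : ψ t * conj (ψ e) ≠ 1 := by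
      intro h
      have := re_one_sub_mul_conj_pos ht.le he (hne e t hae het)
      rw [h] at this
      simp at this
    have := arg_one_sub_add_arg_one_sub hw hw1
    rw [map_mul, Complex.conj_conj] at this
    rw [neg_mul, ← this, mul_comm (ψ e)]
  have h2 := end_vary u heu hu
  have h3 := end_vary v (heu.trans_le huv) hv
  rw [← inscribed u heu hu, ← inscribed v (heu.trans_le huv) hv]
  linarith

end IsSecantAngle

/-- The winding angle of `ψ t` with respect to the arc `ψ [0, a]` closed by a straight segment,
up to a constant. It is locally constant where `‖ψ a‖ < ‖ψ t‖`. -/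
noncomputable def windingAngle (ψ : ℝ → ℂ) (A : ℝ → ℝ → ℝ) (a t : ℝ) : ℝ :=
  A a t - A 0 t - (1 - ψ a / ψ t).arg

/-- `ψ [a, e]` is an arc in the closed unit disc that ends on the unit circle. -/
structure IsExit (ψ : ℝ → ℂ) (a e : ℝ) : Prop where
  nonneg : 0 ≤ a
  lt : a < e
  norm_le : ∀ x ∈ Icc a e, ‖ψ x‖ ≤ 1
  norm_eq : ‖ψ e‖ = 1

theorem exists_first_exit {ψ : ℝ → ℂ} (hψ : Continuous ψ) {a b : ℝ} (hab : a ≤ b)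
    (hb : 1 ≤ ‖ψ b‖) : ∃ c ∈ Icc a b, 1 ≤ ‖ψ c‖ ∧ ∀ x ∈ Ico a c, ‖ψ x‖ < 1 := by
  have hcl : IsClosed (Icc a b ∩ {x | 1 ≤ ‖ψ x‖}) :=
    isClosed_Icc.inter (isClosed_le continuous_const (by fun_prop))
  have hbdd : BddBelow (Icc a b ∩ {x | 1 ≤ ‖ψ x‖}) := bddBelow_Icc.mono inter_subset_left
  have hmem := hcl.csInf_mem ⟨b, ⟨hab, le_rfl⟩, hb⟩ hbdd
  refine ⟨_, hmem.1, hmem.2, fun x hx => ?_⟩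
  by_contra hx1
  exact hx.2.not_ge (csInf_le hbdd ⟨⟨hx.1, hx.2.le.trans hmem.1.2⟩, not_lt.1 hx1⟩)

theorem exists_last_entry {ψ : ℝ → ℂ} (hψ : Continuous ψ) {a b : ℝ} (hab : a ≤ b)
    (ha : 1 ≤ ‖ψ a‖) : ∃ c ∈ Icc a b, 1 ≤ ‖ψ c‖ ∧ ∀ x ∈ Ioc c b, ‖ψ x‖ < 1 := by
  have hcl : IsClosed (Icc a b ∩ {x | 1 ≤ ‖ψ x‖}) :=
    isClosed_Icc.inter (isClosed_le continuous_const (by fun_prop))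
  have hbdd : BddAbove (Icc a b ∩ {x | 1 ≤ ‖ψ x‖}) := bddAbove_Icc.mono inter_subset_left
  have hmem := hcl.csSup_mem ⟨a, ⟨le_rfl, hab⟩, ha⟩ hbdd
  refine ⟨_, hmem.1, hmem.2, fun x hx => ?_⟩
  by_contra hx1
  exact hx.1.not_ge (le_csSup hbdd ⟨⟨hmem.1.1.trans hx.1.le, hx.2⟩, not_lt.1 hx1⟩)

theorem norm_le_one_of_Ioo {ψ : ℝ → ℂ} (hψ : Continuous ψ) {a b : ℝ} (hab : a < b)
    (h : ∀ x ∈ Ioo a b, ‖ψ x‖ < 1) : ∀ x ∈ Icc a b, ‖ψ x‖ ≤ 1 := by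
  intro x hx
  rw [← closure_Ioo hab.ne] at hx
  exact closure_minimal (fun y hy => (h y hy).le)
    (isClosed_le (f := fun y => ‖ψ y‖) (by fun_prop) continuous_const) hx

section Winding

variable {ψ : ℝ → ℂ} {A : ℝ → ℝ → ℝ} {a e E : ℝ}

theorem windingAngle_eq_of_far (hA : IsSecantAngle ψ A) (hψ : Continuous ψ) (h0 : ψ 0 = 0)
    (ha : 0 ≤ a) {u v : ℝ} (hau : a < u) (huv : u ≤ v) (hfar : ∀ x ∈ Icc u v, ‖ψ a‖ < ‖ψ x‖) :
    windingAngle ψ A a v = windingAngle ψ A a u := by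
  have hquot : ∀ x ∈ Icc u v, (ψ x - ψ a) / (ψ x - ψ 0) = 1 - ψ a / ψ x := by
    intro x hx
    have : ψ x ≠ 0 := by
      intro h
      have := hfar x hx
      rw [h, norm_zero] at this
      exact (norm_nonneg _).not_gt this
    rw [h0, sub_zero, sub_div, div_self this]
  have := hA.increment_sub hψ huv (p := fun _ => a) (q := fun x => x) (p' := fun _ => 0)
    (q' := fun x => x) continuous_const continuous_id continuous_const continuous_id
    (fun t ht => ⟨ha, hau.trans_le ht.1⟩) (fun t ht => ⟨le_rfl, ha.trans_lt (hau.trans_le ht.1)⟩)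
    (fun t ht => ?_)
  · rw [hquot v ⟨huv, le_rfl⟩, hquot u ⟨le_rfl, huv⟩] at this
    rw [windingAngle, windingAngle]
    linarith
  · rw [hquot t ht]
    refine re_pos_of_norm_sub_one_lt ?_
    have h1 := hfar t ht
    rw [sub_sub_cancel_left, norm_neg, norm_div, div_lt_one ((norm_nonneg _).trans_lt h1)]
    exact h1

theorem windingAngle_sub_of_crossing (hA : IsSecantAngle ψ A) (hψ : Continuous ψ)
    (hinj : InjOn ψ (Ici 0)) (h0 : ψ 0 = 0) (hE : IsExit ψ 0 E) (hE1 : ψ E = 1)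
    (ha : IsExit ψ a e) (hEa : E < a) {u v : ℝ} (heu : e < u) (huv : u ≤ v)
    (hdisc : ∀ x ∈ Icc u v, ‖ψ x‖ ≤ 1) (hu : ‖ψ u‖ = 1) (hv : ‖ψ v‖ = 1) :
    windingAngle ψ A a v - windingAngle ψ A a u = cutJump (ψ e) (ψ v) - cutJump (ψ e) (ψ u) := by
  have h1 := hA.increment_of_crossing hψ hinj ha.nonneg ha.lt.le heu huv ha.norm_le ha.norm_eq
    hdisc hu hv
  have h2 := hA.increment_of_crossing hψ hinj le_rfl hE.lt.le
    ((hEa.trans ha.lt).trans heu) huv hE.norm_le hE.norm_eq hdisc hu hv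
  have hinv : ∀ x, ‖ψ x‖ = 1 → ψ a / ψ x = ψ a * conj (ψ x) := by
    intro x hx
    rw [div_eq_mul_inv, Complex.inv_def, Complex.normSq_eq_norm_sq, hx]
    simp
  rw [hE1, h0] at h2
  simp only [map_one, mul_one, zero_mul, sub_zero, Complex.arg_one] at h2
  rw [windingAngle, windingAngle, hinv v hv, hinv u hu, cutJump, cutJump]
  linarith

variable {ε σ : ℝ}

/-- When no arc in the disc goes from near `1` to near `0`, the winding angle around `ψ [0, a]`
is monotone along crossings of the disc. -/
theorem windingAngle_le_of_crossing (hA : IsSecantAngle ψ A) (hψ : Continuous ψ)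
    (hinj : InjOn ψ (Ici 0)) (h0 : ψ 0 = 0) (hE : IsExit ψ 0 E) (hE1 : ψ E = 1)
    (hNB : ∀ x y, 0 ≤ x → x ≤ y → ‖ψ x - 1‖ < ε → ‖ψ y‖ < ε → ∃ z ∈ Icc x y, 1 < ‖ψ z‖)
    (ha : IsExit ψ a e) (hEa : E < a) (haε : ‖ψ a‖ < ε) (hσ : σ = 1 ∨ σ = -1)
    (hpos : 0 < σ * (ψ e).arg) (hsmall : |(ψ e).arg| < 1) (hsmall' : |(ψ e).arg| < ε)
    {u v : ℝ} (heu : e < u) (huv : u ≤ v)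
    (hdisc : ∀ x ∈ Icc u v, ‖ψ x‖ ≤ 1) (hu : ‖ψ u‖ = 1) (hv : ‖ψ v‖ = 1) :
    σ * windingAngle ψ A a u ≤ σ * windingAngle ψ A a v := by
  have hsub := windingAngle_sub_of_crossing hA hψ hinj h0 hE hE1 ha hEa heu huv hdisc hu hv
  have hsq : σ * σ = 1 := by rcases hσ with rfl | rfl <;> norm_num
  have hpi := Real.pi_pos
  rcases cutJump_eq ha.norm_eq hv hσ hpos hsmall with ⟨h1, -⟩ | ⟨h1, -⟩ <;>
    rcases cutJump_eq ha.norm_eq hu hσ hpos hsmall with ⟨h2, -⟩ | ⟨h2, h3⟩ <;>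
    rw [h1, h2] at hsub
  · exact le_of_eq (by rw [sub_self] at hsub; rw [sub_eq_zero.1 hsub])
  · refine le_of_eq (congrArg _ (windingAngle_eq_of_far hA hψ h0 ha.nonneg
      (ha.lt.trans heu) huv fun x hx => ?_).symm)
    by_contra hx'
    obtain ⟨z, hz, hz1⟩ := hNB u x (ha.nonneg.trans (ha.lt.trans heu).le) hx.1
      (h3.trans_lt hsmall') ((not_lt.1 hx').trans_lt haε)
    exact (hdisc z ⟨hz.1, hz.2.trans hx.2⟩).not_gt hz1
  · have : 0 ≤ σ * (windingAngle ψ A a v - windingAngle ψ A a u) := by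
      rw [hsub]
      nlinarith
    linarith
  · exact le_of_eq (by rw [sub_self] at hsub; rw [sub_eq_zero.1 hsub])

theorem windingAngle_mono (hA : IsSecantAngle ψ A) (hψ : Continuous ψ)
    (hinj : InjOn ψ (Ici 0)) (h0 : ψ 0 = 0) (hE : IsExit ψ 0 E) (hE1 : ψ E = 1)
    (hNB : ∀ x y, 0 ≤ x → x ≤ y → ‖ψ x - 1‖ < ε → ‖ψ y‖ < ε → ∃ z ∈ Icc x y, 1 < ‖ψ z‖)
    (ha : IsExit ψ a e) (hEa : E < a) (haε : ‖ψ a‖ < ε) (ha1 : ‖ψ a‖ < 1)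
    (hσ : σ = 1 ∨ σ = -1) (hpos : 0 < σ * (ψ e).arg) (hsmall : |(ψ e).arg| < 1)
    (hsmall' : |(ψ e).arg| < ε) {u v : ℝ} (heu : e < u) (huv : u ≤ v)
    (hu : 1 ≤ ‖ψ u‖) (hv : 1 ≤ ‖ψ v‖) :
    σ * windingAngle ψ A a u ≤ σ * windingAngle ψ A a v := by
  set S : Set ℝ := {t | t ∈ Icc u v ∧ 1 ≤ ‖ψ t‖ ∧
    σ * windingAngle ψ A a u ≤ σ * windingAngle ψ A a t} with hS
  have huS : u ∈ S := ⟨⟨le_rfl, huv⟩, hu, le_rfl⟩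
  have hbdd : BddAbove S := ⟨v, fun t ht => ht.1.2⟩
  set s := sSup S with hs
  have hus : u ≤ s := le_csSup hbdd huS
  have hsv : s ≤ v := csSup_le ⟨u, huS⟩ fun t ht => ht.1.2
  have hs1 : 1 ≤ ‖ψ s‖ := by
    have h := csSup_mem_closure ⟨u, huS⟩ hbdd
    exact closure_minimal (fun t ht => ht.2.1)
      (isClosed_le (g := fun t => ‖ψ t‖) continuous_const (by fun_prop)) h
  obtain ⟨η, hη, hfar⟩ : ∃ η > 0, ∀ x, |x - s| < η → ‖ψ a‖ < ‖ψ x‖ := by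
    have : ∀ᶠ x in 𝓝 s, ‖ψ a‖ < ‖ψ x‖ :=
      (hψ.norm.continuousAt).eventually (lt_mem_nhds (ha1.trans_le hs1))
    obtain ⟨η, hη, h⟩ := Metric.eventually_nhds_iff.1 this
    exact ⟨η, hη, fun x hx => h hx⟩
  have hau : a < u := ha.lt.trans heu
  have hsS : s ∈ S := by
    obtain ⟨t, ht, hst⟩ := exists_lt_of_lt_csSup ⟨u, huS⟩ (show s - η < sSup S by linarith)
    have hts : t ≤ s := le_csSup hbdd ht
    refine ⟨⟨hus, hsv⟩, hs1, ?_⟩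
    rw [windingAngle_eq_of_far hA hψ h0 ha.nonneg (hau.trans_le ht.1.1) hts]
    · exact ht.2.2
    · intro x hx
      refine hfar x ?_
      rw [abs_lt]
      constructor <;> linarith [hx.1, hx.2]
  rcases hsv.eq_or_lt with h | hlt
  · exact h ▸ hsS.2.2
  exfalso
  set m := min (s + η / 2) v with hm
  have hsm : s < m := lt_min (by linarith) hlt
  have hmv : m ≤ v := min_le_right _ _
  have hmη : m ≤ s + η / 2 := min_le_left _ _
  have hlt1 : ∀ x ∈ Ioc s m, ‖ψ x‖ < 1 := by
    intro x hx
    by_contra hx1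
    refine hx.1.not_ge (le_csSup hbdd ⟨⟨hus.trans hx.1.le, hx.2.trans hmv⟩, not_lt.1 hx1, ?_⟩)
    rw [windingAngle_eq_of_far hA hψ h0 ha.nonneg (hau.trans_le hus) hx.1.le]
    · exact hsS.2.2
    · intro y hy
      refine hfar y ?_
      rw [abs_lt]
      constructor <;> linarith [hy.1, hy.2, hx.2]
  obtain ⟨w, hw, hw1, hwlt⟩ := exists_first_exit hψ hmv hv
  have hsw : s < w := hsm.trans_le hw.1
  have hdisc := norm_le_one_of_Ioo hψ hsw fun x hx => by
    rcases le_or_gt x m with h | h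
    · exact hlt1 x ⟨hx.1, h⟩
    · exact hwlt x ⟨h.le, hx.2⟩
  have := windingAngle_le_of_crossing hA hψ hinj h0 hE hE1 hNB ha hEa haε hσ hpos hsmall hsmall'
    (heu.trans_le hus) hsw.le hdisc (le_antisymm (hdisc s ⟨le_rfl, hsw.le⟩) hs1)
    (le_antisymm (hdisc w ⟨hsw.le, le_rfl⟩) hw1)
  exact hsw.not_ge (le_csSup hbdd ⟨⟨hus.trans hsw.le, hw.2⟩, hw1, hsS.2.2.trans this⟩)

end Winding

section Returns

variable {ψ : ℝ → ℂ} {A : ℝ → ℝ → ℝ} {a e E : ℝ} {κ ρ d ε η : ℝ}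

theorem norm_div_sub_one_lt {z₁ z₂ w : ℂ} (hρ : 0 < ρ) (hρ' : ρ ≤ 1 / 2) (hd : 0 < d)
    (hw : d ≤ ‖w‖) (h₁ : ‖z₁ - w‖ < ρ * d / 4) (h₂ : ‖z₂ - w‖ < ρ * d / 4) :
    ‖z₁ / z₂ - 1‖ < ρ := by
  have h3 : ‖z₁ - z₂‖ ≤ ‖z₁ - w‖ + ‖z₂ - w‖ := by
    have := norm_sub_le (z₁ - w) (z₂ - w)
    rwa [sub_sub_sub_cancel_right] at this
  have h4 : ‖w‖ ≤ ‖z₂‖ + ‖z₂ - w‖ := by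
    have := norm_sub_le z₂ (z₂ - w)
    rwa [sub_sub_cancel] at this
  have h5 : 0 < ‖z₂‖ := by nlinarith
  have h6 : z₂ ≠ 0 := norm_pos_iff.1 h5
  rw [div_sub_one h6, norm_div, div_lt_iff₀ h5]
  have h7 : ρ * d ≤ 1 / 2 * d := mul_le_mul_of_nonneg_right hρ' hd.le
  have h8 : d / 2 ≤ ‖z₂‖ := by linarith
  have h9 := mul_le_mul_of_nonneg_left h8 hρ.le
  linarith

/-- `ψ [t, e]` is an arc in the closed unit disc that shadows `ψ [0, E]` up to `η`. -/
structure IsReturn (ψ : ℝ → ℂ) (E η t e : ℝ) : Prop extends IsExit ψ t e where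
  close : ∀ y ∈ Icc 0 E, ‖ψ (t + y) - ψ y‖ < η
  near : ∀ y ∈ uIcc (t + E) e, ‖ψ y - 1‖ < η

theorem windingAngle_at_exit (hA : IsSecantAngle ψ A) (hψ : Continuous ψ)
    (hinj : InjOn ψ (Ici 0)) (h0 : ψ 0 = 0) (hE : IsExit ψ 0 E) (hE1 : ψ E = 1)
    (hρ : 0 < ρ) (hρ' : ρ ≤ 1 / 2) (hκ : ∀ z : ℂ, ‖z - 1‖ < ρ → |z.arg| < κ)
    (hEa : E < a) (haρ : ‖ψ a‖ < ρ) (hd : 0 < d) (hda : d ≤ ‖1 - ψ a‖)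
    {t e : ℝ} (ht : IsReturn ψ E (ρ * d / 4) t e) (htρ : ‖ψ t‖ < ρ) (hat : a < t) :
    |windingAngle ψ A a e - (A a (t + E) - A E t - (-ψ e).arg)| < 4 * κ := by
  have hEt : E < t := hEa.trans hat
  have hne : ∀ x y, 0 ≤ x → x < y → ψ y ≠ ψ x := fun x y hx hxy h =>
    hxy.ne' (hinj (mem_Ici.2 (by linarith)) (mem_Ici.2 hx) h)
  have hE0 := hE.lt
  have hmul : ∀ s, (ψ e - ψ s) * conj (ψ e) = 1 - ψ s * conj (ψ e) := fun s => by
    rw [sub_mul, mul_conj_of_norm_eq_one ht.norm_eq]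
  have h1 := hA.increment_left hψ le_rfl hE.lt.le (hEt.trans ht.lt) (conj (ψ e)) fun s hs => by
    rw [hmul]
    exact re_one_sub_mul_conj_pos (hE.norm_le s hs) ht.norm_eq
      (hne s e hs.1 (hs.2.trans_lt (hEt.trans ht.lt))).symm
  have h2 := hA.increment_right hψ hE.lt.le hEt ht.lt.le (-1) fun s hs => by
    have := re_one_sub_mul_conj_pos (ht.norm_le s hs) (norm_one (α := ℂ))
      (hE1 ▸ hne E s hE0.le (hEt.trans_le hs.1))
    simpa [hE1] using this
  rw [hmul, hmul, hE1, h0] at h1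
  simp only [hE1, mul_neg, mul_one, neg_sub, zero_mul, sub_zero, Complex.arg_one,
    one_mul] at h1 h2
  have h3 := arg_one_sub_add_arg_one_sub ht.norm_eq (hE1 ▸ hne E e hE0.le (hEt.trans ht.lt))
  have h4 : |(1 - ψ t).arg| < κ := hκ _ (by simpa using htρ)
  have h5 : |(1 - ψ a / ψ e).arg| < κ := hκ _ (by simpa [ht.norm_eq] using haρ)
  have hda0 : 0 < ‖1 - ψ a‖ := hd.trans_le hda
  have hquot : ∀ y ∈ uIcc (t + E) e, ‖(ψ y - ψ a) * (1 - ψ a)⁻¹ - 1‖ < ρ := by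
    intro y hy
    rw [← div_eq_mul_inv, div_sub_one (norm_pos_iff.1 hda0), norm_div, div_lt_iff₀ hda0,
      sub_sub_sub_cancel_right]
    have := ht.near y hy
    nlinarith
  have hu := abs_lt.1 (hκ _ (hquot _ left_mem_uIcc))
  have hv := abs_lt.1 (hκ _ (hquot _ right_mem_uIcc))
  have hre : ∀ y ∈ uIcc (t + E) e, 0 < ((ψ y - ψ a) * (1 - ψ a)⁻¹).re := fun y hy =>
    re_pos_of_norm_sub_one_lt ((hquot y hy).trans (by linarith))
  have h6 : |A a e - A a (t + E)| < 2 * κ := by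
    rcases le_total (t + E) e with h | h
    · rw [hA.increment_right hψ (hE0.le.trans hEa.le) (by linarith) h (1 - ψ a)⁻¹
        (by rwa [uIcc_of_le h] at hre), abs_lt]
      constructor <;> linarith [hu.1, hu.2, hv.1, hv.2]
    · rw [abs_sub_comm, hA.increment_right hψ (hE0.le.trans hEa.le) (hat.trans ht.lt) h (1 - ψ a)⁻¹
        (by rwa [uIcc_of_ge h] at hre), abs_lt]
      constructor <;> linarith [hu.1, hu.2, hv.1, hv.2]
  rw [windingAngle]
  rw [abs_lt] at *
  constructor <;> linarith

theorem secantAngle_return_sub_return (hA : IsSecantAngle ψ A) (hψ : Continuous ψ)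
    (h0 : ψ 0 = 0) (hE : 0 < E)
    (hρ : 0 < ρ) (hρ' : ρ ≤ 1 / 2) (hκ : ∀ z : ℂ, ‖z - 1‖ < ρ → |z.arg| < κ)
    (hEa : E < a) (hd : 0 < d) (hd₁ : ∀ x ∈ Icc E a, d ≤ ‖ψ x‖)
    (hd₂ : ∀ y ∈ Icc 0 E, d ≤ ‖ψ y - ψ a‖)
    {t e t' e' : ℝ} (ht : IsReturn ψ E (ρ * d / 4) t e) (hat : a < t)
    (ht' : IsReturn ψ E (ρ * d / 4) t' e') (hat' : a < t') :
    |A a (t + E) - A E t - (A a (t' + E) - A E t')| < 4 * κ := by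
  have close0 : ∀ {t e : ℝ}, IsReturn ψ E (ρ * d / 4) t e → ‖ψ t‖ < ρ * d / 4 := fun h => by
    have := h.close 0 ⟨le_rfl, hE.le⟩
    rwa [add_zero, h0, sub_zero] at this
  have hq1 : ∀ x ∈ Icc E a, ‖(ψ t - ψ x) / (ψ t' - ψ x) - 1‖ < ρ := fun x hx =>
    norm_div_sub_one_lt hρ hρ' hd (w := -ψ x) (by rw [norm_neg]; exact hd₁ x hx)
      (by simpa using close0 ht) (by simpa using close0 ht')
  have hq2 : ∀ y ∈ Icc 0 E, ‖(ψ (t + y) - ψ a) / (ψ (t' + y) - ψ a) - 1‖ < ρ := fun y hy =>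
    norm_div_sub_one_lt hρ hρ' hd (hd₂ y hy)
      (by simpa using ht.close y hy) (by simpa using ht'.close y hy)
  have h1 := hA.increment_sub hψ hEa.le (p := fun x => x) (q := fun _ => t) (p' := fun x => x)
    (q' := fun _ => t') continuous_id continuous_const continuous_id continuous_const
    (fun x hx => ⟨hE.le.trans hx.1, hx.2.trans_lt hat⟩)
    (fun x hx => ⟨hE.le.trans hx.1, hx.2.trans_lt hat'⟩)
    (fun x hx => re_pos_of_norm_sub_one_lt ((hq1 x hx).trans (by linarith)))
  have h2 := hA.increment_sub hψ hE.le (p := fun _ => a) (q := fun y => t + y) (p' := fun _ => a)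
    (q' := fun y => t' + y) continuous_const (by fun_prop) continuous_const (by fun_prop)
    (fun x hx => ⟨hE.le.trans hEa.le, by linarith [hx.1]⟩)
    (fun x hx => ⟨hE.le.trans hEa.le, by linarith [hx.1]⟩)
    (fun x hx => re_pos_of_norm_sub_one_lt ((hq2 x hx).trans (by linarith)))
  have k1 := abs_lt.1 (hκ _ (hq1 E ⟨le_rfl, hEa.le⟩))
  have k2 := abs_lt.1 (hκ _ (hq1 a ⟨hEa.le, le_rfl⟩))
  have k3 := abs_lt.1 (hκ _ (hq2 0 ⟨le_rfl, hE.le⟩))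
  have k4 := abs_lt.1 (hκ _ (hq2 E ⟨hE.le, le_rfl⟩))
  simp only [add_zero] at h2 k3
  rw [abs_lt]
  constructor <;> linarith [k1.1, k1.2, k2.1, k2.2, k3.1, k3.2, k4.1, k4.2]

variable {σ : ℝ}

theorem arg_neg_eq {z : ℂ} (hσ : σ = 1 ∨ σ = -1) (hpos : 0 < σ * z.arg) (h1 : |z.arg| < 1) :
    σ * (-z).arg = σ * z.arg - Real.pi := by
  rw [abs_lt] at h1
  rcases hσ with rfl | rfl
  · rw [arg_neg_of_arg_pos (by linarith) h1.2]; ring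
  · rw [arg_neg_of_arg_neg (by linarith)]; ring

/-- Two returns which leave the unit disc closer to `1` than an earlier return leave
on its opposite side. -/
theorem exit_side_opposite (hA : IsSecantAngle ψ A) (hψ : Continuous ψ)
    (hinj : InjOn ψ (Ici 0)) (h0 : ψ 0 = 0) (hE : IsExit ψ 0 E) (hE1 : ψ E = 1)
    (hNB : ∀ x y, 0 ≤ x → x ≤ y → ‖ψ x - 1‖ < ε → ‖ψ y‖ < ε → ∃ z ∈ Icc x y, 1 < ‖ψ z‖)
    (hρ : 0 < ρ) (hρ' : ρ ≤ 1 / 2) (hκ : ∀ z : ℂ, ‖z - 1‖ < ρ → |z.arg| < 1 / 20)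
    (ha : IsExit ψ a e) (hEa : E < a) (haρ : ‖ψ a‖ < ρ) (haε : ‖ψ a‖ < ε)
    (hσ : σ = 1 ∨ σ = -1)
    (hpos : 0 < σ * (ψ e).arg) (hsmall : |(ψ e).arg| < 1 / 20) (hsmall' : |(ψ e).arg| < ε)
    (hd : 0 < d) (hd₁ : ∀ x ∈ Icc E a, d ≤ ‖ψ x‖) (hd₂ : ∀ y ∈ Icc 0 E, d ≤ ‖ψ y - ψ a‖)
    {t₁ e₁ t₂ e₂ : ℝ} (het : e < t₁) (hee : e₁ < t₂)
    (h₁ : IsReturn ψ E (ρ * d / 4) t₁ e₁) (h₂ : IsReturn ψ E (ρ * d / 4) t₂ e₂)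
    (ht₁ : ‖ψ t₁‖ < ρ) (ht₂ : ‖ψ t₂‖ < ρ) (ht₂ε : ‖ψ t₂‖ < ε)
    (hs₁ : |(ψ e₁).arg| < |(ψ e).arg|) (hs₂ : |(ψ e₂).arg| < |(ψ e).arg|)
    (hn₂ : (ψ e₂).arg ≠ 0) : ¬ 0 < σ * (ψ e₁).arg := by
  intro hpos₁
  have hpi := Real.pi_gt_three
  have het₂ : e < t₂ := het.trans (h₁.lt.trans hee)
  have hE0 := hE.lt
  have hda : d ≤ ‖1 - ψ a‖ := hE1 ▸ hd₂ E ⟨hE0.le, le_rfl⟩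
  have hat₁ := ha.lt.trans het
  have hat₂ := ha.lt.trans het₂
  have k1 := abs_lt.1 (windingAngle_at_exit hA hψ hinj h0 hE hE1 hρ hρ' hκ hEa haρ hd hda h₁ ht₁
    hat₁)
  have k2 := abs_lt.1 (windingAngle_at_exit hA hψ hinj h0 hE hE1 hρ hρ' hκ hEa haρ hd hda h₂ ht₂
    hat₂)
  have k3 := abs_lt.1 (secantAngle_return_sub_return hA hψ h0 hE0 hρ hρ' hκ hEa hd hd₁ hd₂ h₁ hat₁
    h₂ hat₂)
  obtain ⟨u, hu, hu1, hult⟩ := exists_last_entry hψ hee.le h₁.norm_eq.ge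
  have hut : u < t₂ := lt_of_le_of_ne hu.2 fun h => by
    rw [h] at hu1
    linarith
  have hdisc : ∀ x ∈ Icc u e₂, ‖ψ x‖ ≤ 1 := by
    intro x hx
    rcases le_or_gt x t₂ with h | h
    · exact norm_le_one_of_Ioo hψ hut (fun y hy => hult y ⟨hy.1, hy.2.le⟩) x ⟨hx.1, h⟩
    · exact h₂.norm_le x ⟨h.le, hx.2⟩
  have hue : u < e₂ := hut.trans h₂.lt
  have hu1' : ‖ψ u‖ = 1 := le_antisymm (hdisc u ⟨le_rfl, hue.le⟩) hu1
  have hee₁ : e < e₁ := het.trans h₁.lt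
  have hsmall1 : |(ψ e).arg| < 1 := by linarith
  have hmono := windingAngle_mono hA hψ hinj h0 hE hE1 hNB ha hEa haε (by linarith) hσ hpos hsmall1
    hsmall' hee₁ hu.1 h₁.norm_eq.ge hu1
  have hcross := windingAngle_sub_of_crossing hA hψ hinj h0 hE hE1 ha hEa (hee₁.trans_le hu.1)
    hue.le hdisc hu1' h₂.norm_eq
  have hju : cutJump (ψ e) (ψ u) = 0 := by
    rcases cutJump_eq ha.norm_eq hu1' hσ hpos hsmall1 with ⟨h, -⟩ | ⟨-, h⟩
    · exact h
    · obtain ⟨z, hz, hz1⟩ := hNB u t₂ (h₁.nonneg.trans (h₁.lt.le.trans hu.1)) hut.le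
        (h.trans_lt hsmall') ht₂ε
      exact absurd hz1 (hdisc z ⟨hz.1, hz.2.trans h₂.lt.le⟩).not_gt
  rw [hju, sub_zero] at hcross
  have hσabs : |σ| = 1 := by rcases hσ with rfl | rfl <;> norm_num
  have abs_eq : ∀ x : ℝ, 0 < σ * x → |x| = σ * x := fun x hx => by
    rw [← abs_of_pos hx, abs_mul, hσabs, one_mul]
  have hσsq : σ * σ = 1 := by rcases hσ with rfl | rfl <;> norm_num
  have hN₁ := arg_neg_eq hσ hpos₁ (hs₁.trans hsmall1)
  have hdiff : |windingAngle ψ A a e₂ - windingAngle ψ A a e₁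
      - ((-ψ e₁).arg - (-ψ e₂).arg)| < 12 / 20 := by
    rw [abs_lt]
    constructor <;> linarith [k1.1, k1.2, k2.1, k2.2, k3.1, k3.2]
  have hdiff' := hdiff
  rw [← one_mul |_|, ← hσabs, ← abs_mul, abs_lt] at hdiff'
  have hx₁ := abs_eq _ hpos₁
  have hx := abs_eq _ hpos
  rcases lt_or_gt_of_ne (show σ * (ψ e₂).arg ≠ 0 by
    refine mul_ne_zero ?_ hn₂
    rintro rfl
    norm_num at hσsq) with hneg | hpos₂
  · have hN₂ := arg_neg_eq (σ := -σ) (by rcases hσ with rfl | rfl <;> simp) (by linarith)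
      (hs₂.trans hsmall1)
    have hx₂ : |(ψ e₂).arg| = -(σ * (ψ e₂).arg) := by
      rw [← abs_of_neg hneg, abs_mul, hσabs, one_mul]
    have hj : 0 ≤ σ * cutJump (ψ e) (ψ e₂) := by
      rcases cutJump_eq ha.norm_eq h₂.norm_eq hσ hpos hsmall1 with ⟨h, -⟩ | ⟨h, -⟩ <;> rw [h]
      · simp
      · nlinarith
    rw [← hcross] at hj
    linarith [hdiff'.1, hdiff'.2]
  · have hN₂ := arg_neg_eq hσ hpos₂ (hs₂.trans hsmall1)
    have hx₂ := abs_eq _ hpos₂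
    have hj := cutJump_of_between ha.norm_eq h₂.norm_eq hσ hsmall1 hpos₂ (by linarith)
    have hj' : σ * cutJump (ψ e) (ψ e₂) = 2 * Real.pi := by
      rw [hj]
      linear_combination 2 * Real.pi * hσsq
    rw [← hcross] at hj'
    linarith [hdiff'.1, hdiff'.2]

end Returns

section Recurrence

variable {ψ : ℝ → ℂ} {E : ℝ}

theorem exists_isReturn (hψ : Continuous ψ) (hE : 0 < E) (hE1 : ψ E = 1)
    (hlt : ∀ x ∈ Ico 0 E, ‖ψ x‖ < 1) (hout : ∀ η > 0, ∃ s ∈ Ioo E (E + η), 1 < ‖ψ s‖)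
    {t : ℕ → ℝ} (ht : Tendsto t atTop atTop)
    (hshadow : ∀ K η : ℝ, 0 < η → ∀ᶠ n in atTop, ∀ y ∈ Icc 0 K, ‖ψ (t n + y) - ψ y‖ < η) :
    ∃ e : ℕ → ℝ, ∀ η > 0, ∀ᶠ n in atTop, IsReturn ψ E η (t n) (e n) := by
  have hex : ∀ n, ∃ c, (∃ b, t n ≤ b ∧ 1 ≤ ‖ψ b‖) →
      t n ≤ c ∧ 1 ≤ ‖ψ c‖ ∧ ∀ x ∈ Ico (t n) c, ‖ψ x‖ < 1 := by
    intro n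
    by_cases h : ∃ b, t n ≤ b ∧ 1 ≤ ‖ψ b‖
    · obtain ⟨b, hb, hb1⟩ := h
      obtain ⟨c, hc, h1, h2⟩ := exists_first_exit hψ hb hb1
      exact ⟨c, fun _ => ⟨hc.1, h1, h2⟩⟩
    · exact ⟨0, fun h' => absurd h' h⟩
  choose e he using hex
  refine ⟨e, fun η hη => ?_⟩
  obtain ⟨θ, hθ, hθc⟩ := Metric.continuousAt_iff.1 (hψ.continuousAt (x := E)) (η / 2) (by positivity)
  set α := min (min θ 1) E / 2 with hα
  have hα0 : 0 < α := by positivity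
  have hαE : α < E := by
    have := min_le_right (min θ 1) E
    linarith
  have hαθ : α < θ := by
    have := (min_le_left (min θ 1) E).trans (min_le_left _ _)
    linarith
  have hα1 : α < 1 := by
    have := (min_le_left (min θ 1) E).trans (min_le_right _ _)
    linarith
  obtain ⟨s, hs, hs1⟩ := hout α hα0
  obtain ⟨β, hβ, hβle⟩ := (isCompact_Icc (a := (0 : ℝ)) (b := E - α)).exists_forall_le'
    (f := fun x => 1 - ‖ψ x‖) (by fun_prop) (a := 0) fun x hx =>
      sub_pos.2 (hlt x ⟨hx.1, by linarith [hx.2]⟩)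
  filter_upwards [ht.eventually_ge_atTop 0, hshadow (E + 1) (η / 2) (by positivity),
    hshadow (E + 1) (‖ψ s‖ - 1) (by linarith), hshadow (E + 1) β hβ] with n h0 h1 h2 h3
  have hs' : 1 ≤ ‖ψ (t n + s)‖ := by
    have h4 := h2 s ⟨by linarith [hs.1], by linarith [hs.2]⟩
    have := norm_sub_norm_le (ψ s) (ψ (t n + s))
    rw [norm_sub_rev] at this
    linarith
  obtain ⟨k1, k2, k3⟩ := he n ⟨t n + s, by linarith [hs.1], hs'⟩
  have hlow : E - α < e n - t n := by
    by_contra hle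
    have h4 := h3 (e n - t n) ⟨by linarith, by linarith⟩
    have h5 := hβle (e n - t n) ⟨by linarith, by linarith⟩
    have h6 := norm_sub_norm_le (ψ (t n + (e n - t n))) (ψ (e n - t n))
    rw [add_sub_cancel] at h4 h6
    linarith
  have hup : e n - t n < E + α := by
    by_contra hle
    exact (k3 (t n + s) ⟨by linarith [hs.1], by linarith [hs.2]⟩).not_ge hs'
  have hlt' : t n < e n := by linarith
  have hdisc := norm_le_one_of_Ioo hψ hlt' fun x hx => k3 x ⟨hx.1.le, hx.2⟩
  refine ⟨⟨h0, hlt', hdisc, le_antisymm (hdisc _ ⟨hlt'.le, le_rfl⟩) k2⟩, fun y hy =>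
    (h1 y ⟨hy.1, by linarith [hy.2]⟩).trans (by linarith), fun y hy => ?_⟩
  have hy' : |y - t n - E| ≤ α := by
    rw [abs_le]
    rcases le_total (t n + E) (e n) with h | h
    · rw [uIcc_of_le h] at hy
      constructor <;> linarith [hy.1, hy.2]
    · rw [uIcc_of_ge h] at hy
      constructor <;> linarith [hy.1, hy.2]
  have h4 : dist (ψ (y - t n)) (ψ E) < η / 2 := hθc (by rw [Real.dist_eq]; linarith)
  rw [abs_le] at hy'
  have h5 := h1 (y - t n) ⟨by linarith, by linarith⟩
  rw [add_sub_cancel] at h5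
  rw [dist_eq_norm, hE1] at h4
  have := norm_add_le (ψ y - ψ (y - t n)) (ψ (y - t n) - 1)
  rw [sub_add_sub_cancel] at this
  linarith

/-- Some arc in the unit disc goes from near `1` back to near `0`. -/
theorem exists_backward_arc (hψ : Continuous ψ) (hinj : InjOn ψ (Ici 0)) (h0 : ψ 0 = 0)
    (hE : IsExit ψ 0 E) (hE1 : ψ E = 1) {t e : ℕ → ℝ} (ht : Tendsto t atTop atTop)
    (hret : ∀ η > 0, ∀ᶠ n in atTop, IsReturn ψ E η (t n) (e n)) {ε : ℝ} (hε : 0 < ε) :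
    ∃ x y, 0 ≤ x ∧ x ≤ y ∧ ‖ψ x - 1‖ < ε ∧ ‖ψ y‖ < ε ∧ ∀ z ∈ Icc x y, ‖ψ z‖ ≤ 1 := by
  by_contra hno
  have hNB : ∀ x y, 0 ≤ x → x ≤ y → ‖ψ x - 1‖ < ε → ‖ψ y‖ < ε → ∃ z ∈ Icc x y, 1 < ‖ψ z‖ := by
    intro x y h1 h2 h3 h4
    by_contra! h5
    exact hno ⟨x, y, h1, h2, h3, h4, h5⟩
  obtain ⟨A, hA⟩ := exists_isSecantAngle hψ hinj
  obtain ⟨ρ, hρ, hρ', hκ⟩ := exists_norm_sub_one_lt_abs_arg_lt (κ := 1 / 20) (by norm_num)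
  have hE0 := hE.lt
  have ht0 : ∀ c > 0, ∀ᶠ n in atTop, ‖ψ (t n)‖ < c := fun c hc => by
    filter_upwards [hret c hc] with n hn
    have := hn.close 0 ⟨le_rfl, hE0.le⟩
    rwa [add_zero, h0, sub_zero] at this
  have harg : ∀ c > 0, ∀ᶠ n in atTop, |(ψ (e n)).arg| < c := fun c hc => by
    obtain ⟨r, hr, -, hr'⟩ := exists_norm_sub_one_lt_abs_arg_lt hc
    filter_upwards [hret r hr] with n hn
    exact hr' _ (hn.near _ right_mem_uIcc)
  let G : ℕ → Prop := fun n => IsExit ψ (t n) (e n) ∧ E < t n ∧ ‖ψ (t n)‖ < ρ ∧ ‖ψ (t n)‖ < ε ∧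
    |(ψ (e n)).arg| < 1 / 20 ∧ |(ψ (e n)).arg| < ε ∧ (ψ (e n)).arg ≠ 0
  have hG : ∀ᶠ n in atTop, G n := by
    filter_upwards [hret 1 one_pos, ht.eventually_gt_atTop E, ht0 ρ hρ, ht0 ε hε,
      harg (1 / 20) (by norm_num), harg ε hε] with n h1 h2 h3 h4 h5 h6
    refine ⟨h1.toIsExit, h2, h3, h4, h5, h6, fun h => ?_⟩
    have h7 := Complex.norm_mul_exp_arg_mul_I (ψ (e n))
    rw [h, h1.norm_eq] at h7
    have := hinj (mem_Ici.2 (h1.nonneg.trans h1.lt.le)) (mem_Ici.2 hE0.le)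
      (show ψ (e n) = ψ E by rw [hE1, ← h7]; simp)
    linarith [h1.lt]
  have hopp : ∀ n, G n → ∀ᶠ m in atTop, ∀ σ : ℝ, (σ = 1 ∨ σ = -1) → 0 < σ * (ψ (e n)).arg →
      ¬ 0 < σ * (ψ (e m)).arg := by
    rintro n ⟨n1, n2, n3, n4, n5, n6, n7⟩
    obtain ⟨d₁, hd₁, hd₁'⟩ := (isCompact_Icc (a := E) (b := t n)).exists_forall_le'
      (f := fun x => ‖ψ x‖) (by fun_prop) (a := 0) fun x hx => norm_pos_iff.2 fun h => by
        have hx0 : 0 ≤ x := hE0.le.trans hx.1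
        have := hinj (mem_Ici.2 hx0) self_mem_Ici (h.trans h0.symm)
        linarith [hx.1]
    obtain ⟨d₂, hd₂, hd₂'⟩ := (isCompact_Icc (a := 0) (b := E)).exists_forall_le'
      (f := fun x => ‖ψ x - ψ (t n)‖) (by fun_prop) (a := 0) fun x hx =>
        norm_pos_iff.2 fun h => by
          have := hinj (mem_Ici.2 hx.1) (mem_Ici.2 n1.nonneg) (sub_eq_zero.1 h)
          linarith [hx.2]
    have hd : 0 < min d₁ d₂ := lt_min hd₁ hd₂
    have hP : ∀ᶠ m in atTop, IsReturn ψ E (ρ * min d₁ d₂ / 4) (t m) (e m) ∧ G m ∧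
        |(ψ (e m)).arg| < |(ψ (e n)).arg| ∧ e n < t m := by
      filter_upwards [hret (ρ * min d₁ d₂ / 4) (by positivity), hG, harg _ (abs_pos.2 n7),
        ht.eventually_gt_atTop (e n)] with m h1 h2 h3 h4 using ⟨h1, h2, h3, h4⟩
    filter_upwards [hP] with m hm σ hσ hpos
    obtain ⟨q, hq, hmq⟩ := (hP.and (ht.eventually_gt_atTop (e m))).exists
    obtain ⟨m1, ⟨-, -, m2, -⟩, m3, m4⟩ := hm
    obtain ⟨q1, ⟨-, -, q2, q3, -, -, q4⟩, q5, -⟩ := hq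
    exact exit_side_opposite hA hψ hinj h0 hE hE1 hNB hρ hρ' hκ n1 n2 n3 n4 hσ hpos n5 n6 hd
      (fun x hx => (min_le_left _ _).trans (hd₁' x hx))
      (fun x hx => (min_le_right _ _).trans (hd₂' x hx)) m4 hmq m1 q1 m2 q2 q3 m3 q5 q4
  obtain ⟨n, hn⟩ := hG.exists
  obtain ⟨m, hm, hnm⟩ := (hG.and (hopp n hn)).exists
  obtain ⟨q, hq, hnq, hmq⟩ := (hG.and ((hopp n hn).and (hopp m hm))).exists
  obtain ⟨-, -, -, -, -, -, n0⟩ := hn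
  obtain ⟨-, -, -, -, -, -, m0⟩ := hm
  obtain ⟨-, -, -, -, -, -, q0⟩ := hq
  have a1 := hnm 1 (Or.inl rfl)
  have a2 := hnm (-1) (Or.inr rfl)
  have a3 := hnq 1 (Or.inl rfl)
  have a4 := hnq (-1) (Or.inr rfl)
  have a5 := hmq 1 (Or.inl rfl)
  have a6 := hmq (-1) (Or.inr rfl)
  simp only [one_mul, neg_one_mul, Left.neg_pos_iff, not_lt] at a1 a2 a3 a4 a5 a6
  rcases lt_or_gt_of_ne n0 with h1 | h1 <;> rcases lt_or_gt_of_ne m0 with h2 | h2 <;>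
    rcases lt_or_gt_of_ne q0 with h3 | h3 <;>
    first
      | linarith [a1 h1] | linarith [a2 h1] | linarith [a3 h1] | linarith [a4 h1]
      | linarith [a5 h2] | linarith [a6 h2]

theorem exists_exit_radius (hψ : Continuous ψ) (hinj : InjOn ψ (Ici 0)) {R : ℝ} (hR : 0 < R) :
    ∃ r E : ℝ, 0 < r ∧ r < R ∧ 0 < E ∧ ‖ψ E - ψ 0‖ = r ∧
      (∀ x ∈ Ico 0 E, ‖ψ x - ψ 0‖ < r) ∧ ∀ η > 0, ∃ s ∈ Ioo E (E + η), r < ‖ψ s - ψ 0‖ := by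
  set f : ℝ → ℝ := fun x => ‖ψ x - ψ 0‖ with hf
  have hfc : Continuous f := by fun_prop
  have hf0 : f 0 = 0 := by simp [hf]
  have hf1 : 0 < f 1 := norm_pos_iff.2 fun h => by
    have := hinj (mem_Ici.2 zero_le_one) self_mem_Ici (sub_eq_zero.1 h)
    norm_num at this
  set S : ℝ → Set ℝ := fun r => {x | 0 ≤ x ∧ min r (f 1) ≤ f x} with hS
  have hbdd : ∀ r, BddBelow (S r) := fun r => ⟨0, fun x hx => hx.1⟩
  have hmem : ∀ r, sInf (S r) ∈ S r := fun r =>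
    (isClosed_Ici.inter (isClosed_le continuous_const hfc)).csInf_mem
      ⟨1, mem_Ici.2 zero_le_one, show min r (f 1) ≤ f 1 from min_le_right _ _⟩ (hbdd r)
  have hmono : Monotone fun r => sInf (S r) := fun r r' hr =>
    csInf_le (hbdd r) ⟨(hmem r').1, (min_le_min_right _ hr).trans (hmem r').2⟩
  obtain ⟨r, hr, hr0, hr1⟩ := (hmono.countable_not_continuousAt.dense_compl ℝ).exists_between
    (show 0 < min R (f 1) by positivity)
  rw [mem_compl_iff, mem_ofPred_eq, not_not] at hr
  have hrf := hr1.trans_le (min_le_right _ _)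
  have hlt : ∀ x ∈ Ico 0 (sInf (S r)), f x < r := by
    intro x hx
    by_contra h
    exact hx.2.not_ge (csInf_le (hbdd r) ⟨hx.1, (min_le_left _ _).trans (not_lt.1 h)⟩)
  have hge : r ≤ f (sInf (S r)) := by
    have := (hmem r).2
    rwa [min_eq_left hrf.le] at this
  have hpos : 0 < sInf (S r) := by
    refine lt_of_le_of_ne (hmem r).1 fun h => ?_
    rw [← h, hf0] at hge
    linarith
  have hle : ∀ x ∈ Icc 0 (sInf (S r)), f x ≤ r := by
    intro x hx
    rw [← closure_Ico hpos.ne] at hx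
    exact closure_minimal (fun y hy => (hlt y hy).le) (isClosed_le hfc continuous_const) hx
  refine ⟨r, sInf (S r), hr0, hr1.trans_le (min_le_left _ _), hpos,
    le_antisymm (hle _ ⟨hpos.le, le_rfl⟩) hge, hlt, fun η hη => ?_⟩
  obtain ⟨θ, hθ, hθ'⟩ := Metric.continuousAt_iff.1 hr η hη
  obtain ⟨r', h1, h2⟩ := exists_between (show r < min (r + θ) (f 1) from
    lt_min (by linarith) hrf)
  have h3 := hθ' (show dist r' r < θ by
    rw [Real.dist_eq, abs_of_pos (by linarith)]
    linarith [h2.trans_le (min_le_left _ _)])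
  have h4 := (hmem r').2
  rw [min_eq_left (h2.trans_le (min_le_right _ _)).le] at h4
  refine ⟨sInf (S r'), ⟨?_, ?_⟩, h1.trans_le h4⟩
  · by_contra h
    exact (h1.trans_le h4).not_ge (hle _ ⟨(hmem r').1, not_lt.1 h⟩)
  · rw [Real.dist_eq, abs_lt] at h3
    linarith [h3.2]

/-- A recurrent injective ray in the plane runs forwards and backwards along some arc from its
origin. -/
theorem exists_reversed_arc (hψ : Continuous ψ) (hinj : InjOn ψ (Ici 0))
    {t : ℕ → ℝ} (ht : Tendsto t atTop atTop)
    (hshadow : ∀ K η : ℝ, 0 < η → ∀ᶠ n in atTop, ∀ y ∈ Icc 0 K, ‖ψ (t n + y) - ψ y‖ < η)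
    {R : ℝ} (hR : 0 < R) :
    ∃ E, 0 < E ∧ (∀ x ∈ Icc 0 E, ‖ψ x - ψ 0‖ < R) ∧ ∀ ε > 0, ∃ x y, 0 ≤ x ∧ x ≤ y ∧
      ‖ψ x - ψ E‖ < ε ∧ ‖ψ y - ψ 0‖ < ε ∧ ∀ z ∈ Icc x y, ‖ψ z - ψ 0‖ < R := by
  obtain ⟨r, E, hr, hrR, hE, hEr, hlt, hout⟩ := exists_exit_radius hψ hinj hR
  set b := ψ E - ψ 0 with hb
  have hb0 : b ≠ 0 := norm_pos_iff.1 (hEr ▸ hr)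
  set f : ℝ → ℂ := fun x => (ψ x - ψ 0) / b with hf
  have hfn : ∀ x, ‖ψ x - ψ 0‖ = ‖f x‖ * r := fun x => by
    rw [hf, norm_div, hEr, div_mul_cancel₀ _ hr.ne']
  have hfc : Continuous f := by fun_prop
  have hfinj : InjOn f (Ici 0) := fun x hx y hy h =>
    hinj hx hy (sub_left_injective ((div_left_inj' hb0).1 h))
  have hfE : f E = 1 := div_self hb0
  have hflt : ∀ x ∈ Ico 0 E, ‖f x‖ < 1 := fun x hx => by
    have := hlt x hx
    rw [hfn] at this
    nlinarith
  have hfout : ∀ η > 0, ∃ s ∈ Ioo E (E + η), 1 < ‖f s‖ := fun η hη => by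
    obtain ⟨s, hs, h⟩ := hout η hη
    rw [hfn] at h
    exact ⟨s, hs, by nlinarith⟩
  have hfsh : ∀ K η : ℝ, 0 < η → ∀ᶠ n in atTop, ∀ y ∈ Icc 0 K, ‖f (t n + y) - f y‖ < η := by
    intro K η hη
    filter_upwards [hshadow K (η * r) (by positivity)] with n hn y hy
    rw [hf, ← sub_div, sub_sub_sub_cancel_right, norm_div, hEr, div_lt_iff₀ hr]
    exact hn y hy
  obtain ⟨e, he⟩ := exists_isReturn hfc hE hfE hflt hfout ht hfsh
  have hdisc := norm_le_one_of_Ioo hfc hE fun x hx => hflt x ⟨hx.1.le, hx.2⟩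
  have hexit : IsExit f 0 E := ⟨le_rfl, hE, hdisc, by rw [hfE, norm_one]⟩
  refine ⟨E, hE, fun x hx => ?_, fun ε hε => ?_⟩
  · rw [hfn]
    nlinarith [hdisc x hx]
  · obtain ⟨x, y, h1, h2, h3, h4, h5⟩ := exists_backward_arc hfc hfinj (by simp [hf]) hexit hfE ht he
      (ε := ε / r) (by positivity)
    refine ⟨x, y, h1, h2, ?_, ?_, fun z hz => ?_⟩
    · rw [← hfE, hf, ← sub_div, sub_sub_sub_cancel_right, norm_div, hEr] at h3
      exact (div_lt_div_iff_of_pos_right hr).1 h3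
    · rw [hfn]
      exact (lt_div_iff₀ hr).1 h4
    · rw [hfn]
      nlinarith [h5 z hz]

end Recurrence

section Sphere

theorem not_injective_of_continuous_circle {g : Circle → ℝ} (hg : Continuous g) :
    ¬ Function.Injective g := by
  intro hinj
  set F : ℝ → ℝ := fun θ => g (Circle.exp θ) - g (Circle.exp (θ + Real.pi)) with hF
  have hFc : Continuous F := by fun_prop
  have hFπ : F Real.pi = -F 0 := by
    have : Circle.exp (Real.pi + Real.pi) = Circle.exp 0 := by
      rw [← two_mul, Circle.exp_two_pi, Circle.exp_zero]
    simp only [hF, this, zero_add, neg_sub]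
  have h0 : (0 : ℝ) ∈ uIcc (F 0) (F Real.pi) := by
    rw [hFπ, mem_uIcc]
    rcases le_total 0 (F 0) with h | h
    · exact Or.inr ⟨by linarith, h⟩
    · exact Or.inl ⟨h, by linarith⟩
  obtain ⟨θ, -, hθ⟩ := intermediate_value_uIcc hFc.continuousOn h0
  have h1 := hinj (sub_eq_zero.1 hθ)
  rw [Circle.exp_add, eq_comm, mul_eq_left] at h1
  have h2 := congrArg (fun z : Circle => (z : ℂ)) h1
  simp only [Circle.coe_exp, Complex.exp_pi_mul_I, Circle.coe_one] at h2
  norm_num at h2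

/-- An arc has empty interior in a surface. -/
theorem image_Icc_notMem_nhds {X : Type*} [TopologicalSpace X] [T2Space X] {φ : ℝ≥0 → X}
    (hφ : Continuous φ) (hinj : Function.Injective φ) (n : ℝ≥0) (h : OpenPartialHomeomorph X ℂ)
    {q : X} (hq : q ∈ h.source) : φ '' Icc 0 n ∉ 𝓝 q := by
  intro hmem
  have hemb : IsClosedEmbedding fun x : Icc (0 : ℝ≥0) n => φ x :=
    Continuous.isClosedEmbedding (by fun_prop) (hinj.comp Subtype.val_injective)
  have hev : ∀ᶠ z in 𝓝 (h q), z ∈ h.target ∧ h.symm z ∈ φ '' Icc 0 n := by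
    refine (h.open_target.eventually_mem (h.map_source hq)).and ?_
    refine (h.continuousAt_symm (h.map_source hq)).eventually ?_
    rwa [h.left_inv hq]
  obtain ⟨r, hr, hball⟩ := Metric.nhds_basis_closedBall.mem_iff.1 hev
  have hcirc : ∀ z : Circle, h q + r * z ∈ Metric.closedBall (h q) r := fun z => by
    rw [mem_closedBall_iff_norm, add_sub_cancel_left, norm_mul, Circle.norm_coe, mul_one,
      Complex.norm_real, Real.norm_of_nonneg hr.le]
  have hk : ∀ z : Circle, ∃ x : Icc (0 : ℝ≥0) n, φ x = h.symm (h q + r * z) := fun z => by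
    obtain ⟨x, hx, hx'⟩ := (hball (hcirc z)).2
    exact ⟨⟨x, hx⟩, hx'⟩
  choose k hk using hk
  have hkc : Continuous k := by
    rw [hemb.isInducing.continuous_iff]
    have : (fun x : Icc (0 : ℝ≥0) n => φ x) ∘ k = fun z : Circle => h.symm (h q + r * z) :=
      funext hk
    rw [this]
    exact h.continuousOn_symm.comp_continuous (by fun_prop) fun z => (hball (hcirc z)).1
  refine not_injective_of_continuous_circle (g := fun z => ((k z : ℝ≥0) : ℝ)) (by fun_prop) ?_
  intro z w hzw
  have h1 : k z = k w := Subtype.ext (NNReal.coe_injective hzw)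
  have h2 : h.symm (h q + r * z) = h.symm (h q + r * w) := by rw [← hk, ← hk, h1]
  have h3 := h.symm.injOn (hball (hcirc z)).1 (hball (hcirc w)).1 h2
  have hr' : (r : ℂ) ≠ 0 := Complex.ofReal_ne_zero.2 hr.ne'
  exact Circle.ext (mul_left_cancel₀ hr' (add_left_cancel h3))

/-- The stereographic projection of the sphere from `p` to the complex plane. -/
noncomputable def stereographicComplex (p : Metric.sphere (0 : EuclideanSpace ℝ (Fin 3)) 1) :
    OpenPartialHomeomorph (Metric.sphere (0 : EuclideanSpace ℝ (Fin 3)) 1) ℂ :=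
  haveI : Fact (Module.finrank ℝ (EuclideanSpace ℝ (Fin 3)) = 2 + 1) :=
    ⟨finrank_euclideanSpace_fin⟩
  (stereographic' 2 p).transHomeomorph
    Complex.orthonormalBasisOneI.repr.symm.toHomeomorph

theorem stereographicComplex_source (p : Metric.sphere (0 : EuclideanSpace ℝ (Fin 3)) 1) :
    (stereographicComplex p).source = {p}ᶜ := by
  simp [stereographicComplex]

theorem exists_notMem_range_sphere (φ : C(ℝ≥0, Metric.sphere (0 : EuclideanSpace ℝ (Fin 3)) 1))
    (hinj : Function.Injective φ) : ∃ p, p ∉ range φ := by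
  by_contra! hsurj
  have hU : ⋃ n : ℕ, φ '' Icc 0 (n : ℝ≥0) = univ := by
    refine eq_univ_of_forall fun p => ?_
    obtain ⟨t, rfl⟩ := hsurj p
    obtain ⟨n, hn⟩ := exists_nat_ge t
    exact mem_iUnion.2 ⟨n, t, ⟨zero_le, hn⟩, rfl⟩
  have : Nonempty (Metric.sphere (0 : EuclideanSpace ℝ (Fin 3)) 1) := ⟨φ 0⟩
  obtain ⟨n, q, hq⟩ := nonempty_interior_of_iUnion_of_closed
    (fun n => (isCompact_Icc.image φ.continuous).isClosed) hU
  obtain ⟨p, hp⟩ : ∃ p, q ≠ p := by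
    by_cases h : q = φ 0
    · exact ⟨φ 1, fun h' => zero_ne_one (hinj (h.symm.trans h'))⟩
    · exact ⟨φ 0, h⟩
  exact image_Icc_notMem_nhds φ.continuous hinj n (stereographicComplex p)
    (by rw [stereographicComplex_source]; exact hp) (mem_interior_iff_mem_nhds.1 hq)

end Sphere

section Shift

theorem continuous_bebShift_s3 {Z : Type*} [TopologicalSpace Z] (τ : ℝ≥0) :
    Continuous (bebShift τ : C(ℝ≥0, Z) → C(ℝ≥0, Z)) :=
  ContinuousMap.continuous_precomp _

theorem bebShift_comm_s3 {Z : Type*} [TopologicalSpace Z] (τ τ' : ℝ≥0) (φ : C(ℝ≥0, Z)) :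
    bebShift τ (bebShift τ' φ) = bebShift τ' (bebShift τ φ) := by
  ext t
  simp only [bebShift, ContinuousMap.comp_apply, ContinuousMap.coe_mk]
  rw [add_right_comm]

/-- Version of `exists_reversed_arc` for the compact-open topology. -/
theorem exists_reversed_arc_of_tendsto_bebShift (φ : C(ℝ≥0, ℂ)) (hinj : Function.Injective φ)
    {t : ℕ → ℝ≥0} (ht : Tendsto t atTop atTop)
    (hφ : Tendsto (fun n => bebShift (t n) φ) atTop (𝓝 φ)) (T : ℝ≥0) {R : ℝ} (hR : 0 < R) :
    ∃ T', T < T' ∧ (∀ x ∈ Icc T T', ‖φ x - φ T‖ < R) ∧ ∀ ε > 0, ∃ x y, x ≤ y ∧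
      ‖φ x - φ T'‖ < ε ∧ ‖φ y - φ T‖ < ε ∧ ∀ z ∈ Icc x y, ‖φ z - φ T‖ < R := by
  have hT : Tendsto (fun n => bebShift (t n) (bebShift T φ)) atTop (𝓝 (bebShift T φ)) := by
    simp only [bebShift_comm_s3 _ T]
    exact ((continuous_bebShift_s3 T).tendsto φ).comp hφ
  rw [ContinuousMap.tendsto_iff_forall_isCompact_tendstoUniformlyOn] at hT
  set ψ : ℝ → ℂ := fun s => φ (s.toNNReal + T) with hψdef
  have hψ : Continuous ψ := by fun_prop
  have hψinj : InjOn ψ (Ici 0) := fun x hx y hy h =>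
    (Real.toNNReal_eq_toNNReal_iff hx hy).1 (add_right_cancel (hinj h))
  have hshadow : ∀ K η : ℝ, 0 < η → ∀ᶠ n in atTop, ∀ y ∈ Icc 0 K,
      ‖ψ (t n + y) - ψ y‖ < η := by
    intro K η hη
    filter_upwards [Metric.tendstoUniformlyOn_iff.1
      (hT (Icc 0 K.toNNReal) isCompact_Icc) η hη] with n hn y hy
    have := hn y.toNNReal ⟨zero_le, Real.toNNReal_mono hy.2⟩
    rw [dist_comm, dist_eq_norm] at this
    have hadd : (t n + y : ℝ).toNNReal = y.toNNReal + t n := by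
      rw [Real.toNNReal_add (t n).coe_nonneg hy.1, Real.toNNReal_coe, add_comm]
    simpa only [hψdef, bebShift, ContinuousMap.comp_apply, ContinuousMap.coe_mk, hadd] using this
  obtain ⟨E, hE, hfor, hback⟩ := exists_reversed_arc hψ hψinj (NNReal.tendsto_coe_atTop.2 ht)
    hshadow hR
  have hval : ∀ s : ℝ≥0, T ≤ s → ψ (s - T : ℝ) = φ s := fun s hs => by
    simp only [hψdef]
    rw [← NNReal.coe_sub hs, Real.toNNReal_coe, tsub_add_cancel_of_le hs]
  have hψ0 : ψ 0 = φ T := by simp [hψdef]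
  rw [hψ0] at hfor hback
  refine ⟨E.toNNReal + T, lt_add_of_pos_left _ (Real.toNNReal_pos.2 hE), fun x hx => ?_,
    fun ε hε => ?_⟩
  · have h1 : (x : ℝ) ≤ E + T := by
      have := NNReal.coe_le_coe.2 hx.2
      rwa [NNReal.coe_add, Real.coe_toNNReal _ hE.le] at this
    have h2 : (T : ℝ) ≤ x := NNReal.coe_le_coe.2 hx.1
    rw [← hval x hx.1]
    exact hfor _ ⟨by linarith, by linarith⟩
  · obtain ⟨x, y, hx, hxy, h1, h2, h3⟩ := hback ε hε
    refine ⟨x.toNNReal + T, y.toNNReal + T, by gcongr, h1, h2, fun z hz => ?_⟩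
    have hTz : T ≤ z := le_add_self.trans hz.1
    have h4 := NNReal.coe_le_coe.2 hz.1
    have h5 := NNReal.coe_le_coe.2 hz.2
    rw [NNReal.coe_add, Real.coe_toNNReal _ hx] at h4
    rw [NNReal.coe_add, Real.coe_toNNReal _ (hx.trans hxy)] at h5
    rw [← hval z hTz]
    exact h3 _ ⟨by linarith, by linarith⟩

theorem tendsto_bebShift_comp {X Y : Type*} [TopologicalSpace X] [TopologicalSpace Y]
    {g : X → Y} {s : Set X} (hg : ContinuousOn g s) {φ : C(ℝ≥0, X)} (hs : ∀ t, φ t ∈ s)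
    {Φ : C(ℝ≥0, Y)} (hΦ : ∀ t, Φ t = g (φ t)) {t : ℕ → ℝ≥0}
    (hφ : Tendsto (fun n => bebShift (t n) φ) atTop (𝓝 φ)) :
    Tendsto (fun n => bebShift (t n) Φ) atTop (𝓝 Φ) := by
  let i : C(s, X) := ⟨Subtype.val, continuous_subtype_val⟩
  let g' : C(s, Y) := ⟨s.domRestrict g, hg.domRestrict⟩
  let φ' : C(ℝ≥0, s) := ⟨fun t => ⟨φ t, hs t⟩, by fun_prop⟩
  have h1 : Tendsto (fun n => bebShift (t n) φ') atTop (𝓝 φ') :=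
    (ContinuousMap.isInducing_postcomp i IsInducing.subtypeVal).tendsto_nhds_iff.2 hφ
  have h2 : g'.comp φ' = Φ := ContinuousMap.ext fun t => (hΦ t).symm
  have h3 := ((ContinuousMap.continuous_postcomp g').tendsto φ').comp h1
  rw [← h2]
  exact h3

end Shift

end RecurrentRays

/-- Theorem: for a continuous injective curve `φ : [0,∞) → S²` whose translates accumulate
on `φ` in the compact-open topology, for every `δ > 0` and `T ≥ 0` (with `x₁ := φ(T)`)
there is a point `x₂ ≠ x₁` such that for every `ε > 0` there are intervals `[t₁,t₂]` and
`[t₃,t₄]` along which `φ` travels from (ε-near) `x₁` to (ε-near) `x₂` and then from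
(ε-near) `x₂` back to (ε-near) `x₁`, staying within distance `δ` of `x₁` throughout. -/
theorem reversed_arc_theorem
    (φ : C(ℝ≥0, Metric.sphere (0 : EuclideanSpace ℝ (Fin 3)) 1))
    (hinj : Function.Injective φ)
    (hrec : ∃ t : ℕ → ℝ≥0, Tendsto t atTop atTop ∧
      Tendsto (fun n => bebShift (t n) φ) atTop (𝓝 φ))
    (δ : ℝ) (hδ : 0 < δ) (T : ℝ≥0) :
    ∃ x₂ : Metric.sphere (0 : EuclideanSpace ℝ (Fin 3)) 1, x₂ ≠ φ T ∧
      ∀ ε : ℝ, 0 < ε →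
        ∃ t₁ t₂ t₃ t₄ : ℝ≥0, t₁ ≤ t₂ ∧ t₃ ≤ t₄ ∧
          dist (φ t₁) (φ T) < ε ∧ dist (φ t₂) x₂ < ε ∧
          dist (φ t₃) x₂ < ε ∧ dist (φ t₄) (φ T) < ε ∧
          ∀ t : ℝ≥0, ((t₁ ≤ t ∧ t ≤ t₂) ∨ (t₃ ≤ t ∧ t ≤ t₄)) → dist (φ t) (φ T) < δ := by
  obtain ⟨t, ht, hφ⟩ := hrec
  obtain ⟨p, hp⟩ := exists_notMem_range_sphere φ hinj
  set h := stereographicComplex p with hh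
  have hsrc : ∀ s, φ s ∈ h.source := fun s => by
    rw [hh, stereographicComplex_source]
    rintro rfl
    exact hp ⟨s, rfl⟩
  let Φ : C(ℝ≥0, ℂ) := ⟨fun s => h (φ s), h.continuousOn.comp_continuous φ.continuous hsrc⟩
  have hΦinj : Function.Injective Φ := fun x y hxy => hinj (h.injOn (hsrc x) (hsrc y) hxy)
  have hΦ := tendsto_bebShift_comp (Φ := Φ) h.continuousOn hsrc (fun _ => rfl) hφ
  have hnear : ∀ s (η : ℝ), 0 < η → ∃ r > 0, ∀ x, ‖Φ x - Φ s‖ < r → dist (φ x) (φ s) < η := by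
    intro s η hη
    obtain ⟨r, hr, hr'⟩ := Metric.continuousAt_iff.1
      (h.continuousAt_symm (h.map_source (hsrc s))) η hη
    refine ⟨r, hr, fun x hx => ?_⟩
    have := hr' (x := Φ x) (by rwa [dist_eq_norm])
    rwa [show h.symm (Φ x) = φ x from h.left_inv (hsrc x), h.left_inv (hsrc s)] at this
  obtain ⟨R, hR, hR'⟩ := hnear T δ hδ
  obtain ⟨T', hT', hfor, hback⟩ :=
    exists_reversed_arc_of_tendsto_bebShift Φ hΦinj ht hΦ T hR
  refine ⟨φ T', fun h' => hT'.ne' (hinj h'), fun ε hε => ?_⟩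
  obtain ⟨r₁, hr₁, hr₁'⟩ := hnear T ε hε
  obtain ⟨r₂, hr₂, hr₂'⟩ := hnear T' ε hε
  obtain ⟨x, y, hxy, h1, h2, h3⟩ := hback (min r₁ r₂) (lt_min hr₁ hr₂)
  refine ⟨T, T', x, y, hT'.le, hxy, by rwa [dist_self], by rwa [dist_self],
    hr₂' x (h1.trans_le (min_le_right _ _)), hr₁' y (h2.trans_le (min_le_left _ _)), ?_⟩
  rintro s (hs | hs)
  · exact hR' s (hfor s hs)
  · exact hR' s (h3 s hs)
end
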